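/- Let u, v ∈ S_n with u ≤ v and u ≠ v in the Bruhat order, let x_u ∈ Y°_u, and let ε > 0. Define L_ε(u,v) = { x ∈ Y_{[u,v]} : π_u(x) = x_u and str(x) = str(x_u) + ε }, where str(x) = Σ_{i=1}^{n-1} x_{i,i+1} and Y_{[u,v]} = ∪_{w : u ≤ w ≤ v} Y°_w. Then L_ε(u,v), equipped with the subspace topology from the space of n×n real matrices, is a contractible topological space (in particular, it is nonempty). (This set realizes the link Lk(u,v) of the cell Y°_u inside Y_v, and its contractibility yields the contractibility of the closed strata of the links.) -/

import Mathlib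

open scoped Classical

namespace BruhatTNN

abbrev Mat (n : ℕ) := Matrix (Fin n) (Fin n) ℝ

/-- `x` is upper unitriangular. -/
def upperUni {n : ℕ} (x : Mat n) : Prop :=
  (∀ i, x i i = 1) ∧ ∀ i j : Fin n, j < i → x i j = 0

/-- `x` is lower unitriangular. -/
def lowerUni {n : ℕ} (x : Mat n) : Prop :=
  (∀ i, x i i = 1) ∧ ∀ i j : Fin n, i < j → x i j = 0

/-- `x` is invertible upper triangular (`x ∈ B`). -/
def upperTriInv {n : ℕ} (x : Mat n) : Prop :=
  IsUnit x.det ∧ ∀ i j : Fin n, j < i → x i j = 0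

/-- `x` is invertible lower triangular (`x ∈ B_-`). -/
def lowerTriInv {n : ℕ} (x : Mat n) : Prop :=
  IsUnit x.det ∧ ∀ i j : Fin n, i < j → x i j = 0

/-- `x` is invertible diagonal (`x ∈ H`). -/
def diagInv {n : ℕ} (x : Mat n) : Prop :=
  IsUnit x.det ∧ ∀ i j : Fin n, i ≠ j → x i j = 0

/-- `x` admits a Gaussian decomposition (`x ∈ G_0`). -/
def hasGauss {n : ℕ} (x : Mat n) : Prop :=
  ∃ a d b : Mat n, lowerUni a ∧ diagInv d ∧ upperUni b ∧ x = a * d * b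

/-- The factor `[x]_-` of the Gaussian decomposition (junk value `1` if none exists). -/
noncomputable def gaussMinus {n : ℕ} (x : Mat n) : Mat n :=
  if h : hasGauss x then h.choose else 1

/-- The factor `[x]_0` of the Gaussian decomposition (junk value `1` if none exists). -/
noncomputable def gaussDiag {n : ℕ} (x : Mat n) : Mat n :=
  if h : hasGauss x then h.choose_spec.choose else 1

/-- The factor `[x]_+` of the Gaussian decomposition (junk value `1` if none exists). -/
noncomputable def gaussPlus {n : ℕ} (x : Mat n) : Mat n :=
  if h : hasGauss x then h.choose_spec.choose_spec.choose else 1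

/-- The permutation matrix of `w`, with entry `1` in position `(w j, j)`. -/
def permMat {n : ℕ} (w : Equiv.Perm (Fin n)) : Mat n :=
  Matrix.of fun i j => if i = w j then (1 : ℝ) else 0

/-- The minor of `x` with row set `I` and column set `J` (taken in increasing order). -/
def minorOf {n : ℕ} (x : Mat n) (k : ℕ) (I J : Finset (Fin n))
    (hI : I.card = k) (hJ : J.card = k) : ℝ :=
  Matrix.det (Matrix.of fun a b : Fin k => x (I.orderEmbOfFin hI a) (J.orderEmbOfFin hJ b))

/-- `x` is totally nonnegative: all its minors are nonnegative. -/
def totNonneg {n : ℕ} (x : Mat n) : Prop :=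
  ∀ (k : ℕ) (I J : Finset (Fin n)) (hI : I.card = k) (hJ : J.card = k),
    0 ≤ minorOf x k I J hI hJ

/-- The Bruhat order on the symmetric group. -/
def bruhatLE {n : ℕ} (u v : Equiv.Perm (Fin n)) : Prop :=
  ∀ i j : Fin n,
    (Finset.univ.filter fun k : Fin n => k ≤ i ∧ j ≤ u k).card ≤
    (Finset.univ.filter fun k : Fin n => k ≤ i ∧ j ≤ v k).card

/-- The double coset `B_- w B_-`. -/
def doubleCosetBm {n : ℕ} (w : Equiv.Perm (Fin n)) : Set (Mat n) :=
  {x | ∃ b₁ b₂ : Mat n, lowerTriInv b₁ ∧ lowerTriInv b₂ ∧ x = b₁ * permMat w * b₂}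

/-- `N^w = B_- w B_- ∩ N`. -/
def Ncell {n : ℕ} (w : Equiv.Perm (Fin n)) : Set (Mat n) :=
  {x | upperUni x ∧ x ∈ doubleCosetBm w}

/-- `N_-(w) = w⁻¹ N w ∩ N_-`. -/
def Nminus {n : ℕ} (w : Equiv.Perm (Fin n)) : Set (Mat n) :=
  {x | lowerUni x ∧ ∃ y : Mat n, upperUni y ∧ x = permMat w⁻¹ * y * permMat w}

/-- `N(w) = w⁻¹ N w ∩ N`. -/
def Ngrp {n : ℕ} (w : Equiv.Perm (Fin n)) : Set (Mat n) :=
  {x | upperUni x ∧ ∃ y : Mat n, upperUni y ∧ x = permMat w⁻¹ * y * permMat w}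

/-- The totally positive cell `Y°_w = Y ∩ B_- w B_-`. -/
def Ycirc {n : ℕ} (w : Equiv.Perm (Fin n)) : Set (Mat n) :=
  {x | upperUni x ∧ totNonneg x ∧ x ∈ doubleCosetBm w}

/-- `Y_{≥ u} = ⋃_{v ≥ u} Y°_v`. -/
def Yge {n : ℕ} (u : Equiv.Perm (Fin n)) : Set (Mat n) :=
  {x | ∃ v, bruhatLE u v ∧ x ∈ Ycirc v}

/-- `A = u⁻¹ [x u⁻¹]_+ u`. -/
noncomputable def Amat {n : ℕ} (u : Equiv.Perm (Fin n)) (x : Mat n) : Mat n :=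
  permMat u⁻¹ * gaussPlus (x * permMat u⁻¹) * permMat u

/-- The projection `π_u(x) = [u [u⁻¹ [x u⁻¹]_+ u]_-]_+`. -/
noncomputable def piMap {n : ℕ} (u : Equiv.Perm (Fin n)) (x : Mat n) : Mat n :=
  gaussPlus (permMat u * gaussMinus (Amat u x))

/-- `str(M)`: the sum of the matrix entries immediately above the main diagonal. -/
def strAbove {n : ℕ} (M : Mat n) : ℝ :=
  ∑ p : Fin n × Fin n, if (p.1 : ℕ) + 1 = (p.2 : ℕ) then M p.1 p.2 else 0

/-- The number of inversions (the length) of a permutation. -/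
def invNum {n : ℕ} (w : Equiv.Perm (Fin n)) : ℕ :=
  (Finset.univ.filter fun p : Fin n × Fin n => p.1 < p.2 ∧ w p.2 < w p.1).card

section

/-! ### Triangular unipotent matrices -/

open Matrix Topology Filter

/-- `x` has unit diagonal and is triangular with respect to the order pulled back along `b`. -/
def UT {ι α : Type*} [LinearOrder α] (b : ι → α) (x : Matrix ι ι ℝ) : Prop :=
  x.BlockTriangular b ∧ ∀ i, x i i = 1

section UT
variable {ι α : Type*} [LinearOrder α] {b : ι → α} {x y : Matrix ι ι ℝ}

lemma UT.submatrix {κ : Type*} (f : κ → ι) (hx : UT b x) : UT (b ∘ f) (x.submatrix f f) :=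
  ⟨hx.1.submatrix, fun i => hx.2 (f i)⟩

lemma UT.one [DecidableEq ι] : UT b (1 : Matrix ι ι ℝ) :=
  ⟨Matrix.blockTriangular_one, fun i => Matrix.one_apply_eq i⟩

variable [Fintype ι]

lemma BlockTriangular.mul_diag (hb : Function.Injective b) (hx : x.BlockTriangular b)
    (hy : y.BlockTriangular b) (i : ι) : (x * y) i i = x i i * y i i := by
  rw [Matrix.mul_apply]
  refine Finset.sum_eq_single i (fun k _ hk => ?_) (by simp)
  rcases lt_trichotomy (b i) (b k) with h | h | h
  · rw [hy h, mul_zero]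
  · exact absurd (hb h).symm hk
  · rw [hx h, zero_mul]

lemma UT.mul (hb : Function.Injective b) (hx : UT b x) (hy : UT b y) : UT b (x * y) :=
  ⟨hx.1.mul hy.1, fun i => by
    rw [BlockTriangular.mul_diag hb hx.1 hy.1, hx.2, hy.2, one_mul]⟩

variable [DecidableEq ι]

lemma UT.det (hb : Function.Injective b) (hx : UT b x) : x.det = 1 := by
  rw [hx.1.det]
  refine Finset.prod_eq_one fun a ha => ?_
  obtain ⟨i, -, rfl⟩ := Finset.mem_image.1 ha
  have : Unique {j // b j = b i} := ⟨⟨⟨i, rfl⟩⟩, fun j => Subtype.ext (hb j.2)⟩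
  rw [Matrix.det_unique]
  exact hx.2 _

lemma UT.isUnit_det (hb : Function.Injective b) (hx : UT b x) : IsUnit x.det := by
  rw [hx.det hb]; exact isUnit_one

lemma BlockTriangular.inv' (hx : x.BlockTriangular b) (h : IsUnit x.det) :
    (x⁻¹).BlockTriangular b := by
  have := x.invertibleOfIsUnitDet h
  exact Matrix.blockTriangular_inv_of_blockTriangular hx

lemma UT.inv (hb : Function.Injective b) (hx : UT b x) : UT b x⁻¹ := by
  have h1 := BlockTriangular.inv' hx.1 (hx.isUnit_det hb)
  refine ⟨h1, fun i => ?_⟩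
  have := BlockTriangular.mul_diag hb hx.1 h1 i
  rw [Matrix.mul_nonsing_inv _ (hx.isUnit_det hb), hx.2, one_mul, Matrix.one_apply_eq] at this
  exact this.symm

end UT

variable {n : ℕ}

lemma upperUni_iff {x : Mat n} : upperUni x ↔ UT id x :=
  ⟨fun h => ⟨fun i j hij => h.2 i j hij, h.1⟩, fun h => ⟨h.2, fun _ _ hij => h.1 hij⟩⟩

lemma lowerUni_iff {x : Mat n} : lowerUni x ↔ UT OrderDual.toDual x :=
  ⟨fun h => ⟨fun i j hij => h.2 i j hij, h.1⟩, fun h => ⟨h.2, fun i j hij => h.1 (i := i) (j := j) hij⟩⟩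

lemma toDual_inj : Function.Injective (OrderDual.toDual : Fin n → (Fin n)ᵒᵈ) :=
  OrderDual.toDual.injective

lemma upperUni.mul {x y : Mat n} (hx : upperUni x) (hy : upperUni y) : upperUni (x * y) :=
  upperUni_iff.2 ((upperUni_iff.1 hx).mul Function.injective_id (upperUni_iff.1 hy))
lemma upperUni.inv {x : Mat n} (hx : upperUni x) : upperUni x⁻¹ :=
  upperUni_iff.2 ((upperUni_iff.1 hx).inv Function.injective_id)
lemma upperUni.isUnit {x : Mat n} (hx : upperUni x) : IsUnit x.det :=
  (upperUni_iff.1 hx).isUnit_det Function.injective_id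
lemma upperUni.one : upperUni (1 : Mat n) := upperUni_iff.2 UT.one
lemma lowerUni.mul {x y : Mat n} (hx : lowerUni x) (hy : lowerUni y) : lowerUni (x * y) :=
  lowerUni_iff.2 ((lowerUni_iff.1 hx).mul toDual_inj (lowerUni_iff.1 hy))
lemma lowerUni.inv {x : Mat n} (hx : lowerUni x) : lowerUni x⁻¹ :=
  lowerUni_iff.2 ((lowerUni_iff.1 hx).inv toDual_inj)
lemma lowerUni.isUnit {x : Mat n} (hx : lowerUni x) : IsUnit x.det :=
  (lowerUni_iff.1 hx).isUnit_det toDual_inj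
lemma lowerUni.one : lowerUni (1 : Mat n) := lowerUni_iff.2 UT.one

lemma lowerTriInv_iff {x : Mat n} :
    lowerTriInv x ↔ IsUnit x.det ∧ x.BlockTriangular OrderDual.toDual :=
  ⟨fun h => ⟨h.1, fun i j hij => h.2 i j hij⟩,
    fun h => ⟨h.1, fun i j hij => h.2 (i := i) (j := j) hij⟩⟩

lemma lowerTriInv.mul {x y : Mat n} (hx : lowerTriInv x) (hy : lowerTriInv y) :
    lowerTriInv (x * y) := by
  rw [lowerTriInv_iff] at *
  exact ⟨by rw [Matrix.det_mul]; exact hx.1.mul hy.1, hx.2.mul hy.2⟩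

lemma lowerTriInv.inv {x : Mat n} (hx : lowerTriInv x) : lowerTriInv x⁻¹ := by
  rw [lowerTriInv_iff] at *
  exact ⟨Matrix.isUnit_nonsing_inv_det _ hx.1, BlockTriangular.inv' hx.2 hx.1⟩

lemma lowerUni.lowerTriInv {x : Mat n} (hx : lowerUni x) : lowerTriInv x :=
  ⟨hx.isUnit, hx.2⟩

lemma lowerTriInv.one : lowerTriInv (1 : Mat n) := lowerUni.one.lowerTriInv

lemma lowerTriInv.det_eq {x : Mat n} (hx : lowerTriInv x) : x.det = ∏ i, x i i :=
  Matrix.det_of_isLowerTriangular x (lowerTriInv_iff.1 hx).2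

lemma lowerTriInv.diag_ne {x : Mat n} (hx : lowerTriInv x) (i : Fin n) : x i i ≠ 0 := by
  have h := hx.1.ne_zero
  rw [hx.det_eq] at h
  exact Finset.prod_ne_zero_iff.1 h i (Finset.mem_univ i)

lemma lowerTriInv_diagonal {d : Fin n → ℝ} (hd : ∀ i, d i ≠ 0) : lowerTriInv (diagonal d) :=
  ⟨by rw [Matrix.det_diagonal]; exact (Finset.prod_ne_zero_iff.2 fun i _ => hd i).isUnit,
    fun _ _ h => Matrix.diagonal_apply_ne _ h.ne⟩

/-- An invertible lower triangular matrix is a lower unitriangular one times a diagonal one. -/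
lemma lowerTriInv.factor {x : Mat n} (hx : lowerTriInv x) :
    lowerUni (x * diagonal (fun i => (x i i)⁻¹)) ∧ diagInv (diagonal fun i => x i i) ∧
      x = x * diagonal (fun i => (x i i)⁻¹) * diagonal (fun i => x i i) := by
  refine ⟨⟨fun i => ?_, fun i j hij => ?_⟩, ⟨?_, fun i j h => Matrix.diagonal_apply_ne _ h⟩, ?_⟩
  · rw [Matrix.mul_diagonal, mul_inv_cancel₀ (hx.diag_ne i)]
  · rw [Matrix.mul_diagonal, hx.2 i j hij, zero_mul]
  · exact (lowerTriInv_diagonal fun i => hx.diag_ne i).1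
  · rw [Matrix.mul_assoc, Matrix.diagonal_mul_diagonal]
    have : (fun i => (x i i)⁻¹ * x i i) = fun _ => 1 := by
      ext i; exact inv_mul_cancel₀ (hx.diag_ne i)
    rw [this, Matrix.diagonal_one, mul_one]

/-- Left factorization: a diagonal matrix times a lower unitriangular one. -/
lemma lowerTriInv.factor_left {x : Mat n} (hx : lowerTriInv x) :
    lowerUni (diagonal (fun i => (x i i)⁻¹) * x) ∧
      x = diagonal (fun i => x i i) * (diagonal (fun i => (x i i)⁻¹) * x) := by
  refine ⟨⟨fun i => ?_, fun i j hij => ?_⟩, ?_⟩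
  · rw [Matrix.diagonal_mul, inv_mul_cancel₀ (hx.diag_ne i)]
  · rw [Matrix.diagonal_mul, hx.2 i j hij, mul_zero]
  · rw [← Matrix.mul_assoc, Matrix.diagonal_mul_diagonal]
    have : (fun i => x i i * (x i i)⁻¹) = fun _ => 1 := by
      ext i; exact mul_inv_cancel₀ (hx.diag_ne i)
    rw [this, Matrix.diagonal_one, one_mul]

lemma upper_lower_eq_one {x : Mat n} (hu : upperUni x) (hl : x.BlockTriangular OrderDual.toDual) :
    x = 1 := by
  ext i j
  rcases lt_trichotomy i j with h | rfl | h
  · rw [hl (i := i) (j := j) h, Matrix.one_apply_ne h.ne]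
  · rw [hu.1, Matrix.one_apply_eq]
  · rw [hu.2 _ _ h, Matrix.one_apply_ne h.ne']

lemma mul_eq_iff_inv {a b c : Mat n} (ha : IsUnit a.det) : a * b = c ↔ b = a⁻¹ * c := by
  constructor
  · rintro rfl; rw [← Matrix.mul_assoc, Matrix.nonsing_inv_mul _ ha, one_mul]
  · rintro rfl; rw [← Matrix.mul_assoc, Matrix.mul_nonsing_inv _ ha, one_mul]

/-- Uniqueness of `B_- N` factorizations. -/
lemma lu_unique {l l' b b' : Mat n} (hl : lowerTriInv l) (hl' : lowerTriInv l')
    (hb : upperUni b) (hb' : upperUni b') (h : l * b = l' * b') : l = l' ∧ b = b' := by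
  have h1 : b * b'⁻¹ = l⁻¹ * l' := by
    rw [← mul_eq_iff_inv hl.1, ← Matrix.mul_assoc, h, Matrix.mul_assoc,
      Matrix.mul_nonsing_inv _ hb'.isUnit, mul_one]
  have h2 : b * b'⁻¹ = 1 := upper_lower_eq_one (hb.mul hb'.inv)
    (by rw [h1]; exact (lowerTriInv_iff.1 (hl.inv.mul hl')).2)
  have h3 : b = b' := by
    calc b = b * b'⁻¹ * b' := by
          rw [Matrix.mul_assoc, Matrix.nonsing_inv_mul _ hb'.isUnit, mul_one]
      _ = b' := by rw [h2, one_mul]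
  refine ⟨?_, h3⟩
  rw [h2] at h1
  calc l = l * 1 := (mul_one _).symm
    _ = l' := by rw [h1, ← Matrix.mul_assoc, Matrix.mul_nonsing_inv _ hl.1, one_mul]

lemma gauss_spec {x : Mat n} (h : hasGauss x) :
    lowerUni (gaussMinus x) ∧ diagInv (gaussDiag x) ∧ upperUni (gaussPlus x) ∧
      x = gaussMinus x * gaussDiag x * gaussPlus x := by
  unfold gaussMinus gaussDiag gaussPlus
  simp only [dif_pos h]
  exact h.choose_spec.choose_spec.choose_spec

lemma diagInv.lowerTriInv {d : Mat n} (h : diagInv d) : lowerTriInv d :=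
  ⟨h.1, fun i j hij => h.2 i j hij.ne⟩

lemma gaussPlus_upper (x : Mat n) : upperUni (gaussPlus x) := by
  by_cases h : hasGauss x
  · exact (gauss_spec h).2.2.1
  · unfold gaussPlus; rw [dif_neg h]; exact upperUni.one

lemma gaussMinus_lower (x : Mat n) : lowerUni (gaussMinus x) := by
  by_cases h : hasGauss x
  · exact (gauss_spec h).1
  · unfold gaussMinus; rw [dif_neg h]; exact lowerUni.one

lemma hasGauss_iff {x : Mat n} :
    hasGauss x ↔ ∃ l b : Mat n, lowerTriInv l ∧ upperUni b ∧ x = l * b := by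
  constructor
  · rintro ⟨a, d, b, ha, hd, hb, rfl⟩
    exact ⟨a * d, b, ha.lowerTriInv.mul hd.lowerTriInv, hb, rfl⟩
  · rintro ⟨l, b, hl, hb, rfl⟩
    obtain ⟨h1, h2, h3⟩ := hl.factor
    exact ⟨_, _, b, h1, h2, hb, by rw [← h3]⟩

lemma gauss_exists {x : Mat n} (h : hasGauss x) :
    ∃ l : Mat n, lowerTriInv l ∧ x = l * gaussPlus x := by
  obtain ⟨h1, h2, h3, h4⟩ := gauss_spec h
  exact ⟨_, h1.lowerTriInv.mul h2.lowerTriInv, h4⟩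

lemma gaussPlus_eq {x l b : Mat n} (hl : lowerTriInv l) (hb : upperUni b) (h : x = l * b) :
    gaussPlus x = b := by
  obtain ⟨l', hl', h'⟩ := gauss_exists (hasGauss_iff.2 ⟨l, b, hl, hb, h⟩)
  exact (lu_unique hl' hl (gaussPlus_upper x) hb (by rw [← h', h])).2

lemma gaussMinus_eq {x l b : Mat n} (hl : lowerUni l) (hb : upperUni b) (h : x = l * b) :
    gaussMinus x = l := by
  have hG := hasGauss_iff.2 ⟨l, b, hl.lowerTriInv, hb, h⟩
  obtain ⟨h1, h2, h3, h4⟩ := gauss_spec hG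
  have := (lu_unique (h1.lowerTriInv.mul h2.lowerTriInv) hl.lowerTriInv h3 hb (by rw [← h4, h])).1
  have hd : gaussDiag x = 1 := by
    ext i j
    by_cases hij : i = j
    · subst hij
      have h5 := BlockTriangular.mul_diag toDual_inj (lowerUni_iff.1 h1).1
        (lowerTriInv_iff.1 h2.lowerTriInv).2 i
      rw [this, hl.1, h1.1, one_mul] at h5
      rw [← h5, Matrix.one_apply_eq]
    · rw [h2.2 i j hij, Matrix.one_apply_ne hij]
  rw [hd, mul_one] at this
  exact this

end

section

/-! ### Gaussian decomposition -/

open Matrix Topology Filter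

variable {n : ℕ}

/-- The leading principal block of size `m`. -/
def lead (m : ℕ) (x : Mat n) : Matrix {k : Fin n // (k : ℕ) < m} {k : Fin n // (k : ℕ) < m} ℝ :=
  x.submatrix Subtype.val Subtype.val

lemma sum_subtype_lt {m : ℕ} {f : Fin n → ℝ} (hf : ∀ k : Fin n, m ≤ (k : ℕ) → f k = 0) :
    ∑ k : {k : Fin n // (k : ℕ) < m}, f k = ∑ k, f k := by
  rw [← Finset.sum_subtype (Finset.univ.filter fun k : Fin n => (k : ℕ) < m) (by simp) f]
  exact Finset.sum_filter_of_ne fun k _ hk => by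
    by_contra h
    exact hk (hf k (not_lt.1 h))

lemma lead_lower_mul (m : ℕ) {l : Mat n} (hl : l.BlockTriangular OrderDual.toDual) (x : Mat n) :
    lead m (l * x) = lead m l * lead m x := by
  ext i j
  simp only [lead, Matrix.submatrix_apply, Matrix.mul_apply]
  refine (sum_subtype_lt (f := fun k => l i k * x k j) fun k hk => ?_).symm
  rw [hl (i := i.1) (j := k) (show i.1 < k from Fin.lt_def.2 (i.2.trans_le hk)), zero_mul]

lemma lead_mul_upper (m : ℕ) (x : Mat n) {b : Mat n} (hb : b.BlockTriangular id) :
    lead m (x * b) = lead m x * lead m b := by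
  ext i j
  simp only [lead, Matrix.submatrix_apply, Matrix.mul_apply]
  refine (sum_subtype_lt (f := fun k => x i k * b k j) fun k hk => ?_).symm
  rw [hb (i := k) (j := j.1) (show j.1 < k from Fin.lt_def.2 (j.2.trans_le hk)), mul_zero]

lemma UT.lead {α : Type*} [LinearOrder α] {b : Fin n → α} {x : Mat n} (hx : UT b x) (m : ℕ) :
    UT (b ∘ Subtype.val) (lead m x) := hx.submatrix _

lemma UT.det_lead {α : Type*} [LinearOrder α] {b : Fin n → α} (hb : Function.Injective b)
    {x : Mat n} (hx : UT b x) (m : ℕ) : (BruhatTNN.lead m x).det = 1 :=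
  (hx.lead m).det (hb.comp Subtype.val_injective)

lemma lowerTriInv.det_lead {l : Mat n} (hl : lowerTriInv l) (m : ℕ) : (lead m l).det ≠ 0 := by
  have h : (lead m l).BlockTriangular OrderDual.toDual := fun i j hij =>
    hl.2 i.1 j.1 hij
  rw [Matrix.det_of_isLowerTriangular _ h]
  exact Finset.prod_ne_zero_iff.2 fun i _ => hl.diag_ne i.1

lemma lead_full (x : Mat n) : (lead n x).det = x.det := by
  have := Matrix.det_submatrix_equiv_self (Equiv.subtypeUnivEquiv (p := fun k : Fin n => (k : ℕ) < n)
    (fun k => k.2)) x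
  exact this

/-- Column-wise Gaussian elimination: `x * elimMat x` is lower triangular. -/
noncomputable def elimMat (x : Mat n) : Mat n := Matrix.of fun i j =>
  if h : i < j then -((lead j x)⁻¹ *ᵥ fun k => x k.1 j) ⟨i, h⟩ else if i = j then 1 else 0

lemma elimMat_upper (x : Mat n) : upperUni (elimMat x) := by
  refine ⟨fun i => ?_, fun i j h => ?_⟩
  · simp [elimMat]
  · simp [elimMat, h.not_gt, h.ne']

lemma mul_elimMat {x : Mat n} (h : ∀ m, (lead m x).det ≠ 0) (i j : Fin n) (hij : i < j) :
    (x * elimMat x) i j = 0 := by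
  have h1 : (lead j x) *ᵥ ((lead j x)⁻¹ *ᵥ fun k => x k.1 j) = fun k => x k.1 j := by
    rw [Matrix.mulVec_mulVec, Matrix.mul_nonsing_inv _ (h j).isUnit, Matrix.one_mulVec]
  have h2 := congrFun h1 ⟨i, hij⟩
  rw [Matrix.mul_apply]
  have h3 : ∑ k, (x i k * elimMat x k j - if k = j then x i j else 0) =
      ∑ k : {k : Fin n // (k : ℕ) < j},
        (x i k.1 * elimMat x k.1 j - if k.1 = j then x i j else 0) := by
    refine (sum_subtype_lt
      (f := fun k => x i k * elimMat x k j - if k = j then x i j else 0) fun k hk => ?_).symm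
    rcases eq_or_ne k j with rfl | hkj
    · simp [elimMat]
    · have h5 : j < k := lt_of_le_of_ne (Fin.le_def.2 hk) hkj.symm
      simp [elimMat, h5.not_gt, hkj]
  rw [Finset.sum_sub_distrib, Finset.sum_ite_eq' Finset.univ j] at h3
  simp only [Finset.mem_univ, if_true] at h3
  have h4 : ∑ k : {k : Fin n // (k : ℕ) < j},
        (x i k.1 * elimMat x k.1 j - if k.1 = j then x i j else 0) = - x i j := by
    rw [← h2]
    simp only [Matrix.mulVec, dotProduct]
    rw [← Finset.sum_neg_distrib]
    refine Finset.sum_congr rfl fun k _ => ?_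
    have hk : k.1 < j := Fin.lt_def.2 k.2
    simp [elimMat, hk, hk.ne, lead, Matrix.mulVec, dotProduct]
  linarith

lemma mul_elimMat_lower {x : Mat n} (h : ∀ m, (lead m x).det ≠ 0) :
    lowerTriInv (x * elimMat x) :=
  ⟨by rw [Matrix.det_mul]
      exact ((lead_full x ▸ h n).isUnit).mul (elimMat_upper x).isUnit, mul_elimMat h⟩

lemma mul_inv_cancel_upper {x v : Mat n} (hv : upperUni v) : x = x * v * v⁻¹ := by
  rw [Matrix.mul_assoc, Matrix.mul_nonsing_inv _ hv.isUnit, mul_one]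

lemma hasGauss_iff_lead {x : Mat n} : hasGauss x ↔ ∀ m, (lead m x).det ≠ 0 := by
  constructor
  · intro h m
    obtain ⟨l, b, hl, hb, rfl⟩ := hasGauss_iff.1 h
    rw [lead_mul_upper _ _ (upperUni_iff.1 hb).1, Matrix.det_mul,
      (upperUni_iff.1 hb).det_lead Function.injective_id, mul_one]
    exact hl.det_lead m
  · intro h
    exact hasGauss_iff.2 ⟨_, _, mul_elimMat_lower h, (elimMat_upper x).inv,
      mul_inv_cancel_upper (elimMat_upper x)⟩

lemma gaussPlus_eq_elim {x : Mat n} (h : hasGauss x) : gaussPlus x = (elimMat x)⁻¹ :=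
  gaussPlus_eq (mul_elimMat_lower (hasGauss_iff_lead.1 h)) (elimMat_upper x).inv
    (mul_inv_cancel_upper (elimMat_upper x))

section UT
variable {α : Type*} [LinearOrder α] {b : Fin n → α} {x : Mat n}

lemma UT.hasGauss (hb : Function.Injective b) (hx : UT b x) : hasGauss x :=
  hasGauss_iff_lead.2 fun m => by rw [hx.det_lead hb]; exact one_ne_zero

lemma UT.elimMat (hb : Function.Injective b) (hx : UT b x) : UT b (elimMat x) := by
  refine ⟨fun i j hij => ?_, (elimMat_upper x).1⟩
  have hne : i ≠ j := fun h => by simp [h] at hij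
  by_cases h : i < j
  · have hinv : UT (b ∘ Subtype.val) (BruhatTNN.lead j x)⁻¹ :=
      (hx.lead j).inv (hb.comp Subtype.val_injective)
    simp only [BruhatTNN.elimMat, Matrix.of_apply, dif_pos h, Matrix.mulVec, dotProduct]
    rw [Finset.sum_eq_zero, neg_zero]
    intro k _
    rcases lt_or_ge (b k.1) (b i) with hk | hk
    · rw [hinv.1 (i := ⟨i, h⟩) (j := k) hk, zero_mul]
    · rw [hx.1 (hij.trans_le hk), mul_zero]
  · simp [BruhatTNN.elimMat, h, hne]

lemma UT.gaussPlus (hb : Function.Injective b) (hx : UT b x) : UT b (gaussPlus x) := by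
  rw [gaussPlus_eq_elim (hx.hasGauss hb)]
  exact (hx.elimMat hb).inv hb

lemma UT.gauss_mul (hb : Function.Injective b) (hx : UT b x) :
    UT b (gaussMinus x) ∧ x = gaussMinus x * BruhatTNN.gaussPlus x := by
  have h1 : UT b (x * BruhatTNN.elimMat x) := hx.mul hb (hx.elimMat hb)
  have h2 : lowerUni (x * BruhatTNN.elimMat x) :=
    ⟨h1.2, (mul_elimMat_lower (hasGauss_iff_lead.1 (hx.hasGauss hb))).2⟩
  have h3 := gaussMinus_eq h2 (elimMat_upper x).inv (mul_inv_cancel_upper (elimMat_upper x))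
  rw [h3, gaussPlus_eq_elim (hx.hasGauss hb)]
  exact ⟨h1, mul_inv_cancel_upper (elimMat_upper x)⟩

end UT

lemma continuous_lead_det (m : ℕ) : Continuous fun x : Mat n => (lead m x).det :=
  Continuous.matrix_det (continuous_id.matrix_submatrix _ _)

lemma lead_det_ge {m : ℕ} (hm : n ≤ m) (x : Mat n) : (lead m x).det = x.det :=
  Matrix.det_submatrix_equiv_self (Equiv.subtypeUnivEquiv (p := fun k : Fin n => (k : ℕ) < m)
    (fun k => k.2.trans_le hm)) x

lemma isOpen_hasGauss : IsOpen {x : Mat n | hasGauss x} := by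
  have : {x : Mat n | hasGauss x} = ⋂ m : Fin (n + 1), {x | (lead m x).det ≠ 0} := by
    ext x
    simp only [Set.mem_ofPred_eq, hasGauss_iff_lead, Set.mem_iInter]
    refine ⟨fun h m => h m, fun h m => ?_⟩
    rcases le_or_gt n m with hm | hm
    · rw [lead_det_ge hm, ← lead_full]
      exact h (Fin.last n)
    · exact h ⟨m, by omega⟩
  rw [this]
  exact isOpen_iInter_of_finite fun m => isOpen_ne.preimage (continuous_lead_det m)

lemma continuousAt_inv {ι : Type*} [Fintype ι] [DecidableEq ι] {x : Matrix ι ι ℝ}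
    (hx : IsUnit x.det) : ContinuousAt Inv.inv x := by
  refine continuousAt_matrix_inv x ?_
  simpa only [Ring.inverse_eq_inv'] using continuousAt_inv₀ hx.ne_zero

lemma continuousAt_elimMat {x : Mat n} (h : hasGauss x) : ContinuousAt elimMat x := by
  refine continuousAt_pi.2 fun i => continuousAt_pi.2 fun j => ?_
  by_cases hij : i < j
  · simp only [elimMat, Matrix.of_apply, dif_pos hij, Matrix.mulVec, dotProduct]
    refine (tendsto_finsetSum _ fun k _ => ?_).neg
    refine ContinuousAt.mul ?_ ((continuous_apply_apply k.1 j).continuousAt)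
    have h1 : ContinuousAt (fun y : Mat n => (lead j y)⁻¹) x :=
      ContinuousAt.comp (f := fun y : Mat n => lead j y) (g := Inv.inv)
        (continuousAt_inv (hasGauss_iff_lead.1 h j).isUnit)
        (continuous_id.matrix_submatrix _ _).continuousAt
    exact continuousAt_pi.1 (continuousAt_pi.1 h1 _) _
  · simp only [elimMat, Matrix.of_apply, dif_neg hij]
    exact continuousAt_const

lemma continuousAt_gaussPlus {x : Mat n} (h : hasGauss x) : ContinuousAt gaussPlus x := by
  have h1 : ContinuousAt (fun y => (elimMat y)⁻¹) x :=
    ContinuousAt.comp (f := elimMat) (g := Inv.inv)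
      (continuousAt_inv (elimMat_upper x).isUnit) (continuousAt_elimMat h)
  refine h1.congr ?_
  filter_upwards [isOpen_hasGauss.mem_nhds h] with y hy
  exact (gaussPlus_eq_elim hy).symm

end

section

/-! ### Double cosets, the projection and its coordinates -/

open Matrix Topology Filter

variable {n : ℕ} {u w : Equiv.Perm (Fin n)}

lemma permMat_mul_left (u : Equiv.Perm (Fin n)) (M : Mat n) :
    permMat u * M = M.submatrix (u⁻¹ : Equiv.Perm (Fin n)) id := by
  ext i j
  rw [Matrix.mul_apply, Finset.sum_eq_single ((u⁻¹ : Equiv.Perm (Fin n)) i)]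
  · simp [permMat]
  · intro k _ hk
    have : i ≠ u k := fun h => hk (by simp [h])
    simp [permMat, this]
  · simp

lemma permMat_mul_right (u : Equiv.Perm (Fin n)) (M : Mat n) :
    M * permMat u = M.submatrix id u := by
  ext i j
  rw [Matrix.mul_apply, Finset.sum_eq_single (u j)]
  · simp [permMat]
  · intro k _ hk
    simp [permMat, hk]
  · simp

lemma permMat_one : permMat (1 : Equiv.Perm (Fin n)) = 1 := by
  ext i j; simp only [permMat, Matrix.one_apply, Matrix.of_apply, Equiv.Perm.one_apply]; congr

lemma permMat_mul (u w : Equiv.Perm (Fin n)) : permMat u * permMat w = permMat (u * w) := by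
  rw [permMat_mul_right]; ext i j
  simp only [permMat, Matrix.of_apply, Matrix.submatrix_apply, id, Equiv.Perm.mul_apply]
  congr

lemma permMat_mul_inv (u : Equiv.Perm (Fin n)) : permMat u * permMat u⁻¹ = 1 := by
  rw [permMat_mul, mul_inv_cancel, permMat_one]

lemma permMat_inv_mul (u : Equiv.Perm (Fin n)) : permMat u⁻¹ * permMat u = 1 := by
  rw [permMat_mul, inv_mul_cancel, permMat_one]

lemma permMat_conj (u : Equiv.Perm (Fin n)) (M : Mat n) :
    permMat u * M * permMat u⁻¹ =
      M.submatrix (u⁻¹ : Equiv.Perm (Fin n)) (u⁻¹ : Equiv.Perm (Fin n)) := by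
  rw [permMat_mul_left, permMat_mul_right]; rfl

lemma permMat_conj' (u : Equiv.Perm (Fin n)) (M : Mat n) :
    permMat u⁻¹ * M * permMat u = M.submatrix u u := by
  rw [permMat_mul_left, permMat_mul_right]; simp

lemma UT.conj_inv {A : Mat n} (h : UT u A) : upperUni (permMat u * A * permMat u⁻¹) := by
  rw [permMat_conj, upperUni_iff]
  have := h.submatrix (u⁻¹ : Equiv.Perm (Fin n))
  convert this using 1
  ext i; simp

lemma upperUni.conj {A : Mat n} (h : upperUni A) : UT u (permMat u⁻¹ * A * permMat u) := by
  rw [permMat_conj']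
  exact (upperUni_iff.1 h).submatrix u

/-- The set of `x` such that `x u⁻¹` has a Gaussian decomposition. -/
def Gge (u : Equiv.Perm (Fin n)) : Set (Mat n) := {x | hasGauss (x * permMat u⁻¹)}

lemma isOpen_Gge : IsOpen (Gge u) :=
  isOpen_hasGauss.preimage (continuous_id.matrix_mul continuous_const)

lemma UT_Amat (x : Mat n) : UT u (Amat u x) := (gaussPlus_upper _).conj

lemma Gge_of_eq {x β A : Mat n} (hβ : lowerTriInv β) (hA : UT u A) (h : x = β * permMat u * A) :
    x ∈ Gge u ∧ Amat u x = A := by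
  have h1 : x * permMat u⁻¹ = β * (permMat u * A * permMat u⁻¹) := by
    rw [h]; simp only [Matrix.mul_assoc]
  refine ⟨hasGauss_iff.2 ⟨_, _, hβ, hA.conj_inv, h1⟩, ?_⟩
  rw [Amat, gaussPlus_eq hβ hA.conj_inv h1]
  calc permMat u⁻¹ * (permMat u * A * permMat u⁻¹) * permMat u
      = (permMat u⁻¹ * permMat u) * A * (permMat u⁻¹ * permMat u) := by
        simp only [Matrix.mul_assoc]
    _ = A := by rw [permMat_inv_mul, one_mul, mul_one]

lemma Gge_exists {x : Mat n} (h : x ∈ Gge u) :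
    ∃ β, lowerTriInv β ∧ x = β * permMat u * Amat u x := by
  obtain ⟨l, hl, h1⟩ := gauss_exists h
  refine ⟨l, hl, ?_⟩
  calc x = x * (permMat u⁻¹ * permMat u) := by rw [permMat_inv_mul, mul_one]
    _ = l * gaussPlus (x * permMat u⁻¹) * permMat u := by rw [← h1, Matrix.mul_assoc]
    _ = l * (permMat u * permMat u⁻¹) * gaussPlus (x * permMat u⁻¹) * permMat u := by
        rw [permMat_mul_inv, mul_one]
    _ = _ := by rw [Amat]; simp only [Matrix.mul_assoc]

lemma lowerUni.split (w : Equiv.Perm (Fin n)) {L : Mat n} (hL : lowerUni L) :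
    ∃ L₁ L₂, lowerUni L₁ ∧ UT (OrderDual.toDual ∘ w) L₁ ∧ lowerUni L₂ ∧ UT w L₂ ∧
      L = L₁ * L₂ := by
  have hinj : Function.Injective (OrderDual.toDual ∘ (w⁻¹ : Equiv.Perm (Fin n))) :=
    toDual_inj.comp (Equiv.injective _)
  have hM := (lowerUni_iff.1 hL).submatrix (w⁻¹ : Equiv.Perm (Fin n))
  set M := L.submatrix (w⁻¹ : Equiv.Perm (Fin n)) (w⁻¹ : Equiv.Perm (Fin n)) with hMdef
  obtain ⟨h1, h2⟩ := hM.gauss_mul hinj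
  have h3 := hM.gaussPlus hinj
  have e : (OrderDual.toDual ∘ (w⁻¹ : Equiv.Perm (Fin n))) ∘ w = OrderDual.toDual := by
    ext i; simp
  refine ⟨(gaussMinus M).submatrix w w, (gaussPlus M).submatrix w w, ?_, ?_, ?_, ?_, ?_⟩
  · rw [lowerUni_iff, ← e]; exact h1.submatrix w
  · exact (lowerUni_iff.1 (gaussMinus_lower M)).submatrix w
  · rw [lowerUni_iff, ← e]; exact h3.submatrix w
  · exact (upperUni_iff.1 (gaussPlus_upper M)).submatrix w
  · rw [Matrix.submatrix_mul_equiv, ← h2, hMdef]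
    ext i j; simp

lemma UT.conj_lower {L : Mat n} (h : UT (OrderDual.toDual ∘ w) L) :
    lowerUni (permMat w * L * permMat w⁻¹) := by
  rw [permMat_conj, lowerUni_iff]
  convert h.submatrix (w⁻¹ : Equiv.Perm (Fin n)) using 1
  ext i; simp

lemma permMat_comm' (w : Equiv.Perm (Fin n)) (L : Mat n) :
    permMat w⁻¹ * (permMat w * L) = L := by
  rw [← Matrix.mul_assoc, permMat_inv_mul, one_mul]

lemma permMat_diagonal (w : Equiv.Perm (Fin n)) (d : Fin n → ℝ) :
    permMat w * diagonal d = diagonal (d ∘ (w⁻¹ : Equiv.Perm (Fin n))) * permMat w := by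
  ext i j
  rw [Matrix.mul_diagonal, Matrix.diagonal_mul]
  by_cases h : i = w j
  · simp [h, permMat]
  · simp [h, permMat]

lemma doubleCoset_Gge {y : Mat n} (h : y ∈ doubleCosetBm w) :
    y ∈ Gge w ∧ lowerUni (Amat w y) := by
  obtain ⟨b₁, b₂, h1, h2, rfl⟩ := h
  obtain ⟨h3, h4⟩ := h2.factor_left
  obtain ⟨L₁, L₂, hL1, hL1', hL2, hL2', hL⟩ := h3.split w
  have hd : lowerTriInv (diagonal ((fun i => b₂ i i) ∘ (w⁻¹ : Equiv.Perm (Fin n)))) :=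
    lowerTriInv_diagonal fun i => h2.diag_ne _
  have := Gge_of_eq (x := b₁ * permMat w * b₂)
    ((h1.mul hd).mul hL1'.conj_lower.lowerTriInv) hL2' (by
      conv_lhs => rw [h4, hL]
      calc b₁ * permMat w * (diagonal (fun i => b₂ i i) * (L₁ * L₂))
          = b₁ * (permMat w * diagonal (fun i => b₂ i i)) * L₁ * L₂ := by
            simp only [Matrix.mul_assoc]
        _ = b₁ * diagonal ((fun i => b₂ i i) ∘ (w⁻¹ : Equiv.Perm (Fin n))) *
            (permMat w * L₁) * L₂ := by rw [permMat_diagonal]; simp only [Matrix.mul_assoc]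
        _ = _ := by simp only [Matrix.mul_assoc, permMat_comm' w])
  exact ⟨this.1, this.2 ▸ hL2⟩

lemma mem_doubleCoset {x β A : Mat n} (hβ : lowerTriInv β) (hA : lowerTriInv A)
    (h : x = β * permMat u * A) : x ∈ doubleCosetBm u := ⟨β, A, hβ, hA, h⟩

lemma doubleCoset_mul {x β γ : Mat n} (h : x ∈ doubleCosetBm w) (hβ : lowerTriInv β)
    (hγ : lowerTriInv γ) : β * x * γ ∈ doubleCosetBm w := by
  obtain ⟨b₁, b₂, h1, h2, rfl⟩ := h
  exact ⟨β * b₁, b₂ * γ, hβ.mul h1, h2.mul hγ, by simp only [Matrix.mul_assoc]⟩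

lemma doubleCoset_mul_iff {x β γ : Mat n} (hβ : lowerTriInv β)
    (hγ : lowerTriInv γ) : β * x * γ ∈ doubleCosetBm w ↔ x ∈ doubleCosetBm w := by
  refine ⟨fun h => ?_, fun h => doubleCoset_mul h hβ hγ⟩
  have := doubleCoset_mul h hβ.inv hγ.inv
  have e : β⁻¹ * (β * x * γ) * γ⁻¹ = (β⁻¹ * β) * x * (γ * γ⁻¹) := by
    simp only [Matrix.mul_assoc]
  rwa [e, Matrix.nonsing_inv_mul _ hβ.1, Matrix.mul_nonsing_inv _ hγ.1, one_mul, mul_one] at this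

lemma doubleCoset_iff {y : Mat n} : y ∈ doubleCosetBm w ↔ y ∈ Gge w ∧ lowerUni (Amat w y) := by
  refine ⟨doubleCoset_Gge, fun ⟨h1, h2⟩ => ?_⟩
  obtain ⟨β, hβ, h⟩ := Gge_exists h1
  exact mem_doubleCoset hβ h2.lowerTriInv h

/-- The group `N(u) = u⁻¹ N u ∩ N`. -/
def NU (u : Equiv.Perm (Fin n)) : Set (Mat n) := {p | UT u p ∧ upperUni p}

lemma upperUni.inv_inv {x : Mat n} (h : upperUni x) : x⁻¹⁻¹ = x :=
  Matrix.nonsing_inv_nonsing_inv _ h.isUnit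

lemma UT.split {A : Mat n} (h : UT u A) :
    UT u (gaussMinus A) ∧ lowerUni (gaussMinus A) ∧ BruhatTNN.gaussPlus A ∈ NU u ∧
      A = gaussMinus A * BruhatTNN.gaussPlus A :=
  ⟨(h.gauss_mul u.injective).1, gaussMinus_lower A, ⟨h.gaussPlus u.injective, gaussPlus_upper A⟩,
    (h.gauss_mul u.injective).2⟩

lemma NU_inv {p : Mat n} (h : p ∈ NU u) : p⁻¹ ∈ NU u := ⟨h.1.inv u.injective, h.2.inv⟩
lemma NU_one : (1 : Mat n) ∈ NU u := ⟨UT.one, upperUni.one⟩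

lemma piMap_spec {x : Mat n} (hx : upperUni x) (hu : x ∈ Gge u) :
    piMap u x = x * (gaussPlus (Amat u x))⁻¹ ∧ piMap u x ∈ Ncell u ∧
      Amat u (piMap u x) = gaussMinus (Amat u x) := by
  obtain ⟨β, hβ, h⟩ := Gge_exists hu
  obtain ⟨h1, h2, h3, h4⟩ := (UT_Amat (u := u) x).split
  set a := gaussMinus (Amat u x)
  set m := gaussPlus (Amat u x)
  have e1 : x * m⁻¹ = β * permMat u * a := by
    conv_lhs => rw [h, h4]
    calc β * permMat u * (a * m) * m⁻¹ = β * permMat u * a * (m * m⁻¹) := by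
          simp only [Matrix.mul_assoc]
      _ = _ := by rw [Matrix.mul_nonsing_inv _ h3.2.isUnit, mul_one]
  have e2 : piMap u x = x * m⁻¹ :=
    gaussPlus_eq hβ.inv (hx.mul h3.2.inv)
      (by rw [← mul_eq_iff_inv hβ.1, e1, Matrix.mul_assoc])
  refine ⟨e2, ⟨?_, mem_doubleCoset hβ h2.lowerTriInv (e2.trans e1)⟩, ?_⟩
  · rw [e2]; exact hx.mul h3.2.inv
  · rw [e2]; exact (Gge_of_eq hβ h1 e1).2

lemma Amat_mul {x m : Mat n} (hu : x ∈ Gge u) (hm : UT u m) :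
    x * m ∈ Gge u ∧ Amat u (x * m) = Amat u x * m := by
  obtain ⟨β, hβ, h⟩ := Gge_exists hu
  exact Gge_of_eq hβ ((UT_Amat x).mul u.injective hm) (by
    conv_lhs => rw [h]
    rw [Matrix.mul_assoc])

lemma Ncell_Gge {x : Mat n} (h : x ∈ Ncell u) : x ∈ Gge u := (doubleCoset_Gge h.2).1
lemma Ncell_lower {x : Mat n} (h : x ∈ Ncell u) : lowerUni (Amat u x) :=
  (doubleCoset_Gge h.2).2

/-- The projection of `x` to `N(u)` along the decomposition `Amat u x = p c` with `c` lower. -/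
noncomputable def pc (u : Equiv.Perm (Fin n)) (x : Mat n) : Mat n := (gaussPlus (Amat u x)⁻¹)⁻¹

/-- The point with projections `x'` and `p`. -/
noncomputable def XX (u : Equiv.Perm (Fin n)) (x' p : Mat n) : Mat n :=
  x' * (gaussPlus (p⁻¹ * Amat u x'))⁻¹

lemma pc_mem (x : Mat n) : pc u x ∈ NU u :=
  NU_inv ⟨((UT_Amat x).inv u.injective).gaussPlus u.injective, gaussPlus_upper _⟩

lemma upper_gauss {m : Mat n} {a : Mat n} (ha : lowerUni a) (hm : upperUni m) :
    gaussPlus (a * m) = m := gaussPlus_eq ha.lowerTriInv hm rfl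

lemma piMap_mul {x' m : Mat n} (hx : x' ∈ Ncell u) (hm : m ∈ NU u) : piMap u (x' * m) = x' := by
  have h := Amat_mul (Ncell_Gge hx) hm.1
  rw [(piMap_spec (hx.1.mul hm.2) h.1).1, h.2, upper_gauss (Ncell_lower hx) hm.2, Matrix.mul_assoc,
    Matrix.mul_nonsing_inv _ hm.2.isUnit, mul_one]

lemma XX_spec {x' p : Mat n} (hp : p ∈ NU u) :
    ∃ m c, m ∈ NU u ∧ lowerUni c ∧ UT u c ∧ Amat u x' * m = p * c ∧ XX u x' p = x' * m ∧
      m = (gaussPlus (p⁻¹ * Amat u x'))⁻¹ := by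
  have hM : UT u (p⁻¹ * Amat u x') := (hp.1.inv u.injective).mul u.injective (UT_Amat x')
  obtain ⟨h1, h2, h3, h4⟩ := hM.split
  refine ⟨_, _, NU_inv h3, h2, h1, ?_, rfl, rfl⟩
  set c := gaussMinus (p⁻¹ * Amat u x')
  set g := gaussPlus (p⁻¹ * Amat u x')
  have : Amat u x' = p * (c * g) := by
    rw [← h4, ← Matrix.mul_assoc, Matrix.mul_nonsing_inv _ hp.2.isUnit, one_mul]
  rw [this]
  calc p * (c * g) * g⁻¹ = p * c * (g * g⁻¹) := by simp only [Matrix.mul_assoc]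
    _ = p * c := by rw [Matrix.mul_nonsing_inv _ h3.2.isUnit, mul_one]

lemma XX_upper {x' p : Mat n} (hx : x' ∈ Ncell u) (hp : p ∈ NU u) : upperUni (XX u x' p) := by
  obtain ⟨m, c, hm, hc, hc', h1, h2, -⟩ := XX_spec (x' := x') hp
  rw [h2]; exact hx.1.mul hm.2

lemma piMap_XX {x' p : Mat n} (hx : x' ∈ Ncell u) (hp : p ∈ NU u) : piMap u (XX u x' p) = x' := by
  obtain ⟨m, c, hm, hc, hc', h1, h2, -⟩ := XX_spec (x' := x') hp
  rw [h2]; exact piMap_mul hx hm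

lemma pc_XX {x' p : Mat n} (hx : x' ∈ Ncell u) (hp : p ∈ NU u) : pc u (XX u x' p) = p := by
  obtain ⟨m, c, hm, hc, hc', h1, h2, -⟩ := XX_spec (x' := x') hp
  rw [h2, pc, (Amat_mul (Ncell_Gge hx) hm.1).2, h1, Matrix.mul_inv_rev, upper_gauss hc.inv hp.2.inv,
    hp.2.inv_inv]

lemma XX_mem_iff {x' p : Mat n} (hx : x' ∈ Ncell u) (hp : p ∈ NU u) :
    XX u x' p ∈ doubleCosetBm w ↔ permMat u * p ∈ doubleCosetBm w := by
  obtain ⟨m, c, hm, hc, hc', h1, h2, -⟩ := XX_spec (x' := x') hp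
  obtain ⟨β, hβ, h⟩ := Gge_exists (Ncell_Gge hx)
  have e : XX u x' p = β * (permMat u * p) * c := by
    rw [h2]; conv_lhs => rw [h]
    calc β * permMat u * Amat u x' * m = β * permMat u * (Amat u x' * m) := by
          simp only [Matrix.mul_assoc]
      _ = _ := by rw [h1]; simp only [Matrix.mul_assoc]
  rw [e, doubleCoset_mul_iff hβ hc.lowerTriInv]

lemma XX_pc {x : Mat n} (hx : upperUni x) (hu : x ∈ Gge u) : XX u (piMap u x) (pc u x) = x := by
  obtain ⟨e1, e2, e3⟩ := piMap_spec hx hu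
  obtain ⟨h1, h2, h3, h4⟩ := (UT_Amat (u := u) x).split
  obtain ⟨k1, k2, k3, k4⟩ := ((UT_Amat (u := u) x).inv u.injective).split
  rw [XX, e3, pc, k3.2.inv_inv]
  set A := Amat u x
  set a := gaussMinus A
  set m := gaussPlus A
  set g := gaussPlus A⁻¹
  set c := gaussMinus A⁻¹
  have hA : IsUnit A.det := (UT_Amat x).isUnit_det u.injective
  have e4 : g * a = c⁻¹ * m⁻¹ := by
    have : a = A * m⁻¹ := by
      conv_rhs => rw [h4, Matrix.mul_assoc, Matrix.mul_nonsing_inv _ h3.2.isUnit, mul_one]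
    rw [this, ← mul_eq_iff_inv k2.isUnit]
    calc c * (g * (A * m⁻¹)) = (c * g) * A * m⁻¹ := by simp only [Matrix.mul_assoc]
      _ = m⁻¹ := by rw [← k4, Matrix.nonsing_inv_mul _ hA, one_mul]
  rw [e4, upper_gauss k2.inv h3.2.inv, e1, Matrix.mul_assoc,
    Matrix.mul_nonsing_inv _ h3.2.inv.isUnit, mul_one]

lemma XX_one {x' : Mat n} (hx : x' ∈ Ncell u) : XX u x' 1 = x' := by
  have : gaussPlus (1⁻¹ * Amat u x') = 1 :=
    gaussPlus_eq (Ncell_lower hx).lowerTriInv upperUni.one (by simp)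
  rw [XX, this]; simp

lemma piMap_self {x : Mat n} (hx : x ∈ Ncell u) : piMap u x = x := by
  simpa using piMap_mul hx (m := 1) NU_one

section continuity

lemma continuousAt_Amat {x : Mat n} (hx : x ∈ Gge u) : ContinuousAt (Amat u) x := by
  have h1 : ContinuousAt (fun y : Mat n => gaussPlus (y * permMat u⁻¹)) x :=
    ContinuousAt.comp (f := fun y : Mat n => y * permMat u⁻¹) (g := gaussPlus)
      (continuousAt_gaussPlus hx) (continuous_id.matrix_mul continuous_const).continuousAt
  have h2 : Continuous fun y : Mat n => permMat u⁻¹ * y * permMat u :=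
    (continuous_const.matrix_mul continuous_id).matrix_mul continuous_const
  exact ContinuousAt.comp (g := fun y : Mat n => permMat u⁻¹ * y * permMat u)
    h2.continuousAt h1

lemma ContinuousAt.matMul {Z : Type*} [TopologicalSpace Z] {f g : Z → Mat n} {z : Z}
    (hf : ContinuousAt f z) (hg : ContinuousAt g z) : ContinuousAt (fun z => f z * g z) z :=
  ContinuousAt.comp (f := fun z => (f z, g z)) (g := fun q : Mat n × Mat n => q.1 * q.2)
    (continuous_fst.matrix_mul continuous_snd).continuousAt (hf.prodMk hg)

lemma continuousAt_piMap {x : Mat n} (hx : x ∈ Gge u) :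
    ContinuousAt (fun x => x * (gaussPlus (Amat u x))⁻¹) x := by
  refine ContinuousAt.matMul continuousAt_id ?_
  refine ContinuousAt.comp (g := Inv.inv) (continuousAt_inv (gaussPlus_upper _).isUnit) ?_
  exact ContinuousAt.comp (g := gaussPlus)
    (continuousAt_gaussPlus ((UT_Amat x).hasGauss u.injective)) (continuousAt_Amat hx)

lemma continuousOn_piMap : ContinuousOn (piMap u) ({x | upperUni x} ∩ Gge u) := by
  intro x hx
  refine ((continuousAt_piMap hx.2).continuousWithinAt).congr (fun y hy => ?_) ?_
  · exact (piMap_spec hy.1 hy.2).1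
  · exact (piMap_spec hx.1 hx.2).1

lemma continuousAt_pc {x : Mat n} (hx : x ∈ Gge u) : ContinuousAt (pc u) x := by
  refine ContinuousAt.comp (g := Inv.inv) (continuousAt_inv (gaussPlus_upper _).isUnit) ?_
  refine ContinuousAt.comp (g := gaussPlus) (continuousAt_gaussPlus
    (((UT_Amat x).inv u.injective).hasGauss u.injective)) ?_
  exact ContinuousAt.comp (g := Inv.inv)
    (continuousAt_inv ((UT_Amat x).isUnit_det u.injective)) (continuousAt_Amat hx)

lemma continuousAt_XX {x' p : Mat n} (hx : x' ∈ Gge u) (hp : p ∈ NU u) :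
    ContinuousAt (fun q : Mat n × Mat n => XX u q.1 q.2) (x', p) := by
  refine ContinuousAt.matMul continuousAt_fst ?_
  refine ContinuousAt.comp (g := Inv.inv) (continuousAt_inv (gaussPlus_upper _).isUnit) ?_
  refine ContinuousAt.comp (g := gaussPlus) (continuousAt_gaussPlus
    (((hp.1.inv u.injective).mul u.injective (UT_Amat x')).hasGauss u.injective)) ?_
  refine ContinuousAt.matMul ?_ ?_
  · exact ContinuousAt.comp (g := Inv.inv) (f := Prod.snd)
      (continuousAt_inv (x := p) hp.2.isUnit) continuousAt_snd
  · exact ContinuousAt.comp (g := Amat u) (f := Prod.fst) (continuousAt_Amat (x := x') hx)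
      continuousAt_fst

end continuity

/-- Conjugation by a diagonal matrix. -/
noncomputable def cj (h : Fin n → ℝ) (x : Mat n) : Mat n :=
  diagonal h * x * diagonal (fun i => (h i)⁻¹)

section cj
variable {h : Fin n → ℝ}

lemma cj_apply (x : Mat n) (i j : Fin n) : cj h x i j = h i * x i j * (h j)⁻¹ := by
  rw [cj, Matrix.mul_diagonal, Matrix.diagonal_mul]

lemma diag_mul_inv (hh : ∀ i, h i ≠ 0) :
    diagonal (fun i => (h i)⁻¹) * diagonal h = (1 : Mat n) := by
  rw [Matrix.diagonal_mul_diagonal, ← Matrix.diagonal_one]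
  congr 1; ext i; exact inv_mul_cancel₀ (hh i)

lemma cj_mul (hh : ∀ i, h i ≠ 0) (x y : Mat n) : cj h (x * y) = cj h x * cj h y := by
  calc cj h (x * y) = diagonal h * x * 1 * y * diagonal (fun i => (h i)⁻¹) := by
        simp only [cj, Matrix.mul_assoc, one_mul]
    _ = _ := by rw [← diag_mul_inv hh]; simp only [cj, Matrix.mul_assoc]

lemma cj_one (hh : ∀ i, h i ≠ 0) : cj h (1 : Mat n) = 1 := by
  ext i j
  rw [cj_apply]
  by_cases e : i = j
  · subst e; simp [hh]
  · simp [e]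

lemma UT.cj (hh : ∀ i, h i ≠ 0) {α : Type*} [LinearOrder α] {b : Fin n → α} {x : Mat n}
    (hx : UT b x) : UT b (cj h x) := by
  refine ⟨fun i j hij => ?_, fun i => ?_⟩
  · rw [cj_apply, hx.1 hij]; simp
  · rw [cj_apply, hx.2]; simp [hh]

lemma upperUni.cj (hh : ∀ i, h i ≠ 0) {x : Mat n} (hx : upperUni x) : upperUni (cj h x) :=
  upperUni_iff.2 ((upperUni_iff.1 hx).cj hh)

lemma NU_cj (hh : ∀ i, h i ≠ 0) {x : Mat n} (hx : x ∈ NU u) : cj h x ∈ NU u :=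
  ⟨hx.1.cj hh, hx.2.cj hh⟩

lemma cj_inv (hh : ∀ i, h i ≠ 0) {x : Mat n} (hx : IsUnit x.det) : cj h x⁻¹ = (cj h x)⁻¹ :=
  (Matrix.inv_eq_right_inv (by rw [← cj_mul hh, Matrix.mul_nonsing_inv _ hx, cj_one hh])).symm

lemma cj_permMat (p : Mat n) : permMat u * cj h p =
    diagonal (h ∘ (u⁻¹ : Equiv.Perm (Fin n))) * (permMat u * p) *
      diagonal (fun i => (h i)⁻¹) := by
  calc permMat u * cj h p = (permMat u * diagonal h) * p * diagonal (fun i => (h i)⁻¹) := by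
        simp only [cj, Matrix.mul_assoc]
    _ = _ := by rw [permMat_diagonal]; simp only [Matrix.mul_assoc]

lemma cj_mem_iff (hh : ∀ i, h i ≠ 0) (p : Mat n) :
    permMat u * cj h p ∈ doubleCosetBm w ↔ permMat u * p ∈ doubleCosetBm w := by
  rw [cj_permMat]
  exact doubleCoset_mul_iff (lowerTriInv_diagonal fun i => hh _)
    (lowerTriInv_diagonal fun i => inv_ne_zero (hh i))

lemma cj_doubleCoset (hh : ∀ i, h i ≠ 0) {x : Mat n} (hx : x ∈ doubleCosetBm w) :
    cj h x ∈ doubleCosetBm w :=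
  doubleCoset_mul hx (lowerTriInv_diagonal hh) (lowerTriInv_diagonal fun i => inv_ne_zero (hh i))

lemma cj_Ncell (hh : ∀ i, h i ≠ 0) {x : Mat n} (hx : x ∈ Ncell w) : cj h x ∈ Ncell w :=
  ⟨hx.1.cj hh, cj_doubleCoset hh hx.2⟩

lemma cj_Amat (hh : ∀ i, h i ≠ 0) {x : Mat n} (hx : x ∈ Gge u) :
    Amat u (cj h x) = cj h (Amat u x) := by
  obtain ⟨β, hβ, e⟩ := Gge_exists hx
  refine (Gge_of_eq (β := diagonal h * β * diagonal ((fun i => (h i)⁻¹) ∘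
    (u⁻¹ : Equiv.Perm (Fin n)))) ?_ ((UT_Amat x).cj hh) ?_).2
  · exact ((lowerTriInv_diagonal hh).mul hβ).mul (lowerTriInv_diagonal fun i => inv_ne_zero (hh _))
  · rw [Matrix.mul_assoc (diagonal h * β), ← permMat_diagonal]
    conv_lhs => rw [e]
    calc cj h (β * permMat u * Amat u x)
        = diagonal h * β * permMat u * 1 * Amat u x * diagonal (fun i => (h i)⁻¹) := by
          simp only [cj, Matrix.mul_assoc, one_mul]
      _ = _ := by rw [← diag_mul_inv hh]; simp only [cj, Matrix.mul_assoc]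

lemma cj_gaussPlus (hh : ∀ i, h i ≠ 0) {x : Mat n} (hx : hasGauss x) :
    gaussPlus (cj h x) = cj h (gaussPlus x) := by
  obtain ⟨l, hl, e⟩ := gauss_exists hx
  refine gaussPlus_eq (l := cj h l) ?_ ((gaussPlus_upper x).cj hh) ?_
  · exact ((lowerTriInv_diagonal hh).mul hl).mul (lowerTriInv_diagonal fun i => inv_ne_zero (hh i))
  · rw [← cj_mul hh, ← e]

lemma cj_XX (hh : ∀ i, h i ≠ 0) {x' p : Mat n} (hx : x' ∈ Ncell u) (hp : p ∈ NU u) :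
    cj h (XX u x' p) = XX u (cj h x') (cj h p) := by
  rw [XX, XX, cj_Amat hh (Ncell_Gge hx), ← cj_inv hh hp.2.isUnit, ← cj_mul hh,
    cj_gaussPlus hh (((hp.1.inv u.injective).mul u.injective (UT_Amat x')).hasGauss u.injective),
    cj_mul hh, cj_inv hh (gaussPlus_upper _).isUnit]

end cj

/-- The one-parameter family of dilations; `dil 0` kills the off-diagonal entries. -/
def dil (t : ℝ) (x : Mat n) : Mat n := Matrix.of fun i j => t ^ ((j : ℕ) - (i : ℕ)) * x i j

lemma dil_eq_cj {t : ℝ} (ht : t ≠ 0) {x : Mat n} (hx : upperUni x) :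
    dil t x = cj (fun i => (t ^ (i : ℕ))⁻¹) x := by
  ext i j
  rw [cj_apply, dil, Matrix.of_apply]
  rcases lt_or_ge j i with h | h
  · rw [hx.2 _ _ h]; simp
  · rw [inv_inv, pow_sub₀ _ ht (Fin.le_def.1 h)]; ring

lemma dil_ne {t : ℝ} (ht : t ≠ 0) (i : Fin n) : (t ^ (i : ℕ))⁻¹ ≠ 0 := inv_ne_zero (pow_ne_zero _ ht)

lemma dil_one (x : Mat n) : dil 1 x = x := by ext i j; simp [dil]

lemma dil_zero {x : Mat n} (hx : upperUni x) : dil 0 x = 1 := by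
  ext i j
  rw [dil, Matrix.of_apply]
  rcases lt_trichotomy i j with h | rfl | h
  · have : (j : ℕ) - (i : ℕ) ≠ 0 := by have := Fin.lt_def.1 h; omega
    simp [this, h.ne]
  · simp [hx.1]
  · simp [hx.2 _ _ h, h.ne']

lemma continuous_dil : Continuous fun q : ℝ × Mat n => dil q.1 q.2 :=
  continuous_matrix fun i j => (continuous_fst.pow _).mul
    ((continuous_apply_apply i j).comp continuous_snd)

lemma upperUni.dil {x : Mat n} (hx : upperUni x) (t : ℝ) : upperUni (dil t x) :=
  ⟨fun i => by simp [BruhatTNN.dil, hx.1], fun i j h => by simp [BruhatTNN.dil, hx.2 _ _ h]⟩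

lemma UT.dil {x : Mat n} (hx : UT u x) (t : ℝ) : UT u (dil t x) :=
  ⟨fun i j h => by simp [BruhatTNN.dil, hx.1 h], fun i => by simp [BruhatTNN.dil, hx.2]⟩

lemma NU_dil {x : Mat n} (hx : x ∈ NU u) (t : ℝ) : dil t x ∈ NU u := ⟨hx.1.dil t, hx.2.dil t⟩

end

section

/-! ### Disjointness of double cosets and reduction to simple factors -/

open Matrix Topology Filter

variable {n : ℕ} {u w : Equiv.Perm (Fin n)}

lemma perm_eq_one_of_le {σ : Equiv.Perm (Fin n)} (h : ∀ k, σ k ≤ k) : σ = 1 := by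
  ext k
  congr 1
  induction k using WellFoundedLT.induction with
  | ind k ih =>
    rcases (h k).lt_or_eq with hk | hk
    · exact σ.injective (ih _ hk)
    · exact hk

lemma doubleCoset_disjoint {x : Mat n} (h : x ∈ doubleCosetBm u) (h' : x ∈ doubleCosetBm w) :
    u = w := by
  obtain ⟨b, b', hb, hb', rfl⟩ := h
  obtain ⟨c, c', hc, hc', e⟩ := h'
  have e2 : permMat u * (b' * c'⁻¹) = (b⁻¹ * c) * permMat w := by
    calc permMat u * (b' * c'⁻¹) = (b⁻¹ * b) * permMat u * b' * c'⁻¹ := by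
          rw [Matrix.nonsing_inv_mul _ hb.1, one_mul, Matrix.mul_assoc]
      _ = b⁻¹ * (b * permMat u * b') * c'⁻¹ := by simp only [Matrix.mul_assoc]
      _ = b⁻¹ * c * permMat w * (c' * c'⁻¹) := by rw [e]; simp only [Matrix.mul_assoc]
      _ = _ := by rw [Matrix.mul_nonsing_inv _ hc'.1, mul_one]
  rw [permMat_mul_left, permMat_mul_right] at e2
  have key : ∀ k, w k ≤ u k := fun k => by
    by_contra hk
    have h1 := congrFun (congrFun e2 (u k)) k
    simp only [Matrix.submatrix_apply, id, Equiv.Perm.inv_def, Equiv.symm_apply_apply] at h1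
    exact (hb'.mul hc'.inv).diag_ne k (h1.trans ((hb.inv.mul hc).2 _ _ (not_le.1 hk)))
  have : w * u⁻¹ = 1 := perm_eq_one_of_le fun k => by
    simpa using key ((u⁻¹ : Equiv.Perm (Fin n)) k)
  exact (mul_inv_eq_one.1 this).symm

lemma transv_apply (i j : Fin n) (t : ℝ) (a b : Fin n) :
    transvection i j t a b = (if a = b then 1 else 0) + if i = a ∧ j = b then t else 0 := by
  simp [transvection, Matrix.one_apply, Matrix.single_apply]

lemma mul_transv (M : Mat n) (i j : Fin n) (t : ℝ) (a b : Fin n) :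
    (M * transvection i j t) a b = M a b + if b = j then t * M a i else 0 := by
  by_cases h : b = j
  · subst h; simp
  · simp [h]

lemma transv_mul (M : Mat n) (i j : Fin n) (t : ℝ) (a b : Fin n) :
    (transvection i j t * M) a b = M a b + if a = i then t * M j b else 0 := by
  by_cases h : a = i
  · subst h; simp
  · simp [h]

lemma upperUni_transv {i j : Fin n} (h : i < j) (t : ℝ) : upperUni (transvection i j t) := by
  refine ⟨fun k => ?_, fun a b hab => ?_⟩
  · rw [transv_apply, if_pos rfl, if_neg, add_zero]
    rintro ⟨rfl, rfl⟩; exact h.false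
  · rw [transv_apply, if_neg hab.ne', if_neg, add_zero]
    rintro ⟨rfl, rfl⟩; exact h.not_gt hab

lemma lowerUni_transv {i j : Fin n} (h : j < i) (t : ℝ) : lowerUni (transvection i j t) := by
  refine ⟨fun k => ?_, fun a b hab => ?_⟩
  · rw [transv_apply, if_pos rfl, if_neg, add_zero]
    rintro ⟨rfl, rfl⟩; exact h.false
  · rw [transv_apply, if_neg hab.ne, if_neg, add_zero]
    rintro ⟨rfl, rfl⟩; exact h.not_gt hab

lemma permMat_transv (w : Equiv.Perm (Fin n)) (i j : Fin n) (t : ℝ) :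
    permMat w * transvection i j t = transvection (w i) (w j) t * permMat w := by
  ext a b
  rw [mul_transv, transv_mul]
  by_cases h1 : a = w i <;> by_cases h2 : b = j <;> simp [permMat, h1, h2]
  simp [Ne.symm h2]

lemma swap_apply_cases (i j k : Fin n) : Equiv.swap i j k = if k = i then j else if k = j then i else k :=
  Equiv.swap_apply_def i j k

lemma lower_conj {α : Mat n} (hα : lowerUni α) {i j : Fin n} (hij : (j : ℕ) = i + 1)
    (h0 : α j i = 0) (t : ℝ) :
    lowerUni (transvection i j (-t) * α * transvection i j t) ∧
      (transvection i j (-t) * α * transvection i j t) j i = 0 := by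
  have hlt : i < j := Fin.lt_def.2 (by omega)
  refine ⟨⟨fun k => ?_, fun k l hkl => ?_⟩, ?_⟩
  · rw [mul_transv, transv_mul, transv_mul]
    by_cases h1 : k = i
    · subst h1; simp [hlt.ne, hα.1, h0]
    · by_cases h2 : k = j
      · subst h2; simp [h1, hα.1, h0]
      · simp [h1, h2, hα.1]
  · rw [mul_transv, transv_mul, transv_mul, hα.2 k l hkl]
    by_cases h1 : k = i
    · subst h1
      by_cases h2 : l = j
      · subst h2; simp [hα.1, h0]
      · have h3 : j < l := by
          have := Fin.lt_def.1 hkl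
          refine Fin.lt_def.2 ?_
          have : (l : ℕ) ≠ j := fun h => h2 (Fin.ext h)
          omega
        simp [h2, hα.2 _ _ h3]
    · by_cases h2 : l = j
      · subst h2
        have h3 : k < i := by
          have := Fin.lt_def.1 hkl
          refine Fin.lt_def.2 ?_
          have : (k : ℕ) ≠ i := fun h => h1 (Fin.ext h)
          omega
        simp [h1, hα.2 _ _ h3]
      · simp [h1, h2]
  · rw [mul_transv, transv_mul]
    simp [hlt.ne, hlt.ne', h0]

lemma swap_conj {γ : Mat n} (hγ : lowerUni γ) {i j : Fin n} (hij : (j : ℕ) = i + 1)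
    (h0 : γ j i = 0) : lowerUni (permMat (Equiv.swap i j) * γ * permMat (Equiv.swap i j)) := by
  have e : permMat (Equiv.swap i j) * γ * permMat (Equiv.swap i j) =
      γ.submatrix (Equiv.swap i j) (Equiv.swap i j) := by
    have := permMat_conj' (Equiv.swap i j) γ
    rwa [Equiv.swap_inv] at this
  rw [e]
  refine ⟨fun k => hγ.1 _, fun k l hkl => ?_⟩
  rw [Matrix.submatrix_apply]
  by_cases h : Equiv.swap i j k < Equiv.swap i j l
  · exact hγ.2 _ _ h
  · have hkl' := Fin.lt_def.1 hkl
    rw [Fin.lt_def] at h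
    have : k = i ∧ l = j := by
      rw [Fin.ext_iff, Fin.ext_iff]
      rw [swap_apply_cases, swap_apply_cases] at h
      split_ifs at h <;> simp only [Fin.ext_iff] at * <;> omega
    rw [this.1, this.2, Equiv.swap_apply_left, Equiv.swap_apply_right, h0]

/-- The diagonal matrix with entries `a` at `i`, `b` at `j`, and `1` elsewhere. -/
noncomputable def dd (i j : Fin n) (a b : ℝ) : Fin n → ℝ :=
  fun k => if k = i then a else if k = j then b else 1

lemma dd_ne {i j : Fin n} {a b : ℝ} (ha : a ≠ 0) (hb : b ≠ 0) (k : Fin n) : dd i j a b k ≠ 0 := by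
  unfold dd; split_ifs <;> simp [*]

lemma sl2_identity {i j : Fin n} (hij : i ≠ j) {c : ℝ} (hc : c ≠ 0) :
    transvection j i c * transvection i j (-c⁻¹) =
      transvection i j c⁻¹ * permMat (Equiv.swap i j) * diagonal (dd i j c (-c⁻¹)) := by
  ext a b
  rw [mul_transv, Matrix.mul_diagonal, permMat_mul_right, Matrix.submatrix_apply,
    transv_apply, transv_apply, transv_apply, swap_apply_cases, dd]
  by_cases h1 : b = i
  · subst h1
    by_cases h2 : a = b
    · subst h2; simp [hij, hij.symm, hc]
    · by_cases h3 : a = j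
      · subst h3; simp [hij, hij.symm]
      · simp [hij, h2, h3, Ne.symm h2, Ne.symm h3]
  · by_cases h1' : b = j
    · subst h1'
      by_cases h2 : a = b
      · subst h2; simp [hij, hij.symm, hc]
      · by_cases h3 : a = i
        · subst h3; simp [hij, hij.symm]
        · simp [hij.symm, h2, h3, Ne.symm h2]
    · simp [h1, h1', Ne.symm h1, Ne.symm h1']

lemma sl2_identity' {i j : Fin n} (hij : i ≠ j) {t : ℝ} (ht : t ≠ 0) :
    transvection i j t = permMat (Equiv.swap i j) * transvection i j t⁻¹ *
      diagonal (dd i j (-t⁻¹) t) * transvection j i t⁻¹ := by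
  ext a b
  rw [mul_transv, Matrix.mul_diagonal, Matrix.mul_diagonal, permMat_mul_left, Matrix.submatrix_apply,
    Matrix.submatrix_apply, Equiv.swap_inv, transv_apply, transv_apply, transv_apply,
    swap_apply_cases, dd, dd]
  by_cases h1 : a = i
  · subst h1
    by_cases h2 : b = a
    · subst h2; simp [hij, hij.symm, ht]
    · by_cases h3 : b = j
      · subst h3; simp [hij, hij.symm]
      · simp [h2, h3, Ne.symm h2, Ne.symm h3]
  · by_cases h1' : a = j
    · subst h1'
      by_cases h2 : b = a
      · subst h2; simp [hij, hij.symm, ht]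
      · by_cases h3 : b = i
        · subst h3; simp [hij, hij.symm, ht]
        · simp [h1, h2, h3, hij, Ne.symm h2, Ne.symm h3]
    · by_cases h2 : b = i
      · subst h2; simp [h1, h1', Ne.symm h1]
      · by_cases h3 : b = j
        · subst h3; simp [h1, h1', h2, Ne.symm h1]
        · simp [h1, h1', h2, h3, Ne.symm h1]

lemma Amat_entry {x β L : Mat n} (hβ : lowerTriInv β) (hL : lowerUni L)
    (h : x = β * permMat w * L) {i j : Fin n} (hij : (j : ℕ) = i + 1) (hw : w j < w i) :
    Amat w x j i = L j i := by
  obtain ⟨L₁, L₂, hL1, hL1', hL2, hL2', e⟩ := hL.split w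
  have := (Gge_of_eq (x := x) (hβ.mul hL1'.conj_lower.lowerTriInv) hL2' (by
    rw [h, e]; simp only [Matrix.mul_assoc, permMat_comm' w])).2
  rw [this, e, Matrix.mul_apply]
  rw [Finset.sum_eq_single j]
  · rw [hL1.1, one_mul]
  · intro k _ hk
    rcases lt_or_gt_of_ne hk with h1 | h1
    · rcases eq_or_ne k i with rfl | h2
      · rw [hL1'.1 (i := j) (j := k) hw, zero_mul]
      · have h3 : k < i := by
          rw [Fin.lt_def] at *
          have : (k : ℕ) ≠ i := fun h => h2 (Fin.ext h)
          omega
        rw [hL2.2 _ _ h3, mul_zero]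
    · rw [hL1.2 _ _ h1, zero_mul]
  · simp

lemma swap_swap_mul (w : Equiv.Perm (Fin n)) (i j : Fin n) :
    w * Equiv.swap i j * Equiv.swap i j = w := by
  rw [mul_assoc, Equiv.swap_mul_self, mul_one]

lemma lowerUni_mul_transv_entry {α : Mat n} (hα : lowerUni α) {i j : Fin n} (c : ℝ) :
    (α * transvection j i c) j i = α j i + c := by
  rw [mul_transv]; simp [hα.1]

lemma chart_down {y : Mat n} (hy : y ∈ Ncell w) {i j : Fin n} (hij : (j : ℕ) = i + 1)
    (hw : w j < w i) (hc : Amat w y j i ≠ 0) :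
    y * transvection i j (-(Amat w y j i)⁻¹) ∈ Ncell (w * Equiv.swap i j) := by
  have hlt : i < j := Fin.lt_def.2 (by omega)
  refine ⟨hy.1.mul (upperUni_transv hlt _), ?_⟩
  obtain ⟨β, hβ, h⟩ := Gge_exists (Ncell_Gge hy)
  have hα := Ncell_lower hy
  set α := Amat w y
  set c := α j i
  set s := permMat (Equiv.swap i j) with hs
  have hα' : lowerUni (α * transvection j i (-c)) := hα.mul (lowerUni_transv hlt _)
  have h0 : (α * transvection j i (-c)) j i = 0 := by
    rw [lowerUni_mul_transv_entry hα]; exact add_neg_cancel _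
  obtain ⟨g1, g2⟩ := lower_conj hα' hij h0 c⁻¹
  have g3 := swap_conj g1 hij g2
  have e1 : transvection j i (-c) * transvection j i c = (1 : Mat n) := by
    rw [transvection_mul_transvection_same _ _ hlt.ne']; simp
  have e2 : transvection i j c⁻¹ * transvection i j (-c⁻¹) = (1 : Mat n) := by
    rw [transvection_mul_transvection_same _ _ hlt.ne]; simp
  have e3 : s * s = (1 : Mat n) := by rw [hs, permMat_mul, Equiv.swap_mul_self, permMat_one]
  have e4 : α * transvection i j (-c⁻¹) = transvection i j c⁻¹ * s *
      (s * (transvection i j (-c⁻¹) * (α * transvection j i (-c)) * transvection i j c⁻¹) * s) *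
      diagonal (dd i j c (-c⁻¹)) := by
    calc α * transvection i j (-c⁻¹)
        = α * (transvection j i (-c) * transvection j i c) * transvection i j (-c⁻¹) := by
          rw [e1, mul_one]
      _ = α * transvection j i (-c) * (transvection j i c * transvection i j (-c⁻¹)) := by
          simp only [Matrix.mul_assoc]
      _ = (transvection i j c⁻¹ * transvection i j (-c⁻¹)) * (α * transvection j i (-c)) *
            (transvection i j c⁻¹ * s * diagonal (dd i j c (-c⁻¹))) := by
          rw [sl2_identity hlt.ne hc, e2, one_mul]
      _ = transvection i j c⁻¹ * (s * s) * (transvection i j (-c⁻¹) *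
            (α * transvection j i (-c)) * transvection i j c⁻¹ * s) *
            diagonal (dd i j c (-c⁻¹)) := by
          rw [e3, mul_one]; simp only [Matrix.mul_assoc]
      _ = _ := by simp only [Matrix.mul_assoc]
  refine mem_doubleCoset (β := β * transvection (w i) (w j) c⁻¹) (A := (s * (transvection i j (-c⁻¹)
    * (α * transvection j i (-c)) * transvection i j c⁻¹) * s) * diagonal (dd i j c (-c⁻¹)))
    (hβ.mul (lowerUni_transv hw _).lowerTriInv)
    (g3.lowerTriInv.mul (lowerTriInv_diagonal (dd_ne hc (neg_ne_zero.2 (inv_ne_zero hc))))) ?_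
  conv_lhs => rw [h, Matrix.mul_assoc, e4]
  calc _ = β * (permMat w * transvection i j c⁻¹) * s *
      ((s * (transvection i j (-c⁻¹) * (α * transvection j i (-c)) * transvection i j c⁻¹) * s) *
      diagonal (dd i j c (-c⁻¹))) := by simp only [Matrix.mul_assoc]
    _ = _ := by rw [permMat_transv, ← permMat_mul]; simp only [Matrix.mul_assoc, hs]

lemma chart_up {y : Mat n} (hy : y ∈ Ncell w) {i j : Fin n} (hij : (j : ℕ) = i + 1)
    (hw : w i < w j) {t : ℝ} (ht : t ≠ 0) :
    y * transvection i j t ∈ Ncell (w * Equiv.swap i j) ∧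
      Amat (w * Equiv.swap i j) (y * transvection i j t) j i = t⁻¹ := by
  have hlt : i < j := Fin.lt_def.2 (by omega)
  obtain ⟨β, hβ, h⟩ := Gge_exists (Ncell_Gge hy)
  have hα := Ncell_lower hy
  have h0 : Amat w y j i = 0 := (UT_Amat (u := w) y).1 hw
  set α := Amat w y
  set s := permMat (Equiv.swap i j) with hs
  obtain ⟨g1, g2⟩ := lower_conj hα hij h0 t
  set γ := transvection i j (-t) * α * transvection i j t with hγ
  have e2 : transvection i j t * transvection i j (-t) = (1 : Mat n) := by
    rw [transvection_mul_transvection_same _ _ hlt.ne]; simp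
  have e1 : α * transvection i j t = transvection i j t * γ := by
    calc α * transvection i j t = 1 * (α * transvection i j t) := (one_mul _).symm
      _ = _ := by rw [← e2, hγ]; simp only [Matrix.mul_assoc]
  have hw' : (w * Equiv.swap i j) j < (w * Equiv.swap i j) i := by simpa using hw
  have hD : lowerTriInv (diagonal (dd i j (-t⁻¹) t) : Mat n) :=
    lowerTriInv_diagonal (dd_ne (neg_ne_zero.2 (inv_ne_zero ht)) ht)
  have hD' : lowerTriInv (diagonal ((dd i j (-t⁻¹) t) ∘
      ((w * Equiv.swap i j)⁻¹ : Equiv.Perm (Fin n))) : Mat n) :=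
    lowerTriInv_diagonal fun k => dd_ne (neg_ne_zero.2 (inv_ne_zero ht)) ht _
  have hL : lowerUni (transvection j i t⁻¹ * γ) := (lowerUni_transv hlt _).mul g1
  have hB : lowerTriInv (β * transvection ((w * Equiv.swap i j) i) ((w * Equiv.swap i j) j) t⁻¹ *
      diagonal ((dd i j (-t⁻¹) t) ∘ ((w * Equiv.swap i j)⁻¹ : Equiv.Perm (Fin n)))) :=
    (hβ.mul (lowerUni_transv hw' _).lowerTriInv).mul hD'
  have e : y * transvection i j t = β * transvection ((w * Equiv.swap i j) i)
      ((w * Equiv.swap i j) j) t⁻¹ * diagonal ((dd i j (-t⁻¹) t) ∘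
        ((w * Equiv.swap i j)⁻¹ : Equiv.Perm (Fin n))) * permMat (w * Equiv.swap i j) *
        (transvection j i t⁻¹ * γ) := by
    conv_lhs => rw [h, Matrix.mul_assoc, e1, sl2_identity' hlt.ne ht]
    calc _ = β * (permMat w * s * transvection i j t⁻¹ * diagonal (dd i j (-t⁻¹) t)) *
          (transvection j i t⁻¹ * γ) := by simp only [Matrix.mul_assoc, hs]
      _ = _ := by
        rw [hs, permMat_mul, permMat_transv, Matrix.mul_assoc (transvection _ _ _),
          permMat_diagonal]
        simp only [Matrix.mul_assoc]
  refine ⟨⟨hy.1.mul (upperUni_transv hlt _), mem_doubleCoset hB hL.lowerTriInv e⟩, ?_⟩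
  rw [Amat_entry hB hL e hij hw', transv_mul]
  simp [g2, g1.1]

end

section

/-! ### The Bruhat order -/

open Matrix Topology Filter

variable {n : ℕ} {u v w : Equiv.Perm (Fin n)}

/-- The rank function of a permutation. -/
def rk (w : Equiv.Perm (Fin n)) (p q : ℕ) : ℕ :=
  (Finset.univ.filter fun k : Fin n => (k : ℕ) < p ∧ q ≤ (w k : ℕ)).card

lemma rk_succ (w : Equiv.Perm (Fin n)) (i : Fin n) (q : ℕ) :
    rk w (i + 1) q = rk w i q + if q ≤ (w i : ℕ) then 1 else 0 := by
  unfold rk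
  have : (Finset.univ.filter fun k : Fin n => (k : ℕ) < i + 1 ∧ q ≤ (w k : ℕ)) =
      (Finset.univ.filter fun k : Fin n => (k : ℕ) < i ∧ q ≤ (w k : ℕ)) ∪
        if q ≤ (w i : ℕ) then {i} else ∅ := by
    ext k
    split_ifs with h
    · simp only [Finset.mem_filter, Finset.mem_univ, true_and, Finset.mem_union,
        Finset.mem_singleton]
      constructor
      · rintro ⟨h1, h2⟩
        rcases Nat.lt_succ_iff_lt_or_eq.1 h1 with h3 | h3
        · exact Or.inl ⟨h3, h2⟩
        · exact Or.inr (Fin.ext h3)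
      · rintro (h1 | rfl)
        · exact ⟨by omega, h1.2⟩
        · exact ⟨by omega, h⟩
    · simp only [Finset.mem_filter, Finset.mem_univ, true_and, Finset.union_empty]
      constructor
      · rintro ⟨h1, h2⟩
        rcases Nat.lt_succ_iff_lt_or_eq.1 h1 with h3 | h3
        · exact ⟨h3, h2⟩
        · exact absurd (Fin.ext h3 ▸ h2) h
      · rintro h1
        exact ⟨by omega, h1.2⟩
  rw [this, Finset.card_union_of_disjoint]
  · split_ifs <;> simp
  · split_ifs <;> simp

lemma card_perm_lt (w : Equiv.Perm (Fin n)) (q : ℕ) :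
    (Finset.univ.filter fun k : Fin n => (w k : ℕ) < q).card =
      (Finset.univ.filter fun k : Fin n => (k : ℕ) < q).card := by
  refine Finset.card_bij (fun k _ => w k) ?_ ?_ ?_
  · simp
  · intro a _ b _ h; exact w.injective h
  · intro b hb; exact ⟨w.symm b, by simpa using hb, by simp⟩

lemma rk_compl (w : Equiv.Perm (Fin n)) (p q : ℕ) :
    (Finset.univ.filter fun k : Fin n => p ≤ (k : ℕ) ∧ (w k : ℕ) < q).card +
      (Finset.univ.filter fun k : Fin n => (k : ℕ) < p).card =
    (Finset.univ.filter fun k : Fin n => (k : ℕ) < q).card + rk w p q := by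
  rw [← card_perm_lt w q, rk]
  have h1 := Finset.card_filter_add_card_filter_not (s := Finset.univ.filter fun k : Fin n => (k : ℕ) < p)
    (fun k : Fin n => (w k : ℕ) < q)
  have h2 := Finset.card_filter_add_card_filter_not (s := Finset.univ.filter fun k : Fin n => (w k : ℕ) < q)
    (fun k : Fin n => (k : ℕ) < p)
  rw [Finset.filter_filter, Finset.filter_filter] at h1 h2
  have e1 : (Finset.univ.filter fun k : Fin n => (w k : ℕ) < q ∧ (k : ℕ) < p) =
    Finset.univ.filter fun k : Fin n => (k : ℕ) < p ∧ (w k : ℕ) < q := by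
    ext k; simp [and_comm]
  have e2 : (Finset.univ.filter fun k : Fin n => (w k : ℕ) < q ∧ ¬ (k : ℕ) < p) =
    Finset.univ.filter fun k : Fin n => p ≤ (k : ℕ) ∧ (w k : ℕ) < q := by
    ext k; simp [and_comm]
  have e3 : (Finset.univ.filter fun k : Fin n => (k : ℕ) < p ∧ ¬ (w k : ℕ) < q) =
    Finset.univ.filter fun k : Fin n => (k : ℕ) < p ∧ q ≤ (w k : ℕ) := by
    ext k; simp
  rw [e1, e2] at h2
  rw [e3] at h1
  omega

lemma rk_zero (w : Equiv.Perm (Fin n)) (q : ℕ) : rk w 0 q = 0 := by simp [rk]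

lemma rk_ge (w : Equiv.Perm (Fin n)) {p : ℕ} (hp : n ≤ p) (q : ℕ) :
    rk w p q = rk (1 : Equiv.Perm (Fin n)) p q := by
  have h1 := rk_compl w p q
  have h2 := rk_compl (1 : Equiv.Perm (Fin n)) p q
  have e : ∀ v : Equiv.Perm (Fin n),
      (Finset.univ.filter fun k : Fin n => p ≤ (k : ℕ) ∧ (v k : ℕ) < q) = ∅ := fun v => by
    ext k; simp; omega
  rw [e] at h1 h2
  omega

lemma bruhatLE_iff : bruhatLE u v ↔ ∀ p q : ℕ, rk u p q ≤ rk v p q := by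
  have key : ∀ (w : Equiv.Perm (Fin n)) (i j : Fin n),
      (Finset.univ.filter fun k : Fin n => k ≤ i ∧ j ≤ w k).card = rk w (i + 1) j := fun w i j => by
    unfold rk
    congr 1
    ext k
    simp only [Finset.mem_filter, Finset.mem_univ, true_and, Fin.le_def, Nat.lt_succ_iff]
  constructor
  · intro h p q
    rcases Nat.eq_zero_or_pos p with rfl | hp
    · rw [rk_zero, rk_zero]
    rcases le_or_gt n p with hp' | hp'
    · rw [rk_ge u hp', rk_ge v hp']
    rcases le_or_gt n q with hq | hq
    · have : rk u p q = 0 := by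
        unfold rk
        rw [Finset.card_eq_zero]
        ext k; simp; omega
      omega
    · have := h ⟨p - 1, by omega⟩ ⟨q, hq⟩
      rw [key, key] at this
      simpa [Nat.sub_add_cancel hp] using this
  · intro h i j
    rw [key, key]
    exact h _ _

lemma bruhatLE_refl (u : Equiv.Perm (Fin n)) : bruhatLE u u := fun _ _ => le_rfl
lemma bruhatLE_trans (h : bruhatLE u v) (h' : bruhatLE v w) : bruhatLE u w :=
  fun i j => (h i j).trans (h' i j)

lemma bruhatLE_antisymm (h : bruhatLE u v) (h' : bruhatLE v u) : u = v := by
  rw [bruhatLE_iff] at h h'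
  have e : ∀ p q, rk u p q = rk v p q := fun p q => le_antisymm (h p q) (h' p q)
  ext i
  have h1 := rk_succ u i (u i)
  have h2 := rk_succ v i (u i)
  have h3 := rk_succ u i (v i)
  have h4 := rk_succ v i (v i)
  rw [e, e, h2] at h1
  rw [e, e, h4] at h3
  simp at h1 h3
  exact congrArg _ (le_antisymm h1 h3)

lemma eq_one_of_le_one (h : bruhatLE u 1) : u = 1 := by
  rw [bruhatLE_iff] at h
  refine perm_eq_one_of_le fun k => ?_
  by_contra hk
  have hk' := Fin.lt_def.1 (not_le.1 hk)
  have h1 := h (k + 1) (k + 1)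
  rw [rk_succ] at h1
  have : rk (1 : Equiv.Perm (Fin n)) (k + 1) (k + 1) = 0 := by
    unfold rk
    rw [Finset.card_eq_zero]
    ext l; simp
  rw [this, if_pos (by omega)] at h1
  omega

lemma rk_swap (w : Equiv.Perm (Fin n)) {i j : Fin n} (hij : (j : ℕ) = i + 1) {p : ℕ}
    (hp : p ≠ i + 1) (q : ℕ) : rk (w * Equiv.swap i j) p q = rk w p q := by
  have hs : ∀ k : Fin n, ((Equiv.swap i j k : Fin n) : ℕ) < p ↔ (k : ℕ) < p := fun k => by
    rw [swap_apply_cases]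
    split_ifs with h1 h2
    · subst h1; omega
    · subst h2; omega
    · rfl
  refine Finset.card_bij (fun k _ => Equiv.swap i j k) ?_ ?_ ?_
  · intro k hk
    have hk' := (Finset.mem_filter.1 hk).2
    exact Finset.mem_filter.2 ⟨Finset.mem_univ _, (hs k).2 hk'.1, hk'.2⟩
  · intro a _ b _ h; exact (Equiv.swap i j).injective h
  · intro b hb
    refine ⟨Equiv.swap i j b, ?_, by simp⟩
    have hb' := (Finset.mem_filter.1 hb).2
    refine Finset.mem_filter.2 ⟨Finset.mem_univ _, (hs b).2 hb'.1, ?_⟩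
    simpa only [Equiv.Perm.mul_apply, Equiv.swap_apply_self] using hb'.2

lemma bruhat_lift {i j : Fin n} (hij : (j : ℕ) = i + 1) (hu : u i < u j)
    (h : ∀ p q : ℕ, p ≠ i + 1 → rk u p q ≤ rk w p q) :
    bruhatLE u (w * Equiv.swap i j) := by
  rw [bruhatLE_iff]
  intro p q
  by_cases hp : p = i + 1
  · subst hp
    have h1 := h i q (by omega)
    have h2 := h (i + 1 + 1) q (by omega)
    have a1 := rk_succ u i q
    have a2 := rk_succ u j q
    have b1 := rk_succ w i q
    have b2 := rk_succ w j q
    rw [hij] at a2 b2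
    have c1 := rk_succ (w * Equiv.swap i j) i q
    rw [rk_swap w hij (p := (i : ℕ)) (by omega)] at c1
    simp only [Equiv.Perm.coe_mul, Function.comp_apply, Equiv.swap_apply_left] at c1
    rw [Fin.lt_def] at hu
    rw [a1, c1]
    rw [a2, a1, b2, b1] at h2
    split_ifs at h2 ⊢ <;> omega
  · rw [rk_swap w hij hp]
    exact h p q hp

lemma bruhat_lift_asc {i j : Fin n} (hij : (j : ℕ) = i + 1) (h : bruhatLE u w)
    (hu : u i < u j) : bruhatLE u (w * Equiv.swap i j) :=
  bruhat_lift hij hu fun p q _ => bruhatLE_iff.1 h p q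

lemma bruhat_lift_desc {i j : Fin n} (hij : (j : ℕ) = i + 1) (h : bruhatLE u w)
    (hu : u j < u i) : bruhatLE (u * Equiv.swap i j) (w * Equiv.swap i j) :=
  bruhat_lift hij (by simpa using hu) fun p q hp => by
    rw [rk_swap u hij hp]; exact bruhatLE_iff.1 h p q

lemma rank_ineq {N m α : Mat n} (hN : upperUni N) (hm : m.BlockTriangular OrderDual.toDual)
    (hα : α.BlockTriangular OrderDual.toDual) (h : N * permMat u = m * permMat w * α) :
    bruhatLE u w := by
  rw [bruhatLE_iff]
  intro p q
  have key : (Finset.univ.filter fun k : Fin n => p ≤ (k : ℕ) ∧ (u k : ℕ) < q).card ≤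
      (Finset.univ.filter fun k : Fin n => p ≤ (k : ℕ) ∧ (w k : ℕ) < q).card := by
    set S := {k : Fin n // p ≤ (k : ℕ) ∧ (u k : ℕ) < q}
    set T := {k : Fin n // p ≤ (k : ℕ) ∧ (w k : ℕ) < q}
    have hS : Fintype.card S = (Finset.univ.filter fun k : Fin n => p ≤ (k : ℕ) ∧ (u k : ℕ) < q).card :=
      Fintype.card_subtype _
    have hT : Fintype.card T = (Finset.univ.filter fun k : Fin n => p ≤ (k : ℕ) ∧ (w k : ℕ) < q).card :=
      Fintype.card_subtype _
    rw [← hS, ← hT]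
    let M : Matrix S S ℝ := N.submatrix (fun s => u s.1) (fun s => u s.1)
    have hM : IsUnit M.det := ((upperUni_iff.1 hN).submatrix (fun s : S => u s.1)).isUnit_det
      (u.injective.comp Subtype.val_injective)
    have hfac : M = (Matrix.of fun (s : S) (k : T) => m (u s.1) (w k.1)) *
        (Matrix.of fun (k : T) (s : S) => α k.1 s.1) := by
      ext s t
      have h1 := congrFun (congrFun h (u s.1)) t.1
      rw [permMat_mul_right, permMat_mul_right, Matrix.mul_apply] at h1
      simp only [Matrix.submatrix_apply, id] at h1
      change N (u s.1) (u t.1) = _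
      rw [h1, Matrix.mul_apply]
      simp only [Matrix.of_apply]
      rw [← Finset.sum_subtype (Finset.univ.filter fun k : Fin n => p ≤ (k : ℕ) ∧ (w k : ℕ) < q)
        (by simp) (fun k => m (u s.1) (w k) * α k t.1)]
      refine (Finset.sum_filter_of_ne fun k _ hk => ?_).symm
      by_contra hk'
      apply hk
      rw [not_and_or, not_le, not_lt] at hk'
      rcases hk' with hk' | hk'
      · rw [hα (i := k) (j := t.1) (show k < t.1 from Fin.lt_def.2 (hk'.trans_le t.2.1)), mul_zero]
      · rw [hm (i := u s.1) (j := w k)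
          (show u s.1 < w k from Fin.lt_def.2 (s.2.2.trans_le hk')), zero_mul]
    have h1 : M.rank = Fintype.card S :=
      Matrix.rank_of_isUnit _ ((Matrix.isUnit_iff_isUnit_det _).2 hM)
    rw [← h1, hfac]
    exact (Matrix.rank_mul_le_left _ _).trans (Matrix.rank_le_card_width _)
  have h1 := rk_compl u p q
  have h2 := rk_compl w p q
  omega

lemma bruhatLE_of_Gge {x : Mat n} (hx : x ∈ doubleCosetBm w) (hu : x ∈ Gge u) : bruhatLE u w := by
  obtain ⟨b, b', hb, hb', rfl⟩ := hx
  obtain ⟨l, hl, h⟩ := gauss_exists hu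
  refine rank_ineq (N := gaussPlus (b * permMat w * b' * permMat u⁻¹)) (m := l⁻¹ * b) (α := b')
    (gaussPlus_upper _) ?_ (lowerTriInv_iff.1 hb').2 ?_
  · exact (lowerTriInv_iff.1 (hl.inv.mul hb)).2
  · have e : gaussPlus (b * permMat w * b' * permMat u⁻¹) =
        l⁻¹ * (b * permMat w * b' * permMat u⁻¹) := by rw [← mul_eq_iff_inv hl.1, ← h]
    rw [e]
    simp only [Matrix.mul_assoc, permMat_inv_mul, mul_one]

end

section

/-! ### Totally nonnegative unitriangular matrices -/

open Matrix Topology Filter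

variable {n : ℕ} {u v w : Equiv.Perm (Fin n)}

lemma totNonneg.strict {z : Mat n} (hz : totNonneg z) {k : ℕ} {r c : Fin k → Fin n}
    (hr : StrictMono r) (hc : StrictMono c) : 0 ≤ (z.submatrix r c).det := by
  have key : ∀ {f : Fin k → Fin n}, StrictMono f → (Finset.univ.image f).card = k := fun {f} hf => by
    rw [Finset.card_image_of_injective _ hf.injective, Finset.card_univ, Fintype.card_fin]
  have h := hz k _ _ (key hr) (key hc)
  have e : ∀ {f : Fin k → Fin n} (hf : StrictMono f),
      f = (Finset.univ.image f).orderEmbOfFin (key hf) := fun {f} hf =>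
    Finset.orderEmbOfFin_unique _ (fun a => Finset.mem_image_of_mem _ (Finset.mem_univ a)) hf
  rw [minorOf, ← e hr, ← e hc] at h
  exact h

lemma totNonneg_iff {z : Mat n} : totNonneg z ↔ ∀ (k : ℕ) (r c : Fin k → Fin n), StrictMono r →
    StrictMono c → 0 ≤ (z.submatrix r c).det :=
  ⟨fun h _ _ _ hr hc => h.strict hr hc, fun h k _ _ _ _ =>
    h k _ _ (OrderEmbedding.strictMono _) (OrderEmbedding.strictMono _)⟩

lemma totNonneg.mono {z : Mat n} (hz : totNonneg z) {k : ℕ} {r c : Fin k → Fin n}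
    (hr : StrictMono r) (hc : Monotone c) : 0 ≤ (z.submatrix r c).det := by
  by_cases h : Function.Injective c
  · exact hz.strict hr (hc.strictMono_of_injective h)
  · simp only [Function.Injective, not_forall] at h
    obtain ⟨a, b, e, hne⟩ := h
    rw [Matrix.det_zero_of_column_eq hne fun i => by simp [e]]

lemma totNonneg.entry {z : Mat n} (hz : totNonneg z) (i j : Fin n) : 0 ≤ z i j := by
  have := hz.mono (k := 1) (r := fun _ => i) (c := fun _ => j) (Subsingleton.strictMono _)
    monotone_const
  simpa using this

lemma totNonneg.two {z : Mat n} (hz : totNonneg z) {i i' j j' : Fin n} (hi : i < i') (hj : j ≤ j') :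
    z i j' * z i' j ≤ z i j * z i' j' := by
  have := hz.mono (k := 2) (r := ![i, i']) (c := ![j, j']) (by
    rw [Fin.strictMono_iff_lt_succ]; intro a; fin_cases a; simpa using hi) (by
    rw [Fin.monotone_iff_le_succ]; intro a; fin_cases a; simpa using hj)
  rw [Matrix.det_fin_two] at this
  simp at this
  linarith

lemma submatrix_mul_transv_notMem (z : Mat n) {κ l : Type*} {r : κ → Fin n} {c : l → Fin n}
    {i j : Fin n} (t : ℝ) (h : ∀ b, c b ≠ j) :
    (z * transvection i j t).submatrix r c = z.submatrix r c := by
  ext a b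
  rw [Matrix.submatrix_apply, mul_transv, if_neg (h b), add_zero, Matrix.submatrix_apply]

lemma det_mul_transv (z : Mat n) {κ : Type*} [Fintype κ] [DecidableEq κ] {r c : κ → Fin n}
    (hc : Function.Injective c) {i : Fin n} (b : κ) (t : ℝ) :
    ((z * transvection i (c b) t).submatrix r c).det =
      (z.submatrix r c).det + t * (z.submatrix r (Function.update c b i)).det := by
  have e1 : (z * transvection i (c b) t).submatrix r c =
      (z.submatrix r c).updateCol b ((fun a => z (r a) (c b)) + t • fun a => z (r a) i) := by
    ext a d
    rw [Matrix.submatrix_apply, mul_transv, Matrix.updateCol_apply]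
    by_cases h : d = b
    · subst h; simp
    · simp [h, hc.ne h]
  have e2 : z.submatrix r (Function.update c b i) =
      (z.submatrix r c).updateCol b (fun a => z (r a) i) := by
    ext a d
    rw [Matrix.submatrix_apply, Matrix.updateCol_apply, Function.update_apply]
    by_cases h : d = b
    · subst h; simp
    · simp [h]
  have e3 : (z.submatrix r c).updateCol b (fun a => z (r a) (c b)) = z.submatrix r c := by
    ext a d
    rw [Matrix.updateCol_apply]
    by_cases h : d = b
    · subst h; simp
    · simp [h]
  rw [e1, Matrix.det_updateCol_add, Matrix.det_updateCol_smul, e2, e3]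

lemma totNonneg.mul_transv {z : Mat n} (hz : totNonneg z) {i j : Fin n} (hij : (j : ℕ) = i + 1)
    {t : ℝ} (ht : 0 ≤ t) : totNonneg (z * transvection i j t) := by
  rw [totNonneg_iff]
  intro k r c hr hc
  by_cases h : ∃ b, c b = j
  · obtain ⟨b, rfl⟩ := h
    rw [det_mul_transv z hc.injective]
    refine add_nonneg (hz.strict hr hc) (mul_nonneg ht (hz.mono hr ?_))
    intro a d had
    rw [Function.update_apply, Function.update_apply]
    split_ifs with h1 h2 h2
    · exact le_rfl
    · subst h1
      have := Fin.lt_def.1 (hc (lt_of_le_of_ne had (Ne.symm h2)))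
      exact Fin.le_def.2 (by omega)
    · subst h2
      have := Fin.lt_def.1 (hc (lt_of_le_of_ne had h1))
      exact Fin.le_def.2 (by omega)
    · exact hc.monotone had
  · rw [submatrix_mul_transv_notMem z t (not_exists.1 h)]
    exact hz.strict hr hc

lemma totNonneg_one : totNonneg (1 : Mat n) := by
  rw [totNonneg_iff]
  intro k r c hr hc
  by_cases h : r = c
  · subst h
    rw [Matrix.submatrix_one _ hr.injective, det_one]; exact zero_le_one
  · have : ∃ a, ∀ b, r a ≠ c b := by
      by_contra hcon
      push Not at hcon
      choose f hf using hcon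
      have hfs : StrictMono f := fun a b hab => by
        have := hr hab
        rw [hf, hf b] at this
        exact hc.lt_iff_lt.1 this
      have hfid : f = id := by
        have := Subsingleton.elim (StrictMono.orderIsoOfSurjective f hfs
          (Finite.surjective_of_injective hfs.injective)) (OrderIso.refl _)
        funext a
        exact DFunLike.congr_fun this a
      exact h (funext fun a => by rw [hf a, hfid]; rfl)
    obtain ⟨a, ha⟩ := this
    rw [Matrix.det_eq_zero_of_row_eq_zero a fun b => by simp [ha b]]

/-- The totally nonnegative unipotent semigroup. -/
def YY (n : ℕ) : Set (Mat n) := {x | upperUni x ∧ totNonneg x}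

lemma YY_one : (1 : Mat n) ∈ YY n := ⟨upperUni.one, totNonneg_one⟩

lemma YY_mul_transv {x : Mat n} (hx : x ∈ YY n) {i j : Fin n} (hij : (j : ℕ) = i + 1)
    {t : ℝ} (ht : 0 ≤ t) : x * transvection i j t ∈ YY n :=
  ⟨hx.1.mul (upperUni_transv (Fin.lt_def.2 (by omega)) t), hx.2.mul_transv hij ht⟩

lemma isClosed_YY : IsClosed (YY n) := by
  have e : YY n = {x | (∀ i, x i i = 1) ∧ ∀ i j : Fin n, j < i → x i j = 0} ∩
      {x | ∀ (k : ℕ) (r c : Fin k → Fin n), StrictMono r → StrictMono c →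
        0 ≤ (x.submatrix r c).det} := by
    ext x; exact and_congr Iff.rfl totNonneg_iff
  rw [e]
  simp only [Set.ofPred_and, Set.ofPred_forall]
  have hc : ∀ i j : Fin n, Continuous fun x : Mat n => x i j := fun i j => by fun_prop
  refine IsClosed.inter (IsClosed.inter ?_ ?_) ?_
  · exact isClosed_iInter fun i => isClosed_eq (hc _ _) continuous_const
  · exact isClosed_iInter fun i => isClosed_iInter fun j => isClosed_iInter fun _ =>
      isClosed_eq (hc _ _) continuous_const
  · refine isClosed_iInter fun k => isClosed_iInter fun r => isClosed_iInter fun c =>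
      isClosed_iInter fun _ => isClosed_iInter fun _ => isClosed_le continuous_const ?_
    exact Continuous.matrix_det (Continuous.matrix_submatrix continuous_id _ _)

lemma cj_totNonneg {h : Fin n → ℝ} (hh : ∀ i, 0 < h i) {x : Mat n} (hx : totNonneg x) :
    totNonneg (cj h x) := by
  rw [totNonneg_iff]
  intro k r c hr hc
  have e : (cj h x).submatrix r c = diagonal (fun a => h (r a)) * x.submatrix r c *
      diagonal (fun a => (h (c a))⁻¹) := by
    ext a b
    rw [Matrix.mul_diagonal, Matrix.diagonal_mul, Matrix.submatrix_apply, cj_apply,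
      Matrix.submatrix_apply]
  rw [e, det_mul, det_mul, det_diagonal, det_diagonal]
  exact mul_nonneg (mul_nonneg (Finset.prod_nonneg fun _ _ => (hh _).le) (hx.strict hr hc))
    (Finset.prod_nonneg fun _ _ => inv_nonneg.2 (hh _).le)

lemma YY_cj {h : Fin n → ℝ} (hh : ∀ i, 0 < h i) {x : Mat n} (hx : x ∈ YY n) : cj h x ∈ YY n :=
  ⟨hx.1.cj fun i => (hh i).ne', cj_totNonneg hh hx.2⟩

lemma YY_dil_pos {t : ℝ} (ht : 0 < t) {x : Mat n} (hx : x ∈ YY n) : dil t x ∈ YY n := by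
  rw [dil_eq_cj ht.ne' hx.1]
  exact YY_cj (fun i => inv_pos.2 (pow_pos ht _)) hx

lemma YY_dil {t : ℝ} (ht : 0 ≤ t) {x : Mat n} (hx : x ∈ YY n) : dil t x ∈ YY n := by
  rcases ht.eq_or_lt with rfl | ht
  · rw [dil_zero hx.1]; exact YY_one
  · exact YY_dil_pos ht hx

lemma le_strAbove {x : Mat n} (hx : totNonneg x) {i j : Fin n} (hij : (j : ℕ) = i + 1) :
    x i j ≤ strAbove x := by
  have h : ∀ p ∈ (Finset.univ : Finset (Fin n × Fin n)),
      0 ≤ if (p.1 : ℕ) + 1 = (p.2 : ℕ) then x p.1 p.2 else 0 := fun p _ => by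
    split_ifs
    · exact hx.entry _ _
    · exact le_rfl
  have := Finset.single_le_sum h (Finset.mem_univ (i, j))
  rw [if_pos hij.symm] at this
  exact this

lemma strAbove_nonneg {x : Mat n} (hx : totNonneg x) : 0 ≤ strAbove x :=
  Finset.sum_nonneg fun p _ => by
    split_ifs
    · exact hx.entry _ _
    · exact le_rfl

lemma continuous_strAbove : Continuous (strAbove : Mat n → ℝ) := by
  unfold strAbove
  refine continuous_finsetSum _ fun p _ => ?_
  split_ifs
  · fun_prop
  · exact continuous_const

lemma upperUni.mul_super {x y : Mat n} (hx : upperUni x) (hy : upperUni y) {i j : Fin n}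
    (hij : (j : ℕ) = i + 1) : (x * y) i j = x i j + y i j := by
  have hne : i ≠ j := fun h => by subst h; omega
  rw [Matrix.mul_apply, Finset.sum_eq_add i j hne]
  · rw [hx.1, hy.1]; ring
  · rintro k - ⟨h1, h2⟩
    rcases lt_or_ge k i with h | h
    · rw [hx.2 i k h, zero_mul]
    · rw [hy.2 k j, mul_zero]
      have h3 : (k : ℕ) ≠ i := fun h => h1 (Fin.ext h)
      have h4 : (k : ℕ) ≠ j := fun h => h2 (Fin.ext h)
      have := Fin.le_def.1 h
      exact Fin.lt_def.2 (by omega)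
  · simp
  · simp

lemma strAbove_mul {x y : Mat n} (hx : upperUni x) (hy : upperUni y) :
    strAbove (x * y) = strAbove x + strAbove y := by
  unfold strAbove
  rw [← Finset.sum_add_distrib]
  refine Finset.sum_congr rfl fun p _ => ?_
  split_ifs with h
  · exact hx.mul_super hy h.symm
  · simp

lemma strAbove_transv {i j : Fin n} (hij : (j : ℕ) = i + 1) (t : ℝ) :
    strAbove (transvection i j t) = t := by
  unfold strAbove
  rw [Finset.sum_eq_single (i, j)]
  · have hne : i ≠ j := fun h => by subst h; omega
    simp [hij, transv_apply, hne]
  · rintro ⟨a, b⟩ - h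
    dsimp only
    split_ifs with h'
    · rw [transv_apply, if_neg (fun e => by subst e; omega), if_neg, add_zero]
      rintro ⟨rfl, rfl⟩; exact h rfl
    · rfl
  · simp

lemma YY_bound {x : Mat n} (hx : x ∈ YY n) {c : ℝ} (hc : strAbove x ≤ c) (d : ℕ) :
    ∀ i j : Fin n, (j : ℕ) ≤ i + d → x i j ≤ max 1 c ^ d := by
  induction d with
  | zero =>
    intro i j h
    rcases lt_or_ge j i with h' | h'
    · rw [hx.1.2 i j h']; simp
    · have : i = j := le_antisymm h' (Fin.le_def.2 (by omega))
      subst this; rw [hx.1.1]; simp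
  | succ d ih =>
    intro i j h
    by_cases hd : (j : ℕ) ≤ i + d
    · exact (ih i j hd).trans (pow_le_pow_right₀ (le_max_left _ _) (Nat.le_succ _))
    · have hi : (i : ℕ) + 1 < n := by have := j.2; omega
      have h1 := hx.2.two (i := i) (i' := ⟨i + 1, hi⟩) (j := ⟨i + 1, hi⟩) (j' := j)
        (Fin.lt_def.2 (Nat.lt_succ_self _)) (Fin.le_def.2 (by simp; omega))
      rw [hx.1.1, mul_one] at h1
      refine h1.trans ?_
      rw [pow_succ']
      refine mul_le_mul (((le_strAbove hx.2 rfl).trans hc).trans (le_max_right _ _))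
        (ih _ _ (by simp; omega)) (hx.2.entry _ _) (zero_le_one.trans (le_max_left _ _))

lemma isCompact_YY_le (c : ℝ) : IsCompact {x | x ∈ YY n ∧ strAbove x ≤ c} := by
  have h1 : IsCompact {x : Mat n | ∀ i : Fin n, x i ∈ {y : Fin n → ℝ | ∀ j, y j ∈ Set.Icc 0 (max 1 c ^ n)}} :=
    isCompact_pi_infinite fun i => isCompact_pi_infinite fun j => isCompact_Icc
  refine h1.of_isClosed_subset
    (isClosed_YY.inter (isClosed_le continuous_strAbove continuous_const)) ?_
  rintro x ⟨hx, hc⟩ i j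
  exact ⟨hx.2.entry _ _, YY_bound hx hc n i j (by omega)⟩

/-- The matrices obtained from reduced words with positive parameters. -/
inductive Red {n : ℕ} : Equiv.Perm (Fin n) → Mat n → Prop
  | one : Red 1 1
  | step {w : Equiv.Perm (Fin n)} {x : Mat n} {i j : Fin n} {t : ℝ} : Red w x →
      (j : ℕ) = i + 1 → w i < w j → 0 < t →
      Red (w * Equiv.swap i j) (x * transvection i j t)

lemma YY_mul_red {x g : Mat n} (hx : x ∈ YY n) (hg : Red w g) : x * g ∈ YY n := by
  induction hg with
  | one => rwa [mul_one]
  | step _ hij _ ht ih => rw [← Matrix.mul_assoc]; exact YY_mul_transv ih hij ht.le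

lemma Red.YY {g : Mat n} (hg : Red w g) : g ∈ YY n := by
  have := YY_mul_red YY_one hg
  rwa [one_mul] at this

lemma Red.Ncell {g : Mat n} (hg : Red w g) : g ∈ Ncell w := by
  induction hg with
  | one => exact ⟨upperUni.one, 1, 1, lowerTriInv.one, lowerTriInv.one, by simp [permMat_one]⟩
  | step _ hij hw ht ih => exact (chart_up ih hij hw ht.ne').1

lemma mem_Gge_iff {z : Mat n} : z ∈ Gge u ↔ ∀ (m : ℕ) (h : m ≤ n),
    (z.submatrix (Fin.castLE h) (fun a => (u⁻¹ : Equiv.Perm (Fin n)) (Fin.castLE h a))).det ≠ 0 := by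
  have key : ∀ (m : ℕ) (h : m ≤ n), (lead m (z * permMat u⁻¹)).det = (z.submatrix (Fin.castLE h)
      (fun a => (u⁻¹ : Equiv.Perm (Fin n)) (Fin.castLE h a))).det := fun m h => by
    let e : Fin m ≃ {k : Fin n // (k : ℕ) < m} :=
      ⟨fun a => ⟨Fin.castLE h a, a.2⟩, fun s => ⟨s.1, s.2⟩, fun a => by ext; rfl, fun s => by
        ext; rfl⟩
    rw [← Matrix.det_submatrix_equiv_self e (lead m _), permMat_mul_right]
    rfl
  change hasGauss _ ↔ _
  rw [hasGauss_iff_lead]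
  constructor
  · intro h m hm
    rw [← key]; exact h m
  · intro h m
    rcases le_or_gt m n with hm | hm
    · rw [key m hm]; exact h m hm
    · rw [lead_det_ge hm.le, ← lead_det_ge le_rfl, key n le_rfl]; exact h n le_rfl

lemma totNonneg.det_mul_det_nonneg {z : Mat n} (hz : totNonneg z) {k : ℕ} {r f f' : Fin k → Fin n}
    (hr : StrictMono r) (hf : Function.Injective f)
    (hff' : ∀ a b, f a < f b → f' a < f' b) :
    0 ≤ (z.submatrix r f).det * (z.submatrix r f').det := by
  set σ := Tuple.sort f
  have h1 : StrictMono (f ∘ σ) := (Tuple.monotone_sort f).strictMono_of_injective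
    (hf.comp σ.injective)
  have h2 : StrictMono (f' ∘ σ) := fun a b hab => hff' _ _ (h1 hab)
  have e : ∀ g : Fin k → Fin n, (z.submatrix r (g ∘ σ)).det =
      Equiv.Perm.sign σ * (z.submatrix r g).det := fun g => by
    rw [← Matrix.det_permute', Matrix.submatrix_submatrix]; rfl
  have h3 := mul_nonneg (hz.strict hr h1) (hz.strict hr h2)
  rw [e, e] at h3
  rcases Int.units_eq_one_or (Equiv.Perm.sign σ) with h | h <;> rw [h] at h3 <;> simpa using h3

lemma Gge_step {z : Mat n} (hz : z ∈ YY n) {i j : Fin n} (hij : (j : ℕ) = i + 1) (hu : u j < u i)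
    {t : ℝ} (ht : 0 < t) (h : z ∈ Gge (u * Equiv.swap i j)) :
    z * transvection i j t ∈ Gge u := by
  rw [mem_Gge_iff] at h ⊢
  intro m hm
  have h := h m hm
  have hlt : i < j := Fin.lt_def.2 (by omega)
  set r : Fin m → Fin n := Fin.castLE hm with hrdef
  have hr : StrictMono r := Fin.strictMono_castLE hm
  set f : Fin m → Fin n := fun a => (u⁻¹ : Equiv.Perm (Fin n)) (r a) with hfdef
  have hf : Function.Injective f := u⁻¹.injective.comp hr.injective
  have hf' : (fun a => ((u * Equiv.swap i j)⁻¹ : Equiv.Perm (Fin n)) (r a)) =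
      fun a => Equiv.swap i j (f a) := by
    funext a
    rw [_root_.mul_inv_rev, Equiv.swap_inv, Equiv.Perm.mul_apply]
  rw [hf'] at h
  have hmem : ∀ k, (∃ a, f a = k) ↔ (u k : ℕ) < m := fun k => by
    constructor
    · rintro ⟨a, rfl⟩
      simp [hfdef, hrdef]
    · intro hk
      exact ⟨⟨u k, hk⟩, by simp [hfdef, hrdef]⟩
  by_cases hj : ∃ b, f b = j
  · obtain ⟨b, hb⟩ := hj
    rw [← hb, det_mul_transv z hf]
    by_cases hi : ∃ b, f b = i
    · obtain ⟨d, hd⟩ := hi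
      have hbd : b ≠ d := fun e => by rw [e, hd] at hb; exact hlt.ne hb
      have h0 : (z.submatrix r (Function.update f b i)).det = 0 :=
        Matrix.det_zero_of_column_eq hbd fun a => by
          simp [Function.update_of_ne hbd.symm, hd]
      have e : z.submatrix r (fun a => Equiv.swap i j (f a)) =
          (z.submatrix r f).submatrix id (Equiv.swap b d) := by
        ext a c
        simp only [Matrix.submatrix_apply, id]
        congr 1
        rw [swap_apply_cases, swap_apply_cases]
        split_ifs with h1 h2 h3 h4 h5 h6 h7
        · subst h2; rw [hb] at h1; exact absurd h1 hlt.ne'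
        · exact hb.symm
        · exact absurd (hf (h1.trans hd.symm)) h3
        · exact hd.symm
        · subst h6; exact absurd hd h1
        · exact absurd (hf (h4.trans hb.symm)) h5
        · exact absurd hb (h7 ▸ h4)
        · exact absurd hd (by subst_vars; assumption)
        · rfl
      rw [e, Matrix.det_permute'] at h
      rw [h0, mul_zero, add_zero]
      exact right_ne_zero_of_mul h
    · have e : (fun a => Equiv.swap i j (f a)) = Function.update f b i := by
        funext a
        rw [swap_apply_cases, Function.update_apply, if_neg fun h => hi ⟨a, h⟩]
        by_cases hab : a = b
        · subst hab; rw [if_pos hb, if_pos rfl]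
        · rw [if_neg hab, if_neg fun h => hab (hf (h.trans hb.symm))]
      rw [e] at h
      have h1 := hz.2.det_mul_det_nonneg (f' := Function.update f b i) hr hf fun a c hac => by
        rw [Function.update_apply, Function.update_apply]
        have h2 : ∀ a, (f a : ℕ) ≠ i := fun a h => hi ⟨a, Fin.ext h⟩
        have h3 := congrArg Fin.val hb
        rw [Fin.lt_def] at hac ⊢
        have := h2 a
        have := h2 c
        split_ifs with h4 h5 h5
        · subst h4 h5; omega
        · subst h4; omega
        · subst h5; omega
        · exact hac
      intro h2
      have h3 : (z.submatrix r f).det = -(t * (z.submatrix r (Function.update f b i)).det) := by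
        linarith
      rw [h3] at h1
      have := mul_pos ht (mul_self_pos.2 h)
      nlinarith
  · have hi : ¬ ∃ b, f b = i := by
      rw [hmem] at hj ⊢
      have := Fin.lt_def.1 hu
      omega
    rw [submatrix_mul_transv_notMem z t (not_exists.1 hj)]
    have e : (fun a => Equiv.swap i j (f a)) = f := by
      funext a
      exact Equiv.swap_apply_of_ne_of_ne (fun h => hi ⟨a, h⟩) fun h => hj ⟨a, h⟩
    rwa [e] at h

lemma Gge_mul_red {x g : Mat n} (hx : x ∈ YY n) (hg : Red w g) :
    ∀ u : Equiv.Perm (Fin n), bruhatLE u w → x * g ∈ Gge u := by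
  induction hg with
  | one =>
    intro u hu
    obtain rfl := eq_one_of_le_one hu
    rw [mul_one]
    exact (Gge_of_eq (A := x) lowerTriInv.one (upperUni_iff.1 hx.1) (by rw [permMat_one]; simp)).1
  | @step w g i j t hg hij hw ht ih =>
    intro u hu
    rw [← Matrix.mul_assoc]
    rcases lt_or_gt_of_ne (u.injective.ne (a₁ := i) (a₂ := j) (fun h => by subst h; omega)) with
      h | h
    · have h1 := bruhat_lift_asc hij hu h
      rw [swap_swap_mul] at h1
      refine (Amat_mul (ih u h1) ⟨?_, ?_⟩).1
      · intro a b hab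
        have hab' : u b < u a := hab
        rw [transv_apply, if_neg, if_neg, add_zero]
        · rintro ⟨rfl, rfl⟩; exact h.not_gt hab'
        · rintro rfl; exact hab'.false
      · exact (upperUni_transv (Fin.lt_def.2 (by omega)) t).1
    · have h1 := bruhat_lift_desc hij hu h
      rw [swap_swap_mul] at h1
      exact Gge_step (YY_mul_red hx hg) hij h ht (ih _ h1)

end

section

/-! ### Parametrization of the totally nonnegative cells -/

open Matrix Topology Filter

variable {n : ℕ} {u v w : Equiv.Perm (Fin n)}

lemma totNonneg.add_ne_zero {a b t : ℝ} (h : 0 ≤ a * b) (ha : a ≠ 0) (ht : 0 ≤ t) :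
    a + t * b ≠ 0 := by
  intro h0
  have h1 : a = -(t * b) := by linarith
  have h2 : a * a = -(t * (a * b)) := by
    calc a * a = a * -(t * b) := by rw [← h1]
      _ = _ := by ring
  have := mul_self_pos.2 ha
  have := mul_nonneg ht h
  linarith

lemma Gge_mul_transv {z : Mat n} (hz : z ∈ YY n) {i j : Fin n} (hij : (j : ℕ) = i + 1)
    {t : ℝ} (ht : 0 ≤ t) (h : z ∈ Gge u) : z * transvection i j t ∈ Gge u := by
  rw [mem_Gge_iff] at h ⊢
  intro m hm
  have h := h m hm
  have hr : StrictMono (Fin.castLE hm) := Fin.strictMono_castLE hm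
  set f : Fin m → Fin n := fun a => (u⁻¹ : Equiv.Perm (Fin n)) (Fin.castLE hm a) with hfdef
  have hf : Function.Injective f := u⁻¹.injective.comp hr.injective
  by_cases hj : ∃ b, f b = j
  · obtain ⟨b, hb⟩ := hj
    rw [← hb, det_mul_transv z hf]
    by_cases hi : ∃ d, f d = i
    · obtain ⟨d, hd⟩ := hi
      have hbd : b ≠ d := fun e => by rw [e, hd] at hb; subst hb; omega
      rw [Matrix.det_zero_of_column_eq (M := z.submatrix (Fin.castLE hm) (Function.update f b i)) hbd
        fun a => by simp [Function.update_of_ne hbd.symm, hd], mul_zero, add_zero]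
      exact h
    · refine totNonneg.add_ne_zero (hz.2.det_mul_det_nonneg hr hf fun a c hac => ?_) h ht
      rw [Function.update_apply, Function.update_apply]
      have h2 : ∀ a, (f a : ℕ) ≠ i := fun a h => hi ⟨a, Fin.ext h⟩
      have h3 := congrArg Fin.val hb
      rw [Fin.lt_def] at hac ⊢
      have := h2 a
      have := h2 c
      split_ifs with h4 h5 h5
      · subst h4 h5; omega
      · subst h4; omega
      · subst h5; omega
      · exact hac
  · rw [submatrix_mul_transv_notMem z t (not_exists.1 hj)]
    exact h

lemma Gge_mul_red' {x g : Mat n} (hx : x ∈ YY n) (hu : x ∈ Gge u) (hg : Red w g) :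
    x * g ∈ Gge u := by
  induction hg with
  | one => rwa [mul_one]
  | step hg hij _ ht ih =>
    rw [← Matrix.mul_assoc]
    exact Gge_mul_transv (YY_mul_red hx hg) hij ht.le ih

/-- The sets of matrices obtained from a fixed reduced word. -/
inductive Rd {n : ℕ} : Equiv.Perm (Fin n) → Set (Mat n) → Prop
  | one : Rd 1 {1}
  | step {w : Equiv.Perm (Fin n)} {R : Set (Mat n)} {i j : Fin n} : Rd w R →
      (j : ℕ) = i + 1 → w i < w j →
      Rd (w * Equiv.swap i j) {y | ∃ x ∈ R, ∃ t : ℝ, 0 < t ∧ y = x * transvection i j t}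

lemma Rd.red {R : Set (Mat n)} (h : Rd w R) {x : Mat n} (hx : x ∈ R) : Red w x := by
  induction h generalizing x with
  | one => obtain rfl : x = 1 := hx; exact Red.one
  | step _ hij hw ih =>
    obtain ⟨x, hx, t, ht, rfl⟩ := hx
    exact (ih hx).step hij hw ht

lemma Red.rd {x : Mat n} (h : Red w x) : ∃ R, Rd w R ∧ x ∈ R := by
  induction h with
  | one => exact ⟨_, Rd.one, rfl⟩
  | step _ hij hw ht ih =>
    obtain ⟨R, hR, hx⟩ := ih
    exact ⟨_, hR.step hij hw, _, hx, _, ht, rfl⟩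

lemma Rd.nonempty {R : Set (Mat n)} (h : Rd w R) : R.Nonempty := by
  induction h with
  | one => exact ⟨1, rfl⟩
  | step _ hij hw ih =>
    obtain ⟨x, hx⟩ := ih
    exact ⟨_, x, hx, 1, one_pos, rfl⟩

/-- `R` is a relatively open and closed subset of `D`. -/
def RelClopen {X : Type*} [TopologicalSpace X] (R D : Set X) : Prop :=
  (∃ U, IsOpen U ∧ R = D ∩ U) ∧ ∃ F, IsClosed F ∧ R = D ∩ F

lemma RelClopen.mem_of_preconnected {X Z : Type*} [TopologicalSpace X] [TopologicalSpace Z]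
    [PreconnectedSpace Z] {R D : Set X} (h : RelClopen R D) {f : Z → X} (hf : Continuous f)
    (hD : ∀ z, f z ∈ D) {z₀ : Z} (h₀ : f z₀ ∈ R) (z : Z) : f z ∈ R := by
  obtain ⟨⟨U, hU, eU⟩, F, hF, eF⟩ := h
  have e1 : f ⁻¹' R = f ⁻¹' U := by
    ext z; rw [Set.mem_preimage, eU]; exact ⟨fun h => h.2, fun h => ⟨hD z, h⟩⟩
  have e2 : f ⁻¹' R = f ⁻¹' F := by
    ext z; rw [Set.mem_preimage, eF]; exact ⟨fun h => h.2, fun h => ⟨hD z, h⟩⟩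
  have hc : IsClopen (f ⁻¹' R) := ⟨e2 ▸ hF.preimage hf, e1 ▸ hU.preimage hf⟩
  have := hc.eq_univ ⟨z₀, h₀⟩
  exact Set.eq_univ_iff_forall.1 this z

lemma continuous_transv (i j : Fin n) : Continuous fun t : ℝ => transvection i j t :=
  continuous_matrix fun a b => by
    simp only [transv_apply]
    refine continuous_const.add ?_
    split_ifs
    · exact continuous_id
    · exact continuous_const

lemma transv_mul_transv {i j : Fin n} (hij : i ≠ j) (s t : ℝ) :
    transvection i j s * transvection i j t = transvection i j (s + t) :=
  transvection_mul_transvection_same i j hij s t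

/-- The chart removing the last letter. -/
noncomputable def chart (w : Equiv.Perm (Fin n)) (i j : Fin n) (y : Mat n) : Mat n :=
  y * transvection i j (-(Amat w y j i)⁻¹)

lemma continuousAt_Amat_apply {y : Mat n} (hy : y ∈ Gge w) (i j : Fin n) :
    ContinuousAt (fun y => Amat w y i j) y :=
  ContinuousAt.comp (g := fun M : Mat n => M i j) (by fun_prop : Continuous fun M : Mat n =>
    M i j).continuousAt (continuousAt_Amat hy)

lemma continuousAt_chart {y : Mat n} (hy : y ∈ Gge w) {i j : Fin n} (hc : Amat w y j i ≠ 0) :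
    ContinuousAt (chart w i j) y := by
  refine ContinuousAt.matMul continuousAt_id ?_
  refine ContinuousAt.comp (g := fun t : ℝ => transvection i j t)
    (continuous_transv i j).continuousAt ?_
  exact ((continuousAt_Amat_apply hy j i).inv₀ hc).neg

lemma chart_mul {x : Mat n} (hx : x ∈ Ncell w) {i j : Fin n} (hij : (j : ℕ) = i + 1)
    (hw : w i < w j) {t : ℝ} (ht : t ≠ 0) :
    chart (w * Equiv.swap i j) i j (x * transvection i j t) = x := by
  have hne : i ≠ j := fun h => by subst h; omega
  rw [chart, (chart_up hx hij hw ht).2, Matrix.mul_assoc, transv_mul_transv hne, inv_inv,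
    add_neg_cancel, transvection_zero, mul_one]

lemma chart_mul_self {y : Mat n} {i j : Fin n} (hij : (j : ℕ) = i + 1) :
    chart w i j y * transvection i j (Amat w y j i)⁻¹ = y := by
  have hne : i ≠ j := fun h => by subst h; omega
  rw [chart, Matrix.mul_assoc, transv_mul_transv hne, neg_add_cancel, transvection_zero, mul_one]

lemma Rd.relClopen {R : Set (Mat n)} (h : Rd w R) : RelClopen R (Ncell w) := by
  induction h with
  | one =>
    have e : (Ncell 1 : Set (Mat n)) = {1} := by
      ext x
      constructor
      · rintro ⟨hx, b, c, hb, hc, e⟩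
        rw [permMat_one, mul_one] at e
        have := (lowerTriInv_iff.1 (hb.mul hc)).2
        rw [← e] at this
        exact upper_lower_eq_one hx this
      · rintro rfl
        exact Red.one.Ncell
    rw [e]
    exact ⟨⟨Set.univ, isOpen_univ, by simp⟩, Set.univ, isClosed_univ, by simp⟩
  | @step w R i j hR hij hw ih =>
    set v := w * Equiv.swap i j with hv
    set R' := {y | ∃ x ∈ R, ∃ t : ℝ, 0 < t ∧ y = x * transvection i j t} with hR'
    have hvd : v j < v i := by simpa [hv] using hw
    have hvw : v * Equiv.swap i j = w := swap_swap_mul w i j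
    obtain ⟨⟨U, hU, eU⟩, F, hF, eF⟩ := ih
    have hcar : ∀ y, y ∈ R' ↔ y ∈ Ncell v ∧ 0 < Amat v y j i ∧ chart v i j y ∈ R := fun y => by
      constructor
      · rintro ⟨x, hx, t, ht, rfl⟩
        have hxc := (hR.red hx).Ncell
        refine ⟨(chart_up hxc hij hw ht.ne').1, ?_, ?_⟩
        · rw [(chart_up hxc hij hw ht.ne').2]; exact inv_pos.2 ht
        · rw [chart_mul hxc hij hw ht.ne']; exact hx
      · rintro ⟨hy, hc, h⟩
        exact ⟨_, h, _, inv_pos.2 hc, (chart_mul_self hij).symm⟩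
    have hdown : ∀ y ∈ Ncell v, Amat v y j i ≠ 0 → chart v i j y ∈ Ncell w := fun y hy hc => by
      have := chart_down hy hij hvd hc
      rwa [hvw] at this
    refine ⟨⟨(Gge v ∩ (fun y => Amat v y j i) ⁻¹' Set.Ioi 0) ∩ chart v i j ⁻¹' U, ?_, ?_⟩,
      closure R', isClosed_closure, ?_⟩
    · refine ContinuousOn.isOpen_inter_preimage (fun y hy => ?_) ?_ hU
      · exact (continuousAt_chart hy.1 (ne_of_gt hy.2)).continuousWithinAt
      · exact ContinuousOn.isOpen_inter_preimage
          (fun y hy => (continuousAt_Amat_apply hy j i).continuousWithinAt) isOpen_Gge isOpen_Ioi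
    · ext y
      rw [hcar]
      constructor
      · rintro ⟨h1, h2, h3⟩
        rw [eU] at h3
        exact ⟨h1, ⟨Ncell_Gge h1, h2⟩, h3.2⟩
      · rintro ⟨h1, ⟨-, h2⟩, h3⟩
        refine ⟨h1, h2, ?_⟩
        rw [eU]
        exact ⟨hdown y h1 (ne_of_gt h2), h3⟩
    · refine Set.Subset.antisymm (fun y hy => ⟨((hcar y).1 hy).1, subset_closure hy⟩) ?_
      rintro y ⟨hy, hyc⟩
      have : (𝓝[R'] y).NeBot := mem_closure_iff_nhdsWithin_neBot.1 hyc
      have hg := Ncell_Gge hy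
      have hbd : ∀ᶠ z in 𝓝[R'] y, (strAbove y + 1)⁻¹ ≤ Amat v z j i := by
        have h1 : ∀ᶠ z in 𝓝 y, strAbove z < strAbove y + 1 :=
          continuous_strAbove.continuousAt.eventually (gt_mem_nhds (by linarith))
        filter_upwards [nhdsWithin_le_nhds h1, self_mem_nhdsWithin] with z hz hzR
        obtain ⟨x, hx, t, ht, rfl⟩ := hzR
        have hxr := hR.red hx
        rw [(chart_up hxr.Ncell hij hw ht.ne').2]
        rw [strAbove_mul hxr.YY.1 (upperUni_transv (Fin.lt_def.2 (by omega)) t),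
          strAbove_transv hij] at hz
        have := strAbove_nonneg hxr.YY.2
        exact inv_anti₀ ht (by linarith)
      have hyY : y ∈ YY n := by
        refine isClosed_YY.closure_subset_iff.2 ?_ hyc
        intro z hz
        exact ((hR.step hij hw).red hz).YY
      have hpos : 0 < Amat v y j i := by
        have := strAbove_nonneg hyY.2
        refine lt_of_lt_of_le (inv_pos.2 (by linarith : 0 < strAbove y + 1)) ?_
        exact ge_of_tendsto (((continuousAt_Amat_apply hg j i).tendsto.mono_left
          nhdsWithin_le_nhds : Tendsto _ (𝓝[R'] y) _)) hbd
      rw [hcar]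
      refine ⟨hy, hpos, ?_⟩
      rw [eF]
      refine ⟨hdown y hy hpos.ne', ?_⟩
      refine hF.mem_of_tendsto (b := 𝓝[R'] y) ((continuousAt_chart hg hpos.ne').tendsto.mono_left
        nhdsWithin_le_nhds) ?_
      filter_upwards [self_mem_nhdsWithin] with z hz
      have := ((hcar z).1 hz).2.2
      rw [eF] at this
      exact this.2

lemma Rd.dil_mem {R : Set (Mat n)} (h : Rd w R) {x : Mat n} (hx : x ∈ R) {t : ℝ} (ht : 0 < t) :
    dil t x ∈ R := by
  have hxc := (h.red hx).Ncell
  have := h.relClopen.mem_of_preconnected (f := fun s : ℝ => dil (Real.exp s) x) (z₀ := 0)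
    (continuous_dil.comp (Real.continuous_exp.prodMk continuous_const)) (fun s => by
      rw [dil_eq_cj (Real.exp_pos s).ne' hxc.1]
      exact cj_Ncell (dil_ne (Real.exp_pos s).ne') hxc) (by simpa [dil_one] using hx) (Real.log t)
  simpa [Real.exp_log ht] using this

lemma Ncell_of_strictAnti (hw : StrictAnti w) {x : Mat n} (hx : upperUni x) (h : x ∈ Gge w) :
    x ∈ Ncell w := by
  refine ⟨hx, doubleCoset_iff.2 ⟨h, (UT_Amat x).2, fun i j hij => (UT_Amat x).1 (hw hij)⟩⟩

lemma Rd.path {R : Set (Mat n)} (h : Rd w R) (hw : StrictAnti w) {x g : Mat n} (hx : x ∈ YY n)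
    (hg : g ∈ R) : x * g ∈ R := by
  have := h.relClopen.mem_of_preconnected (f := fun s : ℝ => dil (s ^ 2) x * g) (z₀ := 0)
    ((continuous_dil.comp ((continuous_pow 2).prodMk continuous_const)).matrix_mul
      continuous_const) (fun s => by
      refine Ncell_of_strictAnti hw ((hx.1.dil _).mul (h.red hg).YY.1) ?_
      exact Gge_mul_red (YY_dil (sq_nonneg s) hx) (h.red hg) w (bruhatLE_refl w))
    (by simpa [dil_zero hx.1] using hg) 1
  simpa [dil_one] using this

lemma Rd.path' {R R' : Set (Mat n)} (h : Rd w R) (h' : Rd w R') (hw : StrictAnti w)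
    {x g : Mat n} (hx : x ∈ R') (hg : g ∈ R) (hm : x * g ∈ R) : x ∈ R := by
  have hxr := h'.red hx
  have := h.relClopen.mem_of_preconnected (f := fun s : ℝ => x * dil (s ^ 2) g) (z₀ := 1)
    (continuous_const.matrix_mul (continuous_dil.comp
      ((continuous_pow 2).prodMk continuous_const))) (fun s => by
      refine Ncell_of_strictAnti hw (hxr.YY.1.mul ((h.red hg).YY.1.dil _)) ?_
      rcases eq_or_ne s 0 with rfl | hs
      · simpa [dil_zero (h.red hg).YY.1] using Ncell_Gge hxr.Ncell
      · exact Gge_mul_red' hxr.YY (Ncell_Gge hxr.Ncell) (h.red (h.dil_mem hg (by positivity))))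
    (by simpa [dil_one] using hm) 0
  simpa [dil_zero (h.red hg).YY.1] using this

/-- A statistic decreasing along ascents. -/
def nu (w : Equiv.Perm (Fin n)) : ℤ := ∑ k : Fin n, (k : ℤ) * (w k : ℤ)

lemma nu_nonneg (w : Equiv.Perm (Fin n)) : 0 ≤ nu w :=
  Finset.sum_nonneg fun _ _ => by positivity

lemma nu_le (w : Equiv.Perm (Fin n)) : nu w ≤ n * (n * n) := by
  unfold nu
  calc _ ≤ ∑ _k : Fin n, (n * n : ℤ) := Finset.sum_le_sum fun k _ => by
        have := k.2
        have := (w k).2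
        exact mul_le_mul (by omega) (by omega) (by omega) (by omega)
    _ = _ := by simp

lemma nu_swap (w : Equiv.Perm (Fin n)) {i j : Fin n} (hij : (j : ℕ) = i + 1) :
    nu (w * Equiv.swap i j) = nu w - ((w j : ℤ) - w i) := by
  have hne : i ≠ j := fun h => by subst h; omega
  unfold nu
  rw [← Equiv.sum_comp (Equiv.swap i j), sub_eq_add_neg, neg_sub,
    ← sub_eq_iff_eq_add', ← Finset.sum_sub_distrib, Finset.sum_eq_add i j hne]
  · simp [hij]
    ring
  · rintro k - ⟨h1, h2⟩
    simp [Equiv.swap_apply_of_ne_of_ne h1 h2]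
  · simp
  · simp

/-- Induction along ascents, from long permutations to short ones. -/
lemma perm_induction_down {P : Equiv.Perm (Fin n) → Prop}
    (h : ∀ w, (∀ i j : Fin n, (j : ℕ) = i + 1 → w i < w j → P (w * Equiv.swap i j)) → P w) (w) :
    P w := by
  have key : ∀ (k : ℕ) (w : Equiv.Perm (Fin n)), nu w ≤ k → P w := by
    intro k
    induction k with
    | zero =>
      intro w hw
      refine h w fun i j hij hlt => ?_
      have h1 := nu_nonneg (w * Equiv.swap i j)
      rw [nu_swap w hij] at h1
      have := Fin.lt_def.1 hlt
      push_cast at hw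
      omega
    | succ k ih =>
      intro w hw
      refine h w fun i j hij hlt => ih _ ?_
      rw [nu_swap w hij]
      have := Fin.lt_def.1 hlt
      push_cast at hw
      omega
  exact key (nu w).toNat w (by rw [Int.toNat_of_nonneg (nu_nonneg w)])

/-- Induction along descents, from short permutations to long ones. -/
lemma perm_induction_up {P : Equiv.Perm (Fin n) → Prop}
    (h : ∀ w, (∀ i j : Fin n, (j : ℕ) = i + 1 → w j < w i → P (w * Equiv.swap i j)) → P w) (w) :
    P w := by
  have key : ∀ (k : ℕ) (w : Equiv.Perm (Fin n)), n * (n * n) - nu w ≤ k → P w := by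
    intro k
    induction k with
    | zero =>
      intro w hw
      refine h w fun i j hij hlt => ?_
      have h1 := nu_le (w * Equiv.swap i j)
      rw [nu_swap w hij] at h1
      have := Fin.lt_def.1 hlt
      push_cast at hw
      omega
    | succ k ih =>
      intro w hw
      refine h w fun i j hij hlt => ih _ ?_
      rw [nu_swap w hij]
      have := Fin.lt_def.1 hlt
      push_cast at hw
      omega
  exact key (n * (n * n) - nu w).toNat w
    (by rw [Int.toNat_of_nonneg (sub_nonneg.2 (nu_le w))])

lemma exists_ascent_or (w : Equiv.Perm (Fin n)) :
    (∃ i j : Fin n, (j : ℕ) = i + 1 ∧ w i < w j) ∨ StrictAnti w := by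
  by_cases h : ∃ i j : Fin n, (j : ℕ) = i + 1 ∧ w i < w j
  · exact Or.inl h
  · right
    cases n with
    | zero => exact fun i => i.elim0
    | succ n =>
      rw [Fin.strictAnti_iff_succ_lt]
      intro i
      refine lt_of_le_of_ne (not_lt.1 fun h' => h ⟨_, _, by simp, h'⟩) ?_
      exact w.injective.ne (Fin.castSucc_lt_succ (i := i)).ne'

lemma exists_descent_or (w : Equiv.Perm (Fin n)) :
    (∃ i j : Fin n, (j : ℕ) = i + 1 ∧ w j < w i) ∨ w = 1 := by
  by_cases h : ∃ i j : Fin n, (j : ℕ) = i + 1 ∧ w j < w i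
  · exact Or.inl h
  · right
    have hm : StrictMono w := by
      cases n with
      | zero => exact fun i => i.elim0
      | succ n =>
        rw [Fin.strictMono_iff_lt_succ]
        intro i
        refine lt_of_le_of_ne (not_lt.1 fun h' => h ⟨_, _, by simp, h'⟩) ?_
        exact w.injective.ne (Fin.castSucc_lt_succ (i := i)).ne
    ext k
    have := Subsingleton.elim (StrictMono.orderIsoOfSurjective w hm w.surjective) (OrderIso.refl _)
    exact congrArg Fin.val (DFunLike.congr_fun this k)

lemma Rd.unique (w : Equiv.Perm (Fin n)) : ∀ R R' : Set (Mat n), Rd w R → Rd w R' → R ⊆ R' := by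
  induction w using perm_induction_down with
  | h w ih =>
    intro R R' h h' x hx
    rcases exists_ascent_or w with ⟨i, j, hij, hw⟩ | hw
    · have h1 : x * transvection i j 1 ∈
          {y | ∃ x ∈ R, ∃ t : ℝ, 0 < t ∧ y = x * transvection i j t} := ⟨x, hx, 1, one_pos, rfl⟩
      obtain ⟨x', hx', t, ht, e⟩ := ih i j hij hw _ _ (h.step hij hw) (h'.step hij hw) h1
      have e1 := chart_mul (h.red hx).Ncell hij hw one_ne_zero
      rw [e, chart_mul (h'.red hx').Ncell hij hw ht.ne'] at e1
      exact e1 ▸ hx'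
    · obtain ⟨g, hg⟩ := h'.nonempty
      exact h'.path' h hw hx hg (h'.path hw (h.red hx).YY hg)

lemma exists_Rd (w : Equiv.Perm (Fin n)) : ∃ R, Rd w R := by
  induction w using perm_induction_up with
  | h w ih =>
    rcases exists_descent_or w with ⟨i, j, hij, hw⟩ | rfl
    · obtain ⟨R, hR⟩ := ih i j hij hw
      have := hR.step hij (by simpa using hw)
      rw [swap_swap_mul] at this
      exact ⟨_, this⟩
    · exact ⟨_, Rd.one⟩

lemma Rd.eq {R : Set (Mat n)} (h : Rd w R) : R = {x | Red w x} := by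
  ext x
  constructor
  · exact h.red
  · intro hx
    obtain ⟨R', h', hx'⟩ := Red.rd hx
    exact Rd.unique w _ _ h' h hx'

lemma Red.descent {x : Mat n} (h : Red w x) {i j : Fin n} (hij : (j : ℕ) = i + 1) (hw : w j < w i) :
    ∃ x' t, Red (w * Equiv.swap i j) x' ∧ 0 < t ∧ x = x' * transvection i j t := by
  obtain ⟨R, hR⟩ := exists_Rd (w * Equiv.swap i j)
  have h1 := hR.step hij (by simpa using hw)
  rw [swap_swap_mul] at h1
  have h2 : x ∈ {x | Red w x} := h
  rw [← h1.eq] at h2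
  obtain ⟨x', hx', t, ht, e⟩ := h2
  exact ⟨x', t, hR.red hx', ht, e⟩

lemma Red.mul_transv {x : Mat n} (h : Red w x) {i j : Fin n} (hij : (j : ℕ) = i + 1) {t : ℝ}
    (ht : 0 ≤ t) : ∃ w', Red w' (x * transvection i j t) := by
  have hne : i ≠ j := fun h => by subst h; omega
  rcases ht.eq_or_lt with rfl | ht
  · exact ⟨w, by simpa using h⟩
  rcases lt_or_gt_of_ne (w.injective.ne hne) with hw | hw
  · exact ⟨_, h.step hij hw ht⟩
  · obtain ⟨x', s, hx', hs, rfl⟩ := h.descent hij hw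
    have := hx'.step hij (t := s + t) (by simpa using hw) (by positivity)
    rw [Matrix.mul_assoc, transv_mul_transv hne]
    exact ⟨_, this⟩

/-- Products of `k` generators with parameters in `[0, c]`. -/
def KK (n : ℕ) (c : ℝ) : ℕ → Set (Mat n)
  | 0 => {1}
  | k + 1 => ⋃ p : {p : Fin n × Fin n // (p.2 : ℕ) = p.1 + 1},
      (fun q : Mat n × ℝ => q.1 * transvection p.1.1 p.1.2 q.2) '' (KK n c k ×ˢ Set.Icc 0 c)

lemma isCompact_KK (c : ℝ) (k : ℕ) : IsCompact (KK n c k) := by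
  induction k with
  | zero => exact isCompact_singleton
  | succ k ih =>
    refine isCompact_iUnion fun p => (ih.prod isCompact_Icc).image ?_
    exact continuous_fst.matrix_mul ((continuous_transv _ _).comp continuous_snd)

lemma KK_red (c : ℝ) (k : ℕ) {x : Mat n} (hx : x ∈ KK n c k) : ∃ w, Red w x := by
  induction k generalizing x with
  | zero => obtain rfl : x = 1 := hx; exact ⟨1, Red.one⟩
  | succ k ih =>
    simp only [KK, Set.mem_iUnion] at hx
    obtain ⟨p, ⟨y, t⟩, ⟨hy, ht⟩, rfl⟩ := hx
    obtain ⟨w, hw⟩ := ih hy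
    exact hw.mul_transv p.2 ht.1

lemma Rd.mem_KK {R : Set (Mat n)} (h : Rd w R) :
    ∃ k, ∀ x ∈ R, ∀ c, strAbove x ≤ c → x ∈ KK n c k := by
  induction h with
  | one => exact ⟨0, fun x hx c _ => hx⟩
  | @step w R i j hR hij hw ih =>
    obtain ⟨k, hk⟩ := ih
    refine ⟨k + 1, ?_⟩
    rintro _ ⟨x, hx, t, ht, rfl⟩ c hc
    have hxY := (hR.red hx).YY
    rw [strAbove_mul hxY.1 (upperUni_transv (Fin.lt_def.2 (by omega)) t),
      strAbove_transv hij] at hc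
    have := strAbove_nonneg hxY.2
    simp only [KK, Set.mem_iUnion]
    exact ⟨⟨(i, j), hij⟩, (x, t), ⟨hk x hx c (by linarith), ht.le, by linarith⟩, rfl⟩

lemma exists_strictAnti (n : ℕ) : ∃ w : Equiv.Perm (Fin n), StrictAnti w :=
  ⟨Fin.revPerm, fun _ _ h => Fin.rev_lt_rev.2 h⟩

lemma strAbove_dil {x : Mat n} (t : ℝ) : strAbove (dil t x) = t * strAbove x := by
  unfold strAbove
  rw [Finset.mul_sum]
  refine Finset.sum_congr rfl fun p _ => ?_
  split_ifs with h
  · have : (p.2 : ℕ) - p.1 = 1 := by omega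
    simp [dil, this]
  · simp

/-- Every totally nonnegative unipotent matrix factors into elementary ones. -/
lemma exists_red_of_YY {x : Mat n} (hx : x ∈ YY n) : ∃ w, Red w x := by
  obtain ⟨w, hw⟩ := exists_strictAnti n
  obtain ⟨R, hR⟩ := exists_Rd w
  obtain ⟨g, hg⟩ := hR.nonempty
  obtain ⟨k, hk⟩ := hR.mem_KK
  have hgY := (hR.red hg).YY
  refine KK_red (strAbove x + strAbove g) k ?_
  have hcont : Continuous fun s : ℝ => x * dil s g :=
    continuous_const.matrix_mul (continuous_dil.comp (continuous_id.prodMk continuous_const))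
  have h0 : Tendsto (fun s : ℝ => x * dil s g) (𝓝[>] 0) (𝓝 x) := by
    have := hcont.tendsto 0
    rw [dil_zero hgY.1, mul_one] at this
    exact this.mono_left nhdsWithin_le_nhds
  refine (isCompact_KK _ k).isClosed.mem_of_tendsto h0 ?_
  filter_upwards [Ioo_mem_nhdsGT one_pos] with s hs
  refine hk _ (hR.path hw hx (hR.dil_mem hg hs.1)) _ ?_
  rw [strAbove_mul hx.1 (hgY.1.dil s), strAbove_dil]
  have := strAbove_nonneg hgY.2
  nlinarith [hs.2]

lemma mem_Ycirc_iff {x : Mat n} : x ∈ Ycirc w ↔ Red w x := by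
  constructor
  · rintro ⟨h1, h2, h3⟩
    obtain ⟨w', hw'⟩ := exists_red_of_YY ⟨h1, h2⟩
    rwa [doubleCoset_disjoint h3 hw'.Ncell.2]
  · intro h
    exact ⟨h.YY.1, h.YY.2, h.Ncell.2⟩

lemma Ycirc_relClopen (w : Equiv.Perm (Fin n)) : RelClopen (Ycirc w) (Ncell w) := by
  obtain ⟨R, hR⟩ := exists_Rd w
  have e : Ycirc w = R := by
    rw [hR.eq]; ext x; exact mem_Ycirc_iff
  rw [e]
  exact hR.relClopen

lemma Yge_iff {x : Mat n} : x ∈ Yge u ↔ x ∈ YY n ∧ x ∈ Gge u := by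
  constructor
  · rintro ⟨v, huv, hx⟩
    have h := mem_Ycirc_iff.1 hx
    have := Gge_mul_red YY_one h u huv
    rw [one_mul] at this
    exact ⟨h.YY, this⟩
  · rintro ⟨hx, hu⟩
    obtain ⟨w, hw⟩ := exists_red_of_YY hx
    exact ⟨w, bruhatLE_of_Gge hw.Ncell.2 hu, mem_Ycirc_iff.2 hw⟩

end

section

open Matrix Topology Filter
variable {n : ℕ} {u v w : Equiv.Perm (Fin n)}

/-! ### Absolute extensors -/

/-- `S` is an absolute extensor for metrizable spaces. -/
def AE {X : Type} [TopologicalSpace X] (S : Set X) : Prop :=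
  ∀ (Z : Type) [TopologicalSpace Z] [TopologicalSpace.MetrizableSpace Z] (C : Set Z) (f : Z → X),
    IsClosed C → ContinuousOn f C → Set.MapsTo f C S →
      ∃ g : Z → X, Continuous g ∧ (∀ z, g z ∈ S) ∧ Set.EqOn g f C

section AE

variable {X X' : Type} [TopologicalSpace X] [TopologicalSpace X']

lemma AE.rel {S : Set X} (hS : AE S) {Z : Type} [TopologicalSpace Z]
    [TopologicalSpace.MetrizableSpace Z] {D F : Set Z} (hF : IsClosed F) {f : Z → X}
    (hf : ContinuousOn f (D ∩ F)) (hm : Set.MapsTo f (D ∩ F) S) :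
    ∃ g : Z → X, ContinuousOn g D ∧ Set.MapsTo g D S ∧ Set.EqOn g f (D ∩ F) := by
  obtain ⟨g, hg, hgS, hgf⟩ := hS D (Subtype.val ⁻¹' F) (fun z => f z)
    (hF.preimage continuous_subtype_val)
    (hf.comp continuous_subtype_val.continuousOn fun z hz => ⟨z.2, hz⟩)
    (fun z hz => hm ⟨z.2, hz⟩)
  refine ⟨fun z => if h : z ∈ D then g ⟨z, h⟩ else f z, ?_, fun z hz => ?_, fun z hz => ?_⟩
  · rw [continuousOn_iff_continuous_domRestrict]
    convert hg using 1
    ext z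
    simp
  · simpa [hz] using hgS _
  · simpa [hz.1] using hgf (x := ⟨z, hz.1⟩) hz.2

lemma AE.of_retract {S : Set X} (hS : AE S) {T : Set X'} {i : X' → X} {r : X → X'}
    (hi : ContinuousOn i T) (hiS : Set.MapsTo i T S) (hr : ContinuousOn r S)
    (hrT : Set.MapsTo r S T) (h : ∀ x ∈ T, r (i x) = x) : AE T := by
  intro Z _ _ C f hC hf hm
  obtain ⟨g, hg, hgS, hgf⟩ := hS Z C (i ∘ f) hC (hi.comp hf hm) (hiS.comp hm)
  refine ⟨r ∘ g, hr.comp_continuous hg hgS, fun z => hrT (hgS z), fun z hz => ?_⟩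
  simp only [Function.comp_apply, hgf hz]
  exact h _ (hm hz)

lemma AE_univ : AE (Set.univ : Set ℝ) := by
  intro Z _ _ C f hC hf hm
  obtain ⟨g, hg⟩ := ContinuousMap.exists_restrict_eq hC
    (⟨C.domRestrict f, continuousOn_iff_continuous_domRestrict.1 hf⟩ : C(C, ℝ))
  exact ⟨g, g.continuous, fun _ => trivial, fun z hz =>
    congrArg (fun k : C(C, ℝ) => k ⟨z, hz⟩) hg⟩

lemma AE_Ioi : AE (Set.Ioi (0 : ℝ)) :=
  AE_univ.of_retract (i := Real.log) (r := Real.exp)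
    (Real.continuousOn_log.mono fun _ hx => (Set.mem_Ioi.1 hx).ne') (fun _ _ => trivial)
    Real.continuous_exp.continuousOn (fun x _ => Real.exp_pos x) (fun _ hx => Real.exp_log hx)

lemma AE_Ici : AE (Set.Ici (0 : ℝ)) :=
  AE_univ.of_retract (i := id) (r := fun x => max 0 x) continuousOn_id (fun _ _ => trivial)
    (by fun_prop) (fun x _ => le_max_left 0 x) (fun _ hx => max_eq_right hx)

lemma AE_singleton (x : X) : AE ({x} : Set X) := by
  intro Z _ _ C f hC hf hm
  exact ⟨fun _ => x, continuous_const, fun _ => rfl, fun z hz => (hm hz).symm⟩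

lemma AE.prod {S : Set X} {T : Set X'} (hS : AE S) (hT : AE T) : AE (S ×ˢ T) := by
  intro Z _ _ C f hC hf hm
  obtain ⟨g, hg, hgS, hgf⟩ := hS Z C (fun z => (f z).1) hC hf.fst fun z hz => (hm hz).1
  obtain ⟨k, hk, hkT, hkf⟩ := hT Z C (fun z => (f z).2) hC hf.snd fun z hz => (hm hz).2
  exact ⟨fun z => (g z, k z), hg.prodMk hk, fun z => ⟨hgS z, hkT z⟩,
    fun z hz => Prod.ext (hgf hz) (hkf hz)⟩

lemma AE.extend_union {S : Set X} (hS : AE S) {Z : Type} [TopologicalSpace Z]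
    [TopologicalSpace.MetrizableSpace Z] {C D : Set Z} (hC : IsClosed C) (hD : IsClosed D)
    {f g : Z → X} (hf : ContinuousOn f C) (hg : Continuous g) (hfS : Set.MapsTo f C S)
    (hgS : ∀ z, g z ∈ S) (h : ∀ z ∈ C ∩ D, g z = f z) :
    ∃ k : Z → X, Continuous k ∧ (∀ z, k z ∈ S) ∧ Set.EqOn k f C ∧ Set.EqOn k g D := by
  have e1 : Set.EqOn (D.piecewise g f) g D := fun z hz => Set.piecewise_eq_of_mem _ _ _ hz
  have e2 : Set.EqOn (D.piecewise g f) f C := fun z hz => by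
    by_cases hzD : z ∈ D
    · rw [Set.piecewise_eq_of_mem _ _ _ hzD, h z ⟨hz, hzD⟩]
    · exact Set.piecewise_eq_of_notMem _ _ _ hzD
  obtain ⟨k, hk, hkS, hkf⟩ := hS Z (C ∪ D) (D.piecewise g f) (hC.union hD)
    ((hf.congr e2).union_of_isClosed (hg.continuousOn.congr e1) hC hD) (by
      rintro z (hz | hz)
      · rw [e2 hz]; exact hfS hz
      · rw [e1 hz]; exact hgS z)
  exact ⟨k, hk, hkS, fun z hz => (hkf (Or.inl hz)).trans (e2 hz),
    fun z hz => (hkf (Or.inr hz)).trans (e1 hz)⟩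

lemma AE.union {A U₁ U₂ : Set X} (hU₁ : IsOpen U₁) (hU₂ : IsOpen U₂) (hA : A ⊆ U₁ ∪ U₂)
    (h₁ : AE (A ∩ U₁)) (h₂ : AE (A ∩ U₂)) (h₁₂ : AE (A ∩ (U₁ ∩ U₂))) : AE A := by
  intro Z _ _ C f hC hf hm
  let := TopologicalSpace.metrizableSpaceMetric Z
  have c1 : IsClosed (C ∩ f ⁻¹' U₂ᶜ) := hf.preimage_isClosed_of_isClosed hC hU₂.isClosed_compl
  have c2 : IsClosed (C ∩ f ⁻¹' U₁ᶜ) := hf.preimage_isClosed_of_isClosed hC hU₁.isClosed_compl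
  have hdisj : Disjoint (C ∩ f ⁻¹' U₂ᶜ) (C ∩ f ⁻¹' U₁ᶜ) := by
    rw [Set.disjoint_left]
    rintro z ⟨hz, h2⟩ ⟨_, h1⟩
    exact (hA (hm hz)).elim h1 h2
  obtain ⟨φ, hφ0, hφ1, -⟩ := exists_continuous_zero_one_of_isClosed c1 c2 hdisj
  have hZ1 : IsClosed {z | φ z ≤ 1 / 2} := isClosed_le φ.continuous continuous_const
  have hZ2 : IsClosed {z | 1 / 2 ≤ φ z} := isClosed_le continuous_const φ.continuous
  have hZ12 : IsClosed {z | φ z = 1 / 2} := isClosed_eq φ.continuous continuous_const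
  have m1 : ∀ z ∈ C, φ z ≤ 1 / 2 → f z ∈ U₁ := by
    intro z hz h
    by_contra hn
    have := hφ1 ⟨hz, hn⟩
    simp only [Pi.one_apply] at this
    linarith
  have m2 : ∀ z ∈ C, 1 / 2 ≤ φ z → f z ∈ U₂ := by
    intro z hz h
    by_contra hn
    have := hφ0 ⟨hz, hn⟩
    simp only [Pi.zero_apply] at this
    linarith
  obtain ⟨g0, hg0, hg0S, hg0f⟩ := h₁₂ Z (C ∩ {z | φ z = 1 / 2}) f (hC.inter hZ12)
    (hf.mono Set.inter_subset_left)
    (fun z hz => ⟨hm hz.1, m1 z hz.1 (le_of_eq hz.2), m2 z hz.1 (le_of_eq hz.2.symm)⟩)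
  obtain ⟨g1, hg1, hg1S, hg1f, hg1g⟩ := h₁.extend_union (hC.inter hZ1) hZ12
    (hf.mono Set.inter_subset_left) hg0 (fun z hz => ⟨hm hz.1, m1 z hz.1 hz.2⟩)
    (fun z => ⟨(hg0S z).1, (hg0S z).2.1⟩) (fun z hz => hg0f ⟨hz.1.1, hz.2⟩)
  obtain ⟨g2, hg2, hg2S, hg2f, hg2g⟩ := h₂.extend_union (hC.inter hZ2) hZ12
    (hf.mono Set.inter_subset_left) hg0 (fun z hz => ⟨hm hz.1, m2 z hz.1 hz.2⟩)
    (fun z => ⟨(hg0S z).1, (hg0S z).2.2⟩) (fun z hz => hg0f ⟨hz.1.1, hz.2⟩)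
  refine ⟨fun z => if φ z ≤ 1 / 2 then g1 z else g2 z,
    hg1.if_le hg2 φ.continuous continuous_const fun z hz => (hg1g hz).trans (hg2g hz).symm,
    fun z => ?_, fun z hz => ?_⟩
  · simp only
    split_ifs
    exacts [(hg1S z).1, (hg2S z).1]
  · simp only
    split_ifs with h
    exacts [hg1f ⟨hz, h⟩, hg2f ⟨hz, (not_le.1 h).le⟩]

lemma AE.nonempty {S : Set X} (hS : AE S) (x : X) : S.Nonempty := by
  obtain ⟨g, -, hg, -⟩ := hS Unit ∅ (fun _ => x) isClosed_empty (continuousOn_empty _)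
    (Set.mapsTo_empty _ _)
  exact ⟨_, hg ()⟩

lemma AE.contractible [TopologicalSpace.MetrizableSpace X] {S : Set X} (hS : AE S) (x : X) :
    ContractibleSpace S := by
  obtain ⟨x₀, hx₀⟩ := hS.nonempty x
  rw [contractible_iff_id_nullhomotopic]
  have hA : IsClosed {q : unitInterval × S | q.1 = 0} :=
    isClosed_eq continuous_fst continuous_const
  have hB : IsClosed {q : unitInterval × S | q.1 = 1} :=
    isClosed_eq continuous_fst continuous_const
  obtain ⟨g, hg, hgS, hgf, hgx⟩ := hS.extend_union hA hB (f := fun q => (q.2 : X))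
    (g := fun _ => x₀) (by fun_prop) continuous_const (fun q _ => q.2.2) (fun _ => hx₀)
    (fun q hq => by
      have h0 : q.1 = 0 := hq.1
      have h1 : q.1 = 1 := hq.2
      rw [h0] at h1
      exact absurd h1 zero_ne_one)
  exact ⟨⟨x₀, hx₀⟩, ⟨⟨⟨fun q => ⟨g q, hgS q⟩, by fun_prop⟩, fun z => Subtype.ext (hgf rfl),
    fun z => Subtype.ext (hgx rfl)⟩⟩⟩

lemma AE.preconnected [TopologicalSpace.MetrizableSpace X] {S : Set X} (hS : AE S) (x : X) :
    PreconnectedSpace S := by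
  have := hS.contractible x
  infer_instance

end AE

instance : TopologicalSpace.MetrizableSpace (Matrix (Fin n) (Fin n) ℝ) :=
  inferInstanceAs (TopologicalSpace.MetrizableSpace (Fin n → Fin n → ℝ))

/-! ### Cells -/

lemma Ycirc_one : Ycirc (1 : Equiv.Perm (Fin n)) = {1} := by
  ext x
  rw [mem_Ycirc_iff]
  constructor
  · intro h
    obtain ⟨R, hR, hx⟩ := h.rd
    have := Rd.unique 1 R {1} hR Rd.one hx
    exact this
  · rintro rfl
    exact Red.one

lemma Ycirc_Ncell {x : Mat n} (h : x ∈ Ycirc w) : x ∈ Ncell w := ⟨h.1, h.2.2⟩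

lemma Ycirc_YY {x : Mat n} (h : x ∈ Ycirc w) : x ∈ YY n := ⟨h.1, h.2.1⟩

lemma AE_Ycirc (w : Equiv.Perm (Fin n)) : AE (Ycirc w) := by
  induction w using perm_induction_up with
  | h w ih =>
    rcases exists_descent_or w with ⟨i, j, hij, hw⟩ | rfl
    · have key : ∀ y ∈ Ycirc w, ∃ x t, x ∈ Ycirc (w * Equiv.swap i j) ∧ 0 < t ∧
          y = x * transvection i j t ∧ chart w i j y = x ∧ Amat w y j i = t⁻¹ := by
        intro y hy
        obtain ⟨x, t, hx, ht, rfl⟩ := (mem_Ycirc_iff.1 hy).descent hij hw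
        have hw' : (w * Equiv.swap i j) i < (w * Equiv.swap i j) j := by simpa using hw
        refine ⟨x, t, mem_Ycirc_iff.2 hx, ht, rfl, ?_, ?_⟩
        · simpa [swap_swap_mul] using chart_mul hx.Ncell hij hw' ht.ne'
        · simpa [swap_swap_mul] using (chart_up hx.Ncell hij hw' ht.ne').2
      refine ((ih i j hij hw).prod AE_Ioi).of_retract
        (i := fun y => (chart w i j y, (Amat w y j i)⁻¹))
        (r := fun q => q.1 * transvection i j q.2) ?_ ?_ ?_ ?_ ?_
      · intro y hy
        obtain ⟨x, t, hx, ht, -, -, e⟩ := key y hy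
        have h0 : Amat w y j i ≠ 0 := by rw [e]; positivity
        have hG := Ncell_Gge (Ycirc_Ncell hy)
        exact ((continuousAt_chart hG h0).prodMk
          ((continuousAt_Amat_apply hG j i).inv₀ h0)).continuousWithinAt
      · intro y hy
        obtain ⟨x, t, hx, ht, -, e', e⟩ := key y hy
        refine ⟨by simpa [e'] using hx, ?_⟩
        simpa [e] using ht
      · exact (continuous_fst.matrix_mul ((continuous_transv i j).comp continuous_snd)).continuousOn
      · rintro ⟨x, t⟩ ⟨hx, ht⟩
        have hw' : (w * Equiv.swap i j) i < (w * Equiv.swap i j) j := by simpa using hw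
        have := Red.step (mem_Ycirc_iff.1 hx) hij hw' ht
        rw [swap_swap_mul] at this
        exact mem_Ycirc_iff.2 this
      · intro y hy
        exact chart_mul_self hij
    · rw [Ycirc_one]
      exact AE_singleton 1

end

section

/-! ### Dilation of the fiber coordinate -/

open Matrix Topology Filter
variable {n : ℕ} {u v w : Equiv.Perm (Fin n)}

/-! ### The projections preserve the cells -/

lemma Ycirc_cj {h : Fin n → ℝ} (hh : ∀ i, 0 < h i) {x : Mat n} (hx : x ∈ Ycirc w) :
    cj h x ∈ Ycirc w :=
  have h0 := YY_cj hh (Ycirc_YY hx)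
  ⟨h0.1, h0.2, cj_doubleCoset (fun i => (hh i).ne') hx.2.2⟩

lemma continuous_XX {Z : Type} [TopologicalSpace Z] {f g : Z → Mat n} (hf : Continuous f)
    (hg : Continuous g) (hfu : ∀ z, f z ∈ Ncell u) (hgu : ∀ z, g z ∈ NU u) :
    Continuous fun z => XX u (f z) (g z) :=
  continuous_iff_continuousAt.2 fun z =>
    ContinuousAt.comp (f := fun z => (f z, g z)) (g := fun q : Mat n × Mat n => XX u q.1 q.2)
      (continuousAt_XX (Ncell_Gge (hfu z)) (hgu z)) (hf.prodMk hg).continuousAt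

lemma continuous_dil_left (p : Mat n) : Continuous fun t : ℝ => dil t p :=
  continuous_dil.comp (continuous_id.prodMk continuous_const)

lemma piMap_mem {x : Mat n} (hx : x ∈ YY n) (hu : x ∈ Gge u) : piMap u x ∈ Ycirc u := by
  obtain ⟨z, hz⟩ := exists_red_of_YY hx
  have hz := mem_Ycirc_iff.2 hz
  have hN := (piMap_spec hx.1 hu).2.1
  have hp : pc u x ∈ NU u := pc_mem x
  have h1 : XX u (piMap u x) (pc u x) = x := XX_pc hx.1 hu
  have hc : Continuous fun t : ℝ => XX u (piMap u x) (dil t (pc u x)) :=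
    continuous_XX continuous_const (continuous_dil_left _) (fun _ => hN) (fun t => NU_dil hp t)
  have hpos : ∀ s : ℝ, XX u (piMap u x) (dil (Real.exp s) (pc u x)) ∈ Ycirc z := by
    refine (Ycirc_relClopen z).mem_of_preconnected
      (f := fun s : ℝ => XX u (piMap u x) (dil (Real.exp s) (pc u x)))
      (hc.comp Real.continuous_exp) (fun s => ?_) (z₀ := 0) ?_
    · refine ⟨XX_upper hN (NU_dil hp _), ?_⟩
      rw [XX_mem_iff hN (NU_dil hp _), dil_eq_cj (Real.exp_pos s).ne' hp.2,
        cj_mem_iff (dil_ne (Real.exp_pos s).ne'), ← XX_mem_iff hN hp, h1]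
      exact hz.2.2
    · simpa [dil_one, h1] using hz
  have h0 : XX u (piMap u x) (dil 0 (pc u x)) ∈ YY n := by
    refine isClosed_YY.mem_of_tendsto
      (hc.continuousAt.tendsto.mono_left (nhdsWithin_le_nhds (s := Set.Ioi 0))) ?_
    filter_upwards [self_mem_nhdsWithin] with t ht
    have := hpos (Real.log t)
    rw [Real.exp_log ht] at this
    exact Ycirc_YY this
  rw [dil_zero hp.2, XX_one hN] at h0
  exact ⟨h0.1, h0.2, hN.2⟩

lemma XX_mem {x' x'' p : Mat n} (hp : p ∈ NU u) (hx' : x' ∈ Ycirc u) (h : XX u x' p ∈ Ycirc w)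
    (hx'' : x'' ∈ Ycirc u) : XX u x'' p ∈ Ycirc w := by
  have := (AE_Ycirc u).preconnected x'
  refine (Ycirc_relClopen w).mem_of_preconnected (Z := Ycirc u) (f := fun y => XX u y p)
    (continuous_XX continuous_subtype_val continuous_const (fun y => Ycirc_Ncell y.2)
      fun _ => hp) (fun y => ⟨XX_upper (Ycirc_Ncell y.2) hp, ?_⟩) (z₀ := ⟨x', hx'⟩) h ⟨x'', hx''⟩
  rw [XX_mem_iff (Ycirc_Ncell y.2) hp, ← XX_mem_iff (Ycirc_Ncell hx') hp]
  exact h.2.2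

lemma cj_cj_inv {h : Fin n → ℝ} (hh : ∀ i, h i ≠ 0) (x : Mat n) :
    cj h (cj (fun i => (h i)⁻¹) x) = x := by
  ext i j
  rw [cj_apply, cj_apply]
  have := hh i
  have := hh j
  field_simp

lemma XX_cj_mem {x' p : Mat n} (hp : p ∈ NU u) (hx' : x' ∈ Ycirc u) (h : XX u x' p ∈ Ycirc w)
    {k : Fin n → ℝ} (hk : ∀ i, 0 < k i) : XX u x' (cj k p) ∈ Ycirc w := by
  have hk' : ∀ i, 0 < (k i)⁻¹ := fun i => inv_pos.2 (hk i)
  have hm := Ycirc_cj hk' hx'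
  have := Ycirc_cj hk (XX_mem hp hx' h hm)
  rwa [cj_XX (fun i => (hk i).ne') (Ycirc_Ncell hm) hp, cj_cj_inv fun i => (hk i).ne'] at this

lemma XX_dil_mem {x' p : Mat n} (hp : p ∈ NU u) (hx' : x' ∈ Ycirc u) (h : XX u x' p ∈ Ycirc w)
    {t : ℝ} (ht : 0 < t) : XX u x' (dil t p) ∈ Ycirc w := by
  rw [dil_eq_cj ht.ne' hp.2]
  exact XX_cj_mem hp hx' h fun i => inv_pos.2 (pow_pos ht _)

/-! ### Superdiagonal entries of Gaussian factors -/

lemma gaussPlus_super {M : Mat n} (hM : UT u M) (i j : Fin n) :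
    gaussPlus M i j = (lead (i + 1) (M * transvection j i 1)).det - 1 := by
  obtain ⟨-, hL, hp, e⟩ := hM.split
  have hU := gaussPlus_upper M
  have h1 : (lead (i + 1) (M * transvection j i 1)).det =
      (lead (i + 1) (gaussPlus M * transvection j i 1)).det := by
    conv_lhs => rw [e, Matrix.mul_assoc, lead_lower_mul _ (lowerUni_iff.1 hL).1, det_mul,
      (lowerUni_iff.1 hL).det_lead toDual_inj, one_mul]
  have h2 : (lead (i + 1) (gaussPlus M * transvection j i 1)).BlockTriangular Subtype.val := by
    intro a b hab
    have hb : (b.1 : ℕ) < i := by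
      have := Fin.lt_def.1 hab
      have := a.2
      omega
    rw [lead, submatrix_apply, mul_transv, hU.2 _ _ hab, if_neg, add_zero]
    intro h
    exact absurd (congrArg Fin.val h) hb.ne
  rw [h1, det_of_isUpperTriangular h2, Finset.prod_eq_single (⟨i, by simp⟩ : {k : Fin n // (k : ℕ) < i + 1})]
  · simp [lead, hU.1]
  · intro b _ hb
    have : b.1 ≠ i := fun h => hb (Subtype.ext h)
    simp [lead, hU.1, this]
  · simp

lemma XX_super {x' p : Mat n} (hx : x' ∈ Ncell u) (hp : p ∈ NU u) {i j : Fin n}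
    (hij : (j : ℕ) = i + 1) :
    XX u x' p i j = x' i j + 1 - (lead (i + 1) (p⁻¹ * (Amat u x' * transvection j i 1))).det := by
  have hM : UT u (p⁻¹ * Amat u x') := (hp.1.inv u.injective).mul u.injective (UT_Amat x')
  have hg := gaussPlus_upper (p⁻¹ * Amat u x')
  have h1 := hg.mul_super hg.inv hij
  rw [Matrix.mul_nonsing_inv _ hg.isUnit, Matrix.one_apply_ne
    (by rintro rfl; omega), gaussPlus_super hM i j, Matrix.mul_assoc] at h1
  rw [XX, hx.1.mul_super hg.inv hij]
  linarith

lemma exists_det_add_vecMulVec {κ : Type} [Fintype κ] [DecidableEq κ] (A : Matrix κ κ ℝ)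
    (a b : κ → ℝ) : ∃ α β : ℝ, ∀ s : ℝ, (A + s • vecMulVec a b).det = α + β * s := by
  let B : Matrix (κ ⊕ Unit) (κ ⊕ Unit) ℝ := fromBlocks A 0 (Matrix.of fun _ k => b k) 1
  refine ⟨(B.updateCol (Sum.inr ()) (Sum.elim 0 1)).det,
    (B.updateCol (Sum.inr ()) (Sum.elim (-a) 0)).det, fun s => ?_⟩
  have h : A + s • vecMulVec a b =
      A - (Matrix.of fun k (_ : Unit) => -(s * a k)) * (Matrix.of fun (_ : Unit) k => b k) := by
    ext k l
    simp [Matrix.mul_apply, vecMulVec_apply, mul_assoc]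
  rw [h, ← det_fromBlocks_one₂₂, mul_comm, ← det_updateCol_smul, ← det_updateCol_add]
  congr 1
  ext k l
  rcases k with k | k <;> rcases l with l | l <;>
    simp [B]

lemma det_lead_cj (m : ℕ) {k : Fin n → ℝ} (q b : Mat n) :
    (lead m (cj k q * b)).det =
      (∏ r : {r : Fin n // (r : ℕ) < m}, k r) *
        (lead m (q * (diagonal (fun i => (k i)⁻¹) * b))).det := by
  rw [cj, Matrix.mul_assoc, Matrix.mul_assoc, lead_lower_mul, det_mul]
  · congr 1
    rw [lead, Matrix.submatrix_diagonal _ _ Subtype.val_injective, det_diagonal]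
    rfl
  · intro i j hij
    exact Matrix.diagonal_apply_ne _ (show i ≠ j from ne_of_lt (show i < j from hij))

lemma exists_det_lead_cj (m : ℕ) (k : Fin n → ℝ) (l : Fin n) (q b : Mat n) :
    ∃ α β : ℝ, ∀ s : ℝ, 0 < s →
      (lead m (cj (Function.update k l (if (l : ℕ) < m then s else s⁻¹)) q * b)).det
        = α + β * s := by
  obtain ⟨α, β, h⟩ := exists_det_add_vecMulVec
    (lead m (q * (diagonal (Function.update (fun i => (k i)⁻¹) l 0) * b)))
    (fun r => q r l) (fun r => b l r)
  have key : ∀ s : ℝ, (lead m (q * (diagonal (fun i => (Function.update k l s i)⁻¹) * b))).det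
      = α + β * s⁻¹ := by
    intro s
    rw [← h]
    congr 1
    ext r c
    simp only [lead, submatrix_apply, Matrix.add_apply, Matrix.smul_apply, vecMulVec_apply,
      smul_eq_mul]
    rw [Matrix.mul_apply, Matrix.mul_apply]
    simp only [diagonal_mul]
    rw [← Finset.add_sum_erase _ _ (Finset.mem_univ l),
      ← Finset.add_sum_erase (a := l) (f := fun x => q r x * (Function.update (fun i => (k i)⁻¹) l 0 x * b x c)) _ (Finset.mem_univ l)]
    have : ∀ x ∈ Finset.univ.erase l, q r x * ((Function.update k l s x)⁻¹ * b x c) =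
        q r x * (Function.update (fun i => (k i)⁻¹) l 0 x * b x c) := by
      intro x hx
      have := Finset.ne_of_mem_erase hx
      simp [this]
    rw [Finset.sum_congr rfl this]
    simp
    ring
  by_cases hl : (l : ℕ) < m
  · refine ⟨β * ∏ r ∈ Finset.univ.erase (⟨l, hl⟩ : {r : Fin n // (r : ℕ) < m}), k r,
      α * ∏ r ∈ Finset.univ.erase (⟨l, hl⟩ : {r : Fin n // (r : ℕ) < m}), k r, fun s hs => ?_⟩
    rw [if_pos hl, det_lead_cj, key, ← Finset.mul_prod_erase _ _ (Finset.mem_univ (⟨l, hl⟩ : {r : Fin n // (r : ℕ) < m}))]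
    have : ∀ x ∈ Finset.univ.erase (⟨l, hl⟩ : {r : Fin n // (r : ℕ) < m}),
        Function.update k l s x = k x := by
      intro x hx
      have := Finset.ne_of_mem_erase hx
      exact Function.update_of_ne (fun h => this (Subtype.ext h)) _ _
    rw [Finset.prod_congr rfl this]
    simp only [Function.update_self]
    field_simp
    ring
  · refine ⟨(∏ r : {r : Fin n // (r : ℕ) < m}, k r) * α,
      (∏ r : {r : Fin n // (r : ℕ) < m}, k r) * β, fun s hs => ?_⟩
    rw [if_neg hl, det_lead_cj, key]
    have : ∀ x ∈ (Finset.univ : Finset {r : Fin n // (r : ℕ) < m}),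
        Function.update k l s⁻¹ x = k x := by
      intro x _
      exact Function.update_of_ne (fun h : x.1 = l => hl (h ▸ x.2)) _ _
    rw [Finset.prod_congr rfl this, inv_inv]
    ring

/-! ### Monotonicity along dilations -/

lemma le_of_update_le {φ : (Fin n → ℝ) → ℝ}
    (h : ∀ y : Fin n → ℝ, (∀ i, 0 < y i) → ∀ l s s', 0 < s → s ≤ s' →
      φ (Function.update y l s) ≤ φ (Function.update y l s'))
    {y y' : Fin n → ℝ} (hy : ∀ i, 0 < y i) (hyy : ∀ i, y i ≤ y' i) : φ y ≤ φ y' := by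
  have : ∀ S : Finset (Fin n), φ y ≤ φ (S.piecewise y' y) := by
    intro S
    induction S using Finset.induction_on with
    | empty => simp
    | insert l S hl ih =>
      refine ih.trans ?_
      rw [Finset.piecewise_insert]
      have e : S.piecewise y' y = Function.update (S.piecewise y' y) l (y l) := by
        rw [← Finset.piecewise_eq_of_notMem S y' y hl, Function.update_eq_self]
      conv_lhs => rw [e]
      refine h _ (fun i => ?_) l _ _ (hy l) (hyy l)
      by_cases hi : i ∈ S
      · simpa [hi] using (hy i).trans_le (hyy i)
      · simpa [hi] using hy i
  simpa using this Finset.univ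

lemma XX_super_mono {x' p : Mat n} (hp : p ∈ NU u) (hx' : x' ∈ Ycirc u) (h : XX u x' p ∈ Ycirc w)
    {i j : Fin n} (hij : (j : ℕ) = i + 1) {s t : ℝ} (hs : 0 < s) (hst : s ≤ t) :
    XX u x' (dil s p) i j ≤ XX u x' (dil t p) i j := by
  let K : (Fin n → ℝ) → Fin n → ℝ := fun y l => if (l : ℕ) < i + 1 then y l else (y l)⁻¹
  have hK : ∀ {y : Fin n → ℝ}, (∀ i, 0 < y i) → ∀ l, 0 < K y l := by
    intro y hy l
    simp only [K]
    split_ifs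
    exacts [hy l, inv_pos.2 (hy l)]
  have hKu : ∀ (y : Fin n → ℝ) l s, K (Function.update y l s) =
      Function.update (K y) l (if (l : ℕ) < i + 1 then s else s⁻¹) := by
    intro y l s
    ext r
    by_cases hr : r = l
    · subst hr; simp [K]
    · simp [K, hr]
  have hN := Ycirc_Ncell hx'
  have hform : ∀ k : Fin n → ℝ, (∀ i, 0 < k i) → XX u x' (cj k p) i j = x' i j + 1 -
      (lead (i + 1) (cj k p⁻¹ * (Amat u x' * transvection j i 1))).det := by
    intro k hk
    have hk' := fun i => (hk i).ne'
    rw [XX_super hN (NU_cj hk' hp) hij, ← cj_inv hk' hp.2.isUnit]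
  have hdil : ∀ t : ℝ, 0 < t → dil t p = cj (K fun l => t ^ ((l : ℕ) - i + (i - l))) p := by
    intro t ht
    rw [dil_eq_cj ht.ne' hp.2]
    have : ∀ l : Fin n, K (fun l => t ^ ((l : ℕ) - i + (i - l))) l =
        t ^ (i : ℕ) * (t ^ (l : ℕ))⁻¹ := by
      intro l
      simp only [K]
      split_ifs with hl
      · rw [Nat.sub_eq_zero_of_le (by omega : (l : ℕ) ≤ i), zero_add, eq_mul_inv_iff_mul_eq₀
          (pow_pos ht _).ne', ← pow_add]
        congr 1
        omega
      · rw [Nat.sub_eq_zero_of_le (by omega : (i : ℕ) ≤ l), add_zero, inv_eq_iff_eq_inv, mul_inv,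
          inv_inv, eq_inv_mul_iff_mul_eq₀ (pow_pos ht _).ne', ← pow_add]
        congr 1
        omega
    ext a b
    rw [cj_apply, cj_apply, this, this]
    have := (pow_pos ht (i : ℕ)).ne'
    field_simp
  rw [hdil s hs, hdil t (hs.trans_le hst)]
  refine le_of_update_le (φ := fun y => XX u x' (cj (K y) p) i j) ?_ (fun l => by positivity)
    (fun l => by gcongr)
  intro y hy l s s' hs hss
  obtain ⟨α, β, hαβ⟩ := exists_det_lead_cj (i + 1) (K y) l p⁻¹ (Amat u x' * transvection j i 1)
  have hval : ∀ s, 0 < s → XX u x' (cj (K (Function.update y l s)) p) i j =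
      x' i j + 1 - (α + β * s) := by
    intro s hs
    rw [hform _ (hK fun r => ?_), hKu, hαβ s hs]
    by_cases hr : r = l
    · subst hr; simpa using hs
    · simpa [hr] using hy r
  have hnn : ∀ s, 0 < s → 0 ≤ x' i j + 1 - (α + β * s) := by
    intro s hs
    rw [← hval s hs]
    refine totNonneg.entry (XX_cj_mem hp hx' h (hK fun r => ?_)).2.1 i j
    by_cases hr : r = l
    · subst hr; simpa using hs
    · simpa [hr] using hy r
  have hβ : β ≤ 0 := by
    by_contra hβ
    push Not at hβ
    have := hnn ((|x' i j + 1 - α| + 1) / β) (by positivity)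
    rw [mul_div_cancel₀ _ hβ.ne'] at this
    linarith [le_abs_self (x' i j + 1 - α)]
  simp only [hval s hs, hval s' (hs.trans_le hss)]
  nlinarith

lemma dil_inv {p : Mat n} (hp : upperUni p) (t : ℝ) : (dil t p)⁻¹ = dil t p⁻¹ := by
  rcases eq_or_ne t 0 with rfl | ht
  · rw [dil_zero hp, dil_zero hp.inv, inv_one]
  · rw [dil_eq_cj ht hp, dil_eq_cj ht hp.inv, cj_inv (dil_ne ht) hp.isUnit]

lemma analytic_XX_super {x' p : Mat n} (hx : x' ∈ Ncell u) (hp : p ∈ NU u) {i j : Fin n}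
    (hij : (j : ℕ) = i + 1) : AnalyticOnNhd ℝ (fun t : ℝ => XX u x' (dil t p) i j) Set.univ := by
  have : (fun t : ℝ => XX u x' (dil t p) i j) = fun t : ℝ => x' i j + 1 -
      (lead (i + 1) (dil t p⁻¹ * (Amat u x' * transvection j i 1))).det := by
    ext t
    rw [XX_super hx (NU_dil hp t) hij, dil_inv hp.2]
  rw [this]
  intro t _
  simp only [det_apply', lead, submatrix_apply, Matrix.mul_apply, dil, Matrix.of_apply]
  fun_prop

lemma analytic_strAbove_XX {x' p : Mat n} (hx : x' ∈ Ncell u) (hp : p ∈ NU u) :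
    AnalyticOnNhd ℝ (fun t : ℝ => strAbove (XX u x' (dil t p))) Set.univ := by
  intro t _
  simp only [strAbove]
  refine Finset.analyticAt_fun_sum _ fun q _ => ?_
  split_ifs with h
  · exact analytic_XX_super hx hp h.symm t trivial
  · exact analyticAt_const

lemma strAbove_XX_mono {x' p : Mat n} (hp : p ∈ NU u) (hx' : x' ∈ Ycirc u)
    (h : XX u x' p ∈ Ycirc w) {s t : ℝ} (hs : 0 < s) (hst : s ≤ t) :
    strAbove (XX u x' (dil s p)) ≤ strAbove (XX u x' (dil t p)) := by
  refine Finset.sum_le_sum fun q _ => ?_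
  split_ifs with hq
  · exact XX_super_mono hp hx' h hq.symm hs hst
  · exact le_rfl

end

section

/-! ### The fibers of the projection -/

open Matrix Topology Filter
variable {n : ℕ} {u v w : Equiv.Perm (Fin n)}

/-! ### Fibers of the projection -/

lemma isClosed_NU (u : Equiv.Perm (Fin n)) : IsClosed (NU u) := by
  have h1 : ∀ i j : Fin n, Continuous fun x : Mat n => x i j := fun i j => by fun_prop
  have : NU u = {x : Mat n | (∀ i j, u j < u i → x i j = 0) ∧ (∀ i, x i i = 1) ∧
      ∀ i j, j < i → x i j = 0} := by
    ext x
    constructor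
    · intro h
      exact ⟨fun i j hij => h.1.1 hij, h.2.1, h.2.2⟩
    · intro h
      exact ⟨⟨fun i j hij => h.1 i j hij, h.2.1⟩, h.2.1, h.2.2⟩
  rw [this]
  simp only [Set.ofPred_and, Set.ofPred_forall]
  refine IsClosed.inter ?_ (IsClosed.inter ?_ ?_)
  · exact isClosed_iInter fun i => isClosed_iInter fun j => isClosed_iInter fun _ =>
      isClosed_eq (h1 i j) continuous_const
  · exact isClosed_iInter fun i => isClosed_eq (h1 i i) continuous_const
  · exact isClosed_iInter fun i => isClosed_iInter fun j => isClosed_iInter fun _ =>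
      isClosed_eq (h1 i j) continuous_const

/-- The totally nonnegative points in the fiber of `piMap u` over `x'`. -/
def Fib (u : Equiv.Perm (Fin n)) (x' : Mat n) : Set (Mat n) := {x | x ∈ YY n ∧ x'⁻¹ * x ∈ NU u}

lemma isCompact_Fib_le (x' : Mat n) (c : ℝ) :
    IsCompact {x | x ∈ Fib u x' ∧ strAbove x ≤ c} := by
  have h : {x | x ∈ Fib u x' ∧ strAbove x ≤ c} =
      {x | x ∈ YY n ∧ strAbove x ≤ c} ∩ (fun x => x'⁻¹ * x) ⁻¹' NU u := by
    ext x
    exact ⟨fun h => ⟨⟨h.1.1, h.2⟩, h.1.2⟩, fun h => ⟨⟨h.1.1, h.2⟩, h.1.2⟩⟩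
  rw [h]
  exact (isCompact_YY_le c).inter_right
    ((isClosed_NU u).preimage (continuous_const.matrix_mul continuous_id))

lemma Fib_spec {x' x : Mat n} (hx' : x' ∈ Ncell u) (h : x ∈ Fib u x') :
    x ∈ Gge u ∧ piMap u x = x' ∧ XX u x' (pc u x) = x := by
  have e : x' * (x'⁻¹ * x) = x := by
    rw [← Matrix.mul_assoc, Matrix.mul_nonsing_inv _ hx'.1.isUnit, Matrix.one_mul]
  have h1 : x ∈ Gge u := by
    have := (Amat_mul (Ncell_Gge hx') h.2.1).1
    rwa [e] at this
  have h2 : piMap u x = x' := by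
    have := piMap_mul hx' h.2
    rwa [e] at this
  exact ⟨h1, h2, by rw [← h2]; exact XX_pc h.1.1 h1⟩

lemma XX_Fib {x' p : Mat n} (hx' : x' ∈ Ncell u) (hp : p ∈ NU u) (h : XX u x' p ∈ YY n) :
    XX u x' p ∈ Fib u x' := by
  obtain ⟨m, c, hm, -, -, -, e, -⟩ := XX_spec (x' := x') hp
  refine ⟨h, ?_⟩
  rw [e, ← Matrix.mul_assoc, Matrix.nonsing_inv_mul _ hx'.1.isUnit, Matrix.one_mul]
  exact hm

lemma mem_Fib {x : Mat n} (hx : x ∈ YY n) (hu : x ∈ Gge u) : x ∈ Fib u (piMap u x) := by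
  have := XX_Fib (piMap_spec hx.1 hu).2.1 (pc_mem x) (by rw [XX_pc hx.1 hu]; exact hx)
  rwa [XX_pc hx.1 hu] at this

lemma eq_one_of_strAbove_le {x' p : Mat n} (hp : p ∈ NU u) (hx' : x' ∈ Ycirc u)
    (h : XX u x' p ∈ Ycirc w) {c : ℝ} (hc : ∀ t : ℝ, 0 < t → strAbove (XX u x' (dil t p)) ≤ c) :
    p = 1 := by
  have hN := Ycirc_Ncell hx'
  have key : ∀ i j : Fin n, i < j → p i j = 0 := by
    intro i j hij
    have hcont : ContinuousOn (fun x => pc u x i j) {x | x ∈ Fib u x' ∧ strAbove x ≤ c} := by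
      intro x hx
      exact ((continuous_id.matrix_elem i j).continuousAt.comp
        (continuousAt_pc (Fib_spec hN hx.1).1)).continuousWithinAt
    obtain ⟨C, hC⟩ := (isCompact_Fib_le x' c).exists_bound_of_continuousOn hcont
    have hb : ∀ t : ℝ, 0 < t → t ^ ((j : ℕ) - i) * |p i j| ≤ C := by
      intro t ht
      have := hC _ ⟨XX_Fib hN (NU_dil hp t) (Ycirc_YY (XX_dil_mem hp hx' h ht)), hc t ht⟩
      simp only [pc_XX hN (NU_dil hp t)] at this
      simpa [dil, abs_mul, abs_of_pos ht] using this
    by_contra hne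
    have hpos : 0 < |p i j| := abs_pos.2 hne
    have hC0 : 0 ≤ C := le_trans (by positivity) (hb 1 one_pos)
    have h1 := hb (C / |p i j| + 1) (by positivity)
    have h2 : C / |p i j| + 1 ≤ (C / |p i j| + 1) ^ ((j : ℕ) - i) := by
      refine le_self_pow₀ (by linarith [div_nonneg hC0 hpos.le]) ?_
      have := Fin.lt_def.1 hij
      omega
    have h3 := (mul_le_mul_of_nonneg_right h2 hpos.le).trans h1
    rw [add_mul, div_mul_cancel₀ _ hpos.ne'] at h3
    linarith
  ext i j
  rcases lt_trichotomy i j with hij | rfl | hij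
  · rw [key i j hij, one_apply_ne hij.ne]
  · rw [hp.2.1, one_apply_eq]
  · rw [hp.2.2 i j hij, one_apply_ne hij.ne']

/-- Nontrivial coordinates along the fiber over `x'`. -/
def DD (u : Equiv.Perm (Fin n)) (x' : Mat n) : Set (Mat n) :=
  {p | p ∈ NU u ∧ p ≠ 1 ∧ ∃ w, XX u x' p ∈ Ycirc w}

lemma strAbove_XX_strictMono {x' p : Mat n} (hx' : x' ∈ Ycirc u) (hp : p ∈ DD u x') :
    StrictMonoOn (fun t : ℝ => strAbove (XX u x' (dil t p))) (Set.Ici 0) := by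
  obtain ⟨hp, hp1, w, h⟩ := hp
  have hA := analytic_strAbove_XX (Ycirc_Ncell hx') hp
  have hcont : Continuous fun t : ℝ => strAbove (XX u x' (dil t p)) :=
    continuous_iff_continuousAt.2 fun t => (hA t trivial).continuousAt
  have hmono : ∀ s t : ℝ, 0 < s → s ≤ t →
      strAbove (XX u x' (dil s p)) ≤ strAbove (XX u x' (dil t p)) :=
    fun s t hs hst => strAbove_XX_mono hp hx' h hs hst
  have hstrict : ∀ s t : ℝ, 0 < s → s < t →
      strAbove (XX u x' (dil s p)) < strAbove (XX u x' (dil t p)) := by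
    intro s t hs hst
    refine lt_of_le_of_ne (hmono s t hs hst.le) fun heq => hp1 ?_
    have hc : ∀ r ∈ Set.Icc s t,
        strAbove (XX u x' (dil r p)) = strAbove (XX u x' (dil s p)) := fun r hr =>
      le_antisymm ((hmono r t (hs.trans_le hr.1) hr.2).trans heq.ge) (hmono s r hs hr.1)
    have hev : (fun t : ℝ => strAbove (XX u x' (dil t p))) =ᶠ[𝓝 ((s + t) / 2)]
        fun _ => strAbove (XX u x' (dil s p)) := by
      filter_upwards [Icc_mem_nhds (a := s) (b := t) (by linarith) (by linarith)] with r hr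
      exact hc r hr
    have := hA.eq_of_eventuallyEq analyticOnNhd_const hev
    exact eq_one_of_strAbove_le hp hx' h (c := strAbove (XX u x' (dil s p)))
      fun r _ => (congrFun this r).le
  intro s hs t ht hst
  rcases (Set.mem_Ici.1 hs).eq_or_lt with rfl | hs
  · have h0 : strAbove (XX u x' (dil 0 p)) ≤ strAbove (XX u x' (dil (t / 2) p)) := by
      refine le_of_tendsto (hcont.continuousAt.tendsto.mono_left
        (nhdsWithin_le_nhds (s := Set.Ioi 0))) ?_
      filter_upwards [Ioc_mem_nhdsGT (show (0 : ℝ) < t / 2 by linarith)] with r hr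
      exact hmono r _ hr.1 hr.2
    exact h0.trans_lt (hstrict _ _ (by linarith) (by linarith))
  · exact hstrict s t hs hst

lemma continuous_strAbove_XX {x' p : Mat n} (hx' : x' ∈ Ycirc u) (hp : p ∈ NU u) :
    Continuous fun t : ℝ => strAbove (XX u x' (dil t p)) :=
  continuous_iff_continuousAt.2 fun t =>
    (analytic_strAbove_XX (Ycirc_Ncell hx') hp t trivial).continuousAt

lemma exists_dil_strAbove {x' p : Mat n} (hx' : x' ∈ Ycirc u) (hp : p ∈ DD u x') {s : ℝ}
    (hs : 0 < s) : ∃ t : ℝ, 0 < t ∧ strAbove (XX u x' (dil t p)) = strAbove x' + s := by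
  have hN := Ycirc_Ncell hx'
  have h0 : strAbove (XX u x' (dil 0 p)) = strAbove x' := by rw [dil_zero hp.1.2, XX_one hN]
  obtain ⟨T, hT, hTs⟩ : ∃ T : ℝ, 0 < T ∧ strAbove x' + s < strAbove (XX u x' (dil T p)) := by
    by_contra hcon
    push Not at hcon
    obtain ⟨w, hw⟩ := hp.2.2
    exact hp.2.1 (eq_one_of_strAbove_le hp.1 hx' hw hcon)
  obtain ⟨t, ht, hts⟩ := intermediate_value_Icc hT.le (continuous_strAbove_XX hx' hp.1).continuousOn
    (show strAbove x' + s ∈ Set.Icc _ _ from ⟨by simp only [h0]; linarith, hTs.le⟩)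
  refine ⟨t, lt_of_le_of_ne ht.1 ?_, hts⟩
  rintro rfl
  simp only [h0] at hts
  linarith

/-- The dilation parameter raising `strAbove` by `s`. -/
noncomputable def Lam (u : Equiv.Perm (Fin n)) (x' p : Mat n) (s : ℝ) : ℝ :=
  if h : ∃ t : ℝ, 0 < t ∧ strAbove (XX u x' (dil t p)) = strAbove x' + s then h.choose else 0

lemma Lam_spec {x' p : Mat n} (hx' : x' ∈ Ycirc u) (hp : p ∈ DD u x') {s : ℝ} (hs : 0 < s) :
    0 < Lam u x' p s ∧ strAbove (XX u x' (dil (Lam u x' p s) p)) = strAbove x' + s := by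
  have h := exists_dil_strAbove hx' hp hs
  rw [Lam, dif_pos h]
  exact h.choose_spec

lemma Lam_eq {x' p : Mat n} (hx' : x' ∈ Ycirc u) (hp : p ∈ DD u x') {s t : ℝ} (hs : 0 < s)
    (ht : 0 < t) (h : strAbove (XX u x' (dil t p)) = strAbove x' + s) : Lam u x' p s = t :=
  have h1 := Lam_spec hx' hp hs
  (strAbove_XX_strictMono hx' hp).injOn h1.1.le ht.le (h1.2.trans h.symm)

lemma continuousOn_Lam {x' : Mat n} (hx' : x' ∈ Ycirc u) :
    ContinuousOn (fun q : Mat n × ℝ => Lam u x' q.1 q.2) (DD u x' ×ˢ Set.Ioi 0) := by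
  have hN := Ycirc_Ncell hx'
  rintro ⟨p₀, s₀⟩ ⟨hp₀, hs₀⟩
  have hcont : ∀ a : ℝ, Tendsto (fun q : Mat n × ℝ => strAbove (XX u x' (dil a q.1)) - q.2)
      (𝓝[DD u x' ×ˢ Set.Ioi 0] (p₀, s₀)) (𝓝 (strAbove (XX u x' (dil a p₀)) - s₀)) := by
    intro a
    have h1 : ContinuousAt (fun q : Mat n × ℝ => XX u x' (dil a q.1)) (p₀, s₀) :=
      ContinuousAt.comp (f := fun q : Mat n × ℝ => (x', dil a q.1))
        (g := fun q : Mat n × Mat n => XX u q.1 q.2)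
        (continuousAt_XX (Ncell_Gge hN) (NU_dil hp₀.1 a))
        (continuous_const.prodMk
          (continuous_dil.comp (continuous_const.prodMk continuous_fst))).continuousAt
    exact ((continuous_strAbove.continuousAt.comp h1).sub continuous_snd.continuousAt).tendsto.mono_left
      nhdsWithin_le_nhds
  obtain ⟨hL, hLs⟩ := Lam_spec hx' hp₀ hs₀
  refine tendsto_order.2 ⟨fun a ha => ?_, fun b hb => ?_⟩
  · have hm := strAbove_XX_strictMono hx' hp₀ (a := max a 0) (b := Lam u x' p₀ s₀)
      (Set.mem_Ici.2 (le_max_right _ _)) hL.le (max_lt ha hL)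
    simp only [hLs] at hm
    filter_upwards [(hcont (max a 0)).eventually_lt_const (sub_lt_iff_lt_add.2 hm),
      self_mem_nhdsWithin] with q hq hqm
    obtain ⟨h1, h2⟩ := Lam_spec hx' hqm.1 hqm.2
    refine (le_max_left a 0).trans_lt ?_
    by_contra hcon
    have := (strAbove_XX_strictMono hx' hqm.1).monotoneOn (a := Lam u x' q.1 q.2) (b := max a 0)
      h1.le (Set.mem_Ici.2 (le_max_right _ _)) (not_lt.1 hcon)
    simp only [h2] at this
    linarith
  · have hm := strAbove_XX_strictMono hx' hp₀ (a := Lam u x' p₀ s₀) (b := b)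
      hL.le (hL.trans hb).le hb
    simp only [hLs] at hm
    filter_upwards [(hcont b).eventually_const_lt (u := strAbove x') (by linarith),
      self_mem_nhdsWithin] with q hq hqm
    obtain ⟨h1, h2⟩ := Lam_spec hx' hqm.1 hqm.2
    by_contra hcon
    have := (strAbove_XX_strictMono hx' hqm.1).monotoneOn (a := b) (b := Lam u x' q.1 q.2)
      (hL.trans hb).le h1.le (not_lt.1 hcon)
    simp only [h2] at this
    linarith

/-- The point of the fiber over `x'` on the dilation ray of `p`, at height `s`. -/
noncomputable def TT (u : Equiv.Perm (Fin n)) (x' p : Mat n) (s : ℝ) : Mat n :=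
  XX u x' (dil (Lam u x' p s) p)

lemma TT_spec {x' p : Mat n} (hx' : x' ∈ Ycirc u) (hp : p ∈ DD u x') {s : ℝ} (hs : 0 < s)
    (h : XX u x' p ∈ Ycirc w) :
    TT u x' p s ∈ Ycirc w ∧ piMap u (TT u x' p s) = x' ∧
      strAbove (TT u x' p s) = strAbove x' + s :=
  have h1 := Lam_spec hx' hp hs
  ⟨XX_dil_mem hp.1 hx' h h1.1, piMap_XX (Ycirc_Ncell hx') (NU_dil hp.1 _), h1.2⟩

lemma TT_eq {x' p : Mat n} (hx' : x' ∈ Ycirc u) (hp : p ∈ DD u x') {s : ℝ} (hs : 0 < s)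
    (h : strAbove (XX u x' p) = strAbove x' + s) : TT u x' p s = XX u x' p := by
  rw [TT, Lam_eq hx' hp hs one_pos (by rw [dil_one]; exact h), dil_one]

lemma continuousOn_TT {x' : Mat n} (hx' : x' ∈ Ycirc u) :
    ContinuousOn (fun q : Mat n × ℝ => TT u x' q.1 q.2) (DD u x' ×ˢ Set.Ioi 0) := by
  intro q hq
  exact ContinuousAt.comp_continuousWithinAt
    (f := fun q : Mat n × ℝ => (x', dil (Lam u x' q.1 q.2) q.1))
    (g := fun q : Mat n × Mat n => XX u q.1 q.2)
    (continuousAt_XX (Ncell_Gge (Ycirc_Ncell hx')) (NU_dil hq.1.1 _))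
    (continuousWithinAt_const.prodMk (continuous_dil.continuousAt.comp_continuousWithinAt
      (f := fun q : Mat n × ℝ => (Lam u x' q.1 q.2, q.1)) (g := fun q : ℝ × Mat n => dil q.1 q.2)
      ((continuousOn_Lam hx' q hq).prodMk continuous_fst.continuousWithinAt)))

lemma Fib_strAbove_lt {x' x : Mat n} (hx' : x' ∈ Ycirc u) (h : x ∈ Fib u x') (hne : x ≠ x') :
    strAbove x' < strAbove x := by
  have hN := Ycirc_Ncell hx'
  obtain ⟨-, -, h3⟩ := Fib_spec hN h
  obtain ⟨w, hw⟩ := exists_red_of_YY h.1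
  have hp : pc u x ∈ NU u := pc_mem x
  have hD : pc u x ∈ DD u x' := by
    refine ⟨hp, fun h1 => hne ?_, w, by rw [h3]; exact mem_Ycirc_iff.2 hw⟩
    rw [← h3, h1, XX_one hN]
  have := strAbove_XX_strictMono hx' hD (a := 0) (b := 1) Set.self_mem_Ici
    (Set.mem_Ici.2 zero_le_one) one_pos
  simpa [dil_zero hp.2, dil_one, XX_one hN, h3] using this

lemma Fib_strAbove_le {x' x : Mat n} (hx' : x' ∈ Ycirc u) (h : x ∈ Fib u x') :
    strAbove x' ≤ strAbove x := by
  rcases eq_or_ne x x' with rfl | hne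
  exacts [le_rfl, (Fib_strAbove_lt hx' h hne).le]

lemma tendsto_of_strAbove {Z : Type} {l : Filter Z} {x' : Mat n} (hx' : x' ∈ Ycirc u)
    {f : Z → Mat n} (hf : ∀ z, f z ∈ Fib u x')
    (h : Tendsto (fun z => strAbove (f z)) l (𝓝 (strAbove x'))) : Tendsto f l (𝓝 x') := by
  refine (isCompact_Fib_le (u := u) x' (strAbove x' + 1)).tendsto_nhds_of_unique_mapClusterPt
    ?_ fun y hy hc => ?_
  · filter_upwards [h.eventually_lt_const (lt_add_one _)] with z hz
    exact ⟨hf z, hz.le⟩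
  · by_contra hne
    have h1 : MapClusterPt (strAbove y) l (strAbove ∘ f) :=
      hc.continuousAt_comp continuous_strAbove.continuousAt
    have h2 : strAbove y = strAbove x' := by
      have := h1.neBot
      by_contra hd
      obtain ⟨U, V, hU, hV, hyU, hxV, hUV⟩ := t2_separation hd
      have hfr := h1.frequently (hU.mem_nhds hyU)
      have hev := h.eventually (hV.mem_nhds hxV)
      obtain ⟨z, hz, hz'⟩ := (hfr.and_eventually hev).exists
      exact Set.disjoint_left.1 hUV hz hz'
    exact (Fib_strAbove_lt hx' hy.1 hne).ne' h2

end

section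

/-! ### Gluing the cells -/

open Matrix Topology Filter
variable {n : ℕ} {u v w : Equiv.Perm (Fin n)}

lemma Gge_of_le {x : Mat n} (h : bruhatLE u w) (hx : x ∈ Ycirc w) : x ∈ Gge u :=
  (Yge_iff.1 ⟨w, h, hx⟩).2

lemma pc_mem_DD {x x' : Mat n} (h : bruhatLE u w) (hne : u ≠ w) (hx : x ∈ Ycirc w)
    (hx' : x' ∈ Ycirc u) : pc u x ∈ DD u x' ∧ XX u x' (pc u x) ∈ Ycirc w := by
  have hG := Gge_of_le h hx
  have hX : XX u x' (pc u x) ∈ Ycirc w :=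
    XX_mem (pc_mem x) (piMap_mem (Ycirc_YY hx) hG) (by rwa [XX_pc hx.1 hG]) hx'
  refine ⟨⟨pc_mem x, fun h1 => hne ?_, w, hX⟩, hX⟩
  rw [h1, XX_one (Ycirc_Ncell hx')] at hX
  exact doubleCoset_disjoint hx'.2.2 hX.2.2

/-- The union of the cells `Y°_z` for `z ∈ S`. -/
def YS (S : Finset (Equiv.Perm (Fin n))) : Set (Mat n) :=
  {x | ∃ z ∈ S, x ∈ Ycirc z}

variable {S : Finset (Equiv.Perm (Fin n))}

lemma continuousOn_pc_YS (hS : ∀ z ∈ S, bruhatLE u z) : ContinuousOn (pc u) (YS S) := by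
  rintro x ⟨z, hz, hx⟩
  exact (continuousAt_pc (Gge_of_le (hS z hz) hx)).continuousWithinAt

lemma AE_sphere (hS : ∀ z ∈ S, bruhatLE u z ∧ u ≠ z) (h : AE (YS S)) {x' : Mat n}
    (hx' : x' ∈ Ycirc u) {s : ℝ} (hs : 0 < s) :
    AE {x | x ∈ YS S ∧ piMap u x = x' ∧ strAbove x = strAbove x' + s} := by
  refine h.of_retract (i := id) (r := fun x => TT u x' (pc u x) s) continuousOn_id
    (fun x hx => hx.1) ?_ ?_ ?_
  · refine (continuousOn_TT hx').comp (f := fun x => (pc u x, s))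
      ((continuousOn_pc_YS fun z hz => (hS z hz).1).prodMk continuousOn_const) ?_
    rintro x ⟨z, hz, hx⟩
    exact ⟨(pc_mem_DD (hS z hz).1 (hS z hz).2 hx hx').1, hs⟩
  · rintro x ⟨z, hz, hx⟩
    obtain ⟨h1, h2⟩ := pc_mem_DD (hS z hz).1 (hS z hz).2 hx hx'
    obtain ⟨a, b, c⟩ := TT_spec hx' h1 hs h2
    exact ⟨⟨z, hz, a⟩, b, c⟩
  · rintro x ⟨⟨z, hz, hx⟩, hp, hst⟩
    have e : XX u x' (pc u x) = x := by
      rw [← hp]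
      exact XX_pc hx.1 (Gge_of_le (hS z hz).1 hx)
    simp only [id]
    rw [TT_eq hx' (pc_mem_DD (hS z hz).1 (hS z hz).2 hx hx').1 hs (by rw [e]; exact hst), e]

lemma AE_fiber (hS : ∀ z ∈ S, bruhatLE u z ∧ u ≠ z) (h : AE (YS S)) {x' : Mat n}
    (hx' : x' ∈ Ycirc u) : AE {x | x ∈ YS (insert u S) ∧ piMap u x = x'} := by
  have hself : ∀ x ∈ Ycirc u, piMap u x = x := fun x hx => piMap_self (Ycirc_Ncell hx)
  have hle : ∀ z ∈ insert u S, bruhatLE u z := by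
    intro z hz
    rcases Finset.mem_insert.1 hz with rfl | hz
    · exact bruhatLE_refl _
    · exact (hS z hz).1
  have hFib : ∀ x, x ∈ YS (insert u S) ∧ piMap u x = x' → x ∈ Fib u x' := by
    rintro x ⟨⟨z, hz, hx⟩, rfl⟩
    exact mem_Fib (Ycirc_YY hx) (Gge_of_le (hle z hz) hx)
  have hYS : ∀ x, x ∈ YS (insert u S) ∧ piMap u x = x' → x ≠ x' → x ∈ YS S := by
    rintro x ⟨⟨z, hz, hx⟩, hp⟩ hne
    rcases Finset.mem_insert.1 hz with rfl | hz
    · exact absurd (by rw [← hp, hself x hx]) hne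
    · exact ⟨z, hz, hx⟩
  have hbase : x' ∈ YS (insert u S) ∧ piMap u x' = x' :=
    ⟨⟨u, Finset.mem_insert_self _ _, hx'⟩, hself x' hx'⟩
  intro Z _ _ C f hC hf hm
  have hC0 : IsClosed (C ∩ f ⁻¹' {x'}) := hf.preimage_isClosed_of_isClosed hC isClosed_singleton
  obtain ⟨g, hg, hgS, hgf⟩ := h.rel (D := (C ∩ f ⁻¹' {x'})ᶜ) hC (f := f)
    (hf.mono Set.inter_subset_right) fun z hz => hYS _ (hm hz.2) fun e => hz.1 ⟨hz.2, e⟩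
  obtain ⟨σ, hσ, hσ0, hσf⟩ := AE_Ici Z C (fun z => strAbove (f z) - strAbove x') hC
    ((continuous_strAbove.comp_continuousOn hf).sub continuousOn_const)
    fun z hz => sub_nonneg.2 (Fib_strAbove_le hx' (hFib _ (hm hz)))
  set O : Set Z := (C ∩ f ⁻¹' {x'})ᶜ ∩ {z | 0 < σ z} with hO
  have hOo : IsOpen O := hC0.isOpen_compl.inter (isOpen_lt continuous_const hσ)
  have hT : ∀ z ∈ O, TT u x' (pc u (g z)) (σ z) ∈ YS S ∧
      piMap u (TT u x' (pc u (g z)) (σ z)) = x' ∧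
      strAbove (TT u x' (pc u (g z)) (σ z)) = strAbove x' + σ z := by
    intro z hz
    obtain ⟨y, hy, hgy⟩ := hgS hz.1
    obtain ⟨h1, h2⟩ := pc_mem_DD (hS y hy).1 (hS y hy).2 hgy hx'
    obtain ⟨a, b, c⟩ := TT_spec hx' h1 hz.2 h2
    exact ⟨⟨y, hy, a⟩, b, c⟩
  set e : Z → Mat n := fun z => if z ∈ O then TT u x' (pc u (g z)) (σ z) else x' with he
  have heO : ∀ z ∈ O, e z = TT u x' (pc u (g z)) (σ z) := fun z hz => if_pos hz
  have heN : ∀ z ∉ O, e z = x' := fun z hz => if_neg hz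
  have heF : ∀ z, e z ∈ YS (insert u S) ∧ piMap u (e z) = x' := by
    intro z
    by_cases hz : z ∈ O
    · rw [heO z hz]
      obtain ⟨⟨y, hy, a⟩, b, -⟩ := hT z hz
      exact ⟨⟨y, Finset.mem_insert_of_mem hy, a⟩, b⟩
    · rwa [heN z hz]
  have hes : ∀ z, strAbove (e z) ≤ strAbove x' + σ z := by
    intro z
    by_cases hz : z ∈ O
    · rw [heO z hz, (hT z hz).2.2]
    · rw [heN z hz]
      linarith [Set.mem_Ici.1 (hσ0 z)]
  have hσN : ∀ z ∉ O, σ z = 0 := by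
    intro z hz
    by_cases hzC : z ∈ C ∩ f ⁻¹' {x'}
    · rw [hσf hzC.1]
      simp [Set.mem_singleton_iff.1 hzC.2]
    · exact le_antisymm (not_lt.1 fun hlt => hz ⟨hzC, hlt⟩) (hσ0 z)
  refine ⟨e, continuous_iff_continuousAt.2 fun z => ?_, heF, fun z hz => ?_⟩
  · by_cases hz : z ∈ O
    · refine ContinuousOn.continuousAt ?_ (hOo.mem_nhds hz)
      refine ContinuousOn.congr ?_ heO
      refine (continuousOn_TT hx').comp (f := fun z => (pc u (g z), σ z))
        (((continuousOn_pc_YS fun z hz => (hS z hz).1).comp (hg.mono fun z hz => hz.1)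
          fun z hz => hgS hz.1).prodMk hσ.continuousOn) ?_
      intro z hz
      obtain ⟨y, hy, hgy⟩ := hgS hz.1
      exact ⟨(pc_mem_DD (hS y hy).1 (hS y hy).2 hgy hx').1, hz.2⟩
    · rw [ContinuousAt, heN z hz]
      refine tendsto_of_strAbove hx' (fun z => hFib _ (heF z)) ?_
      refine tendsto_of_tendsto_of_tendsto_of_le_of_le tendsto_const_nhds ?_
        (fun z => Fib_strAbove_le hx' (hFib _ (heF z))) hes
      have := (hσ.tendsto z).const_add (strAbove x')
      rwa [hσN z hz, add_zero] at this
  · by_cases hzO : z ∈ O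
    · have hzf : g z = f z := hgf ⟨hzO.1, hz⟩
      have hF := Fib_spec (Ycirc_Ncell hx') (hFib _ (hm hz))
      obtain ⟨y, hy, hgy⟩ := hgS hzO.1
      have hD := (pc_mem_DD (hS y hy).1 (hS y hy).2 hgy hx').1
      rw [hzf] at hD
      rw [heO z hzO, hzf, TT_eq hx' hD hzO.2 (by rw [hF.2.2, hσf hz]; ring), hF.2.2]
    · rw [heN z hzO]
      by_contra hne
      have h1 := Fib_strAbove_lt hx' (hFib _ (hm hz)) (Ne.symm hne)
      have h2 := hσf hz
      rw [hσN z hzO] at h2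
      simp only at h2
      linarith

lemma AE_insert (hS : ∀ z ∈ S, bruhatLE u z ∧ u ≠ z) (h : AE (YS S)) : AE (YS (insert u S)) := by
  obtain ⟨x₀, hx₀⟩ := (AE_Ycirc u).nonempty (1 : Mat n)
  have hle : ∀ z ∈ insert u S, bruhatLE u z := by
    intro z hz
    rcases Finset.mem_insert.1 hz with rfl | hz
    · exact bruhatLE_refl _
    · exact (hS z hz).1
  have hG : ∀ x ∈ YS (insert u S), x ∈ YY n ∧ x ∈ Gge u := by
    rintro x ⟨z, hz, hx⟩
    exact ⟨Ycirc_YY hx, Gge_of_le (hle z hz) hx⟩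
  have hXc : ContinuousOn (fun q : Mat n × Mat n => XX u q.1 (pc u q.2))
      (Ycirc u ×ˢ YS (insert u S)) := by
    intro q hq
    have h1 := continuousAt_XX (Ncell_Gge (Ycirc_Ncell hq.1)) (pc_mem (u := u) q.2)
    have h2 : ContinuousAt (fun q : Mat n × Mat n => (q.1, pc u q.2)) q :=
      continuousAt_fst.prodMk
        (ContinuousAt.comp (f := Prod.snd) (continuousAt_pc (hG _ hq.2).2) continuousAt_snd)
    exact (ContinuousAt.comp (f := fun q : Mat n × Mat n => (q.1, pc u q.2)) h1
      h2).continuousWithinAt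
  have hXm : ∀ x' ∈ Ycirc u, ∀ x ∈ YS (insert u S), XX u x' (pc u x) ∈ YS (insert u S) := by
    rintro x' hx' x ⟨z, hz, hx⟩
    have hx1 := hG x ⟨z, hz, hx⟩
    exact ⟨z, hz, XX_mem (pc_mem x) (piMap_mem hx1.1 hx1.2) (by rwa [XX_pc hx.1 hx1.2]) hx'⟩
  have hpi : ∀ x ∈ YS (insert u S), piMap u x ∈ Ycirc u := fun x hx =>
    piMap_mem (hG x hx).1 (hG x hx).2
  refine ((AE_Ycirc u).prod (AE_fiber hS h hx₀)).of_retract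
    (i := fun x => (piMap u x, XX u x₀ (pc u x))) (r := fun q => XX u q.1 (pc u q.2)) ?_ ?_ ?_ ?_ ?_
  · refine (continuousOn_piMap.mono fun x hx => ?_).prodMk
      (hXc.comp (f := fun x => (x₀, x)) (by fun_prop) fun x hx => ⟨hx₀, hx⟩)
    obtain ⟨z, hz, hxz⟩ := hx
    exact ⟨hxz.1, Gge_of_le (hle z hz) hxz⟩
  · intro x hx
    have hm := hXm x₀ hx₀ x hx
    have hF := XX_Fib (Ycirc_Ncell hx₀) (pc_mem x) (hG _ hm).1
    exact ⟨hpi x hx, hm, (Fib_spec (Ycirc_Ncell hx₀) hF).2.1⟩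
  · exact hXc.mono fun q hq => ⟨hq.1, hq.2.1⟩
  · exact fun q hq => hXm _ hq.1 _ hq.2.1
  · rintro x hx
    obtain ⟨z, hz, hxz⟩ := id hx
    simp only
    rw [pc_XX (Ycirc_Ncell hx₀) (pc_mem x), XX_pc hxz.1 (hG x hx).2]

lemma YS_inter_Gge {T : Finset (Equiv.Perm (Fin n))} (hTS : T ⊆ S)
    (hT : ∀ t ∈ T, ∀ z ∈ S, bruhatLE t z → z ∈ T) : YS S ∩ (⋃ t ∈ T, Gge t) = YS T := by
  ext x
  simp only [Set.mem_inter_iff, Set.mem_iUnion, exists_prop]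
  constructor
  · rintro ⟨⟨z, hz, hx⟩, t, ht, hxt⟩
    exact ⟨z, hT t ht z hz (bruhatLE_of_Gge hx.2.2 hxt), hx⟩
  · rintro ⟨z, hz, hx⟩
    exact ⟨⟨z, hTS hz, hx⟩, z, hz, Gge_of_le (bruhatLE_refl z) hx⟩

lemma YS_inter {T : Finset (Equiv.Perm (Fin n))} : YS S ∩ YS T = YS (S ∩ T) := by
  ext x
  constructor
  · rintro ⟨⟨z, hz, hx⟩, z', hz', hx'⟩
    obtain rfl := doubleCoset_disjoint hx.2.2 hx'.2.2
    exact ⟨z, Finset.mem_inter.2 ⟨hz, hz'⟩, hx⟩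
  · rintro ⟨z, hz, hx⟩
    exact ⟨⟨z, (Finset.mem_inter.1 hz).1, hx⟩, z, (Finset.mem_inter.1 hz).2, hx⟩

lemma exists_bruhat_minimal (hS : S.Nonempty) : ∃ w ∈ S, ∀ z ∈ S, bruhatLE z w → z = w := by
  let : PartialOrder (Equiv.Perm (Fin n)) :=
    { le := bruhatLE
      le_refl := bruhatLE_refl
      le_trans := fun _ _ _ => bruhatLE_trans
      le_antisymm := fun _ _ => bruhatLE_antisymm }
  obtain ⟨w, hw⟩ := S.exists_minimal hS
  exact ⟨w, hw.1, fun z hz h => bruhatLE_antisymm h (hw.2 hz h)⟩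

theorem AE_YS (hv : v ∈ S) (hle : ∀ z ∈ S, bruhatLE z v)
    (hup : ∀ z ∈ S, ∀ y, bruhatLE z y → bruhatLE y v → y ∈ S) : AE (YS S) := by
  induction S using Finset.strongInduction with
  | H S ih =>
  obtain ⟨w, hw, hmin⟩ := exists_bruhat_minimal ⟨v, hv⟩
  by_cases hall : ∀ z ∈ S, bruhatLE w z
  · by_cases hvw : v = w
    · have : YS S = Ycirc w := by
        ext x
        constructor
        · rintro ⟨z, hz, hx⟩
          rwa [← hmin z hz (hvw ▸ hle z hz)]
        · exact fun hx => ⟨w, hw, hx⟩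
      rw [this]
      exact AE_Ycirc w
    · rw [← Finset.insert_erase hw]
      refine AE_insert (fun z hz => ?_) (ih _ (Finset.erase_ssubset hw)
        (Finset.mem_erase.2 ⟨hvw, hv⟩) (fun z hz => hle z (Finset.mem_of_mem_erase hz)) ?_)
      · exact ⟨hall z (Finset.mem_of_mem_erase hz), (Finset.ne_of_mem_erase hz).symm⟩
      · intro z hz y hzy hyv
        refine Finset.mem_erase.2 ⟨?_, hup z (Finset.mem_of_mem_erase hz) y hzy hyv⟩
        rintro rfl
        exact Finset.ne_of_mem_erase hz (hmin z (Finset.mem_of_mem_erase hz) hzy)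
  · push Not at hall
    obtain ⟨z₀, hz₀, hwz₀⟩ := hall
    have hvw : v ≠ w := by
      rintro rfl
      exact hwz₀ (hmin z₀ hz₀ (hle z₀ hz₀) ▸ bruhatLE_refl _)
    have mem1 : ∀ z, z ∈ S.filter (bruhatLE w) ↔ z ∈ S ∧ bruhatLE w z := fun z =>
      Finset.mem_filter
    have mem2 : ∀ z, z ∈ S.erase w ↔ z ∈ S ∧ z ≠ w := fun z => by
      rw [Finset.mem_erase, and_comm]
    have sub1 : S.filter (bruhatLE w) ⊆ S := Finset.filter_subset _ _
    have sub2 : S.erase w ⊆ S := Finset.erase_subset _ _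
    have v1 : v ∈ S.filter (bruhatLE w) := (mem1 v).2 ⟨hv, hle w hw⟩
    have v2 : v ∈ S.erase w := (mem2 v).2 ⟨hv, hvw⟩
    have up1 : ∀ z ∈ S.filter (bruhatLE w), ∀ y ∈ S, bruhatLE z y → y ∈ S.filter (bruhatLE w) :=
      fun z hz y hy h => (mem1 y).2 ⟨hy, bruhatLE_trans ((mem1 z).1 hz).2 h⟩
    have up2 : ∀ z ∈ S.erase w, ∀ y ∈ S, bruhatLE z y → y ∈ S.erase w := by
      rintro z hz y hy h
      refine (mem2 y).2 ⟨hy, ?_⟩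
      rintro rfl
      exact ((mem2 z).1 hz).2 (hmin z (sub2 hz) h)
    have key : ∀ T ⊂ S, v ∈ T → (∀ z ∈ T, ∀ y ∈ S, bruhatLE z y → y ∈ T) → AE (YS T) :=
      fun T hT hvT hTu => ih T hT hvT (fun z hz => hle z (hT.1 hz))
        fun z hz y h h' => hTu z hz y (hup z (hT.1 hz) y h h') h
    have ss2 : S.erase w ⊂ S := Finset.erase_ssubset hw
    have ss1 : S.filter (bruhatLE w) ⊂ S :=
      (Finset.ssubset_iff_of_subset sub1).2 ⟨z₀, hz₀, fun h => hwz₀ ((mem1 z₀).1 h).2⟩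
    have e1 := YS_inter_Gge sub1 up1
    have e2 := YS_inter_Gge sub2 up2
    refine AE.union (isOpen_biUnion fun _ _ => isOpen_Gge) (isOpen_biUnion fun _ _ => isOpen_Gge)
      (U₁ := ⋃ t ∈ S.filter (bruhatLE w), Gge t) (U₂ := ⋃ t ∈ S.erase w, Gge t) ?_ ?_ ?_ ?_
    · rintro x ⟨z, hz, hx⟩
      have hxz := Gge_of_le (bruhatLE_refl z) hx
      by_cases hzw : z = w
      · exact Or.inl (Set.mem_biUnion ((mem1 z).2 ⟨hz, hzw ▸ bruhatLE_refl _⟩) hxz)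
      · exact Or.inr (Set.mem_biUnion ((mem2 z).2 ⟨hz, hzw⟩) hxz)
    · rw [e1]
      exact key _ ss1 v1 up1
    · rw [e2]
      exact key _ ss2 v2 up2
    · rw [Set.inter_inter_distrib_left, e1, e2, YS_inter]
      refine key _ (Finset.inter_subset_right.trans_ssubset ss2) (Finset.mem_inter.2 ⟨v1, v2⟩) ?_
      intro z hz y hy h
      obtain ⟨h1, h2⟩ := Finset.mem_inter.1 hz
      exact Finset.mem_inter.2 ⟨up1 z h1 y hy h, up2 z h2 y hy h⟩

end

theorem statement19 (n : ℕ) (hn : 1 ≤ n) (u v : Equiv.Perm (Fin n))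
    (huv : bruhatLE u v) (hne : u ≠ v) (xu : Mat n) (hxu : xu ∈ Ycirc u)
    (ε : ℝ) (hε : 0 < ε) :
    ({x : Mat n | (∃ w, bruhatLE u w ∧ bruhatLE w v ∧ x ∈ Ycirc w) ∧
        piMap u x = xu ∧ strAbove x = strAbove xu + ε}).Nonempty ∧
    ContractibleSpace
      ↥{x : Mat n | (∃ w, bruhatLE u w ∧ bruhatLE w v ∧ x ∈ Ycirc w) ∧
        piMap u x = xu ∧ strAbove x = strAbove xu + ε} := by
  have key : AE {x : Mat n | (∃ w, bruhatLE u w ∧ bruhatLE w v ∧ x ∈ Ycirc w) ∧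
      piMap u x = xu ∧ strAbove x = strAbove xu + ε} := by
    set S : Finset (Equiv.Perm (Fin n)) :=
      Finset.univ.filter fun z => bruhatLE u z ∧ bruhatLE z v ∧ u ≠ z with hS
    have mem : ∀ z, z ∈ S ↔ bruhatLE u z ∧ bruhatLE z v ∧ u ≠ z := fun z => by simp [hS]
    have h : AE (YS S) := by
      refine AE_YS ((mem v).2 ⟨huv, bruhatLE_refl v, hne⟩) (fun z hz => ((mem z).1 hz).2.1) ?_
      intro z hz y hzy hyv
      obtain ⟨h1, -, h3⟩ := (mem z).1 hz
      refine (mem y).2 ⟨bruhatLE_trans h1 hzy, hyv, ?_⟩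
      rintro rfl
      exact h3 (bruhatLE_antisymm h1 hzy)
    convert AE_sphere (fun z hz => ⟨((mem z).1 hz).1, ((mem z).1 hz).2.2⟩) h hxu hε using 1
    ext x
    refine and_congr_left fun ⟨hp, hs⟩ => ⟨?_, ?_⟩
    · rintro ⟨w, h1, h2, hx⟩
      refine ⟨w, (mem w).2 ⟨h1, h2, ?_⟩, hx⟩
      rintro rfl
      rw [piMap_self (Ycirc_Ncell hx)] at hp
      rw [hp] at hs
      linarith
    · rintro ⟨w, hw, hx⟩
      exact ⟨w, ((mem w).1 hw).1, ((mem w).1 hw).2.1, hx⟩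
  exact ⟨key.nonempty 1, key.contractible 1⟩

end BruhatTNN
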